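/- arXiv:2011.04483 — 3 statements merged into one kernel-verified Lean document; each statement's English description precedes it below -/
import Mathlib

section
/- Theorem 5.3 (linear upper bound): Let 𝒳 be a Polish space and ℋ a measurable concept class. If ℋ does not have an infinite VCL tree, then there exists a learning algorithm ĥ_n such that for every realizable distribution P there exists C > 0 with E[er_P(ĥ_n)] ≤ C/n for all n ≥ 1; i.e., ℋ is learnable at rate 1/n. -/
open scoped ENNReal

/-- A function is universally measurable if it is measurable with respect to (the completion of)
every Borel probability measure on its domain. -/
def UniversallyMeasurable {α β : Type*} [MeasurableSpace α] [MeasurableSpace β] (f : α → β) : Prop :=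
  ∀ μ : MeasureTheory.Measure α, MeasureTheory.IsProbabilityMeasure μ →
    MeasureTheory.NullMeasurable f μ

variable {𝒳 : Type*}

/-- The error of a classifier `h` under distribution `P` on `𝒳 × {0,1}`. -/
noncomputable def errP [MeasurableSpace 𝒳] (P : MeasureTheory.Measure (𝒳 × Bool))
    (h : 𝒳 → Bool) : ℝ≥0∞ :=
  P {p : 𝒳 × Bool | h p.1 ≠ p.2}

/-- `P` is realizable w.r.t. the concept class `ℋ`: `inf_{h ∈ ℋ} er_P(h) = 0`. -/
def Realizable [MeasurableSpace 𝒳] (ℋ : Set (𝒳 → Bool))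
    (P : MeasureTheory.Measure (𝒳 × Bool)) : Prop :=
  (⨅ h ∈ ℋ, errP P h) = 0

/-- A learning algorithm: a sequence of universally measurable maps
`H_n : (𝒳 × {0,1})^n × 𝒳 → {0,1}`. -/
structure LearningAlgorithm (𝒳 : Type*) [MeasurableSpace 𝒳] where
  H : ∀ n : ℕ, (Fin n → 𝒳 × Bool) → 𝒳 → Bool
  meas : ∀ n : ℕ, UniversallyMeasurable fun q : (Fin n → 𝒳 × Bool) × 𝒳 => H n q.1 q.2

/-- Expected error `E[er_P(ĥ_n)]` of the output of a learning algorithm on an i.i.d. sample of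
size `n` from `P`, i.e. integration with respect to `P^{⊗n}`. -/
noncomputable def expErr [MeasurableSpace 𝒳] (P : MeasureTheory.Measure (𝒳 × Bool))
    (A : LearningAlgorithm 𝒳) (n : ℕ) : ℝ≥0∞ :=
  MeasureTheory.lintegral (MeasureTheory.Measure.pi fun _ : Fin n => P)
    fun s => errP P (A.H n s)

/-- A rate function: `R : ℕ → [0,1]` with `R(n) → 0`. -/
def IsRate (R : ℕ → ℝ) : Prop :=
  (∀ n, R n ∈ Set.Icc (0 : ℝ) 1) ∧ Filter.Tendsto R Filter.atTop (nhds 0)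

/-- `ℋ` is learnable at rate `R`. -/
def LearnableAtRate [MeasurableSpace 𝒳] (ℋ : Set (𝒳 → Bool)) (R : ℕ → ℝ) : Prop :=
  ∃ A : LearningAlgorithm 𝒳,
    ∀ P : MeasureTheory.Measure (𝒳 × Bool),
      MeasureTheory.IsProbabilityMeasure P → Realizable ℋ P →
        ∃ C > (0 : ℝ), ∃ c > (0 : ℝ), ∀ n : ℕ,
          expErr P A n ≤ ENNReal.ofReal (C * R ⌈c * (n : ℝ)⌉₊)

/-- `ℋ` is not learnable at rate faster than `R`. -/
def NotLearnableFasterThan [MeasurableSpace 𝒳] (ℋ : Set (𝒳 → Bool)) (R : ℕ → ℝ) : Prop :=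
  ∀ A : LearningAlgorithm 𝒳,
    ∃ P : MeasureTheory.Measure (𝒳 × Bool),
      MeasureTheory.IsProbabilityMeasure P ∧ Realizable ℋ P ∧
        ∃ C > (0 : ℝ), ∃ c > (0 : ℝ),
          {n : ℕ | ENNReal.ofReal (C * R ⌈c * (n : ℝ)⌉₊) ≤ expErr P A n}.Infinite

/-- `ℋ` is learnable with optimal rate `R`. -/
def LearnableWithOptimalRate [MeasurableSpace 𝒳] (ℋ : Set (𝒳 → Bool)) (R : ℕ → ℝ) : Prop :=
  LearnableAtRate ℋ R ∧ NotLearnableFasterThan ℋ R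

/-- `ℋ` requires arbitrarily slow rates. -/
def RequiresArbitrarilySlowRates [MeasurableSpace 𝒳] (ℋ : Set (𝒳 → Bool)) : Prop :=
  ∀ R : ℕ → ℝ, IsRate R → NotLearnableFasterThan ℋ R

/-- Witness that `ℋ` is a measurable class: it is parameterized by a Polish space `Θ` via a
Borel measurable map `𝗁 : Θ × 𝒳 → {0,1}`. -/
structure MeasurableClassWitness (𝒳 : Type*) [MeasurableSpace 𝒳] (ℋ : Set (𝒳 → Bool)) where
  Θ : Type
  [tΘ : TopologicalSpace Θ]
  [mΘ : MeasurableSpace Θ]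
  [polish : PolishSpace Θ]
  [borel : BorelSpace Θ]
  f : Θ → 𝒳 → Bool
  meas : Measurable (Function.uncurry f)
  range_eq : ℋ = Set.range f

/-- `ℋ` is a measurable class (image admissible Suslin). -/
def MeasurableClass (𝒳 : Type*) [MeasurableSpace 𝒳] (ℋ : Set (𝒳 → Bool)) : Prop :=
  Nonempty (MeasurableClassWitness 𝒳 ℋ)

/-- `ℋ` has an infinite Littlestone tree: nodes are indexed by finite binary strings, and every
finite branch is consistent with some concept in `ℋ`. -/
def HasInfiniteLittlestoneTree (ℋ : Set (𝒳 → Bool)) : Prop :=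
  ∃ x : List Bool → 𝒳, ∀ (y : ℕ → Bool) (n : ℕ),
    ∃ h ∈ ℋ, ∀ k ≤ n, h (x (List.ofFn fun i : Fin k => y i)) = y k

/-- `ℋ` has an infinite VCL tree: the node at depth `k` along a branch is a `(k+1)`-tuple of
points, edges out of it are labelled by `{0,1}^{k+1}`, and every finite branch is consistent
with some concept in `ℋ`. -/
def HasInfiniteVCLTree (ℋ : Set (𝒳 → Bool)) : Prop :=
  ∃ x : ∀ k : ℕ, (∀ j : Fin k, Fin (j.val + 1) → Bool) → Fin (k + 1) → 𝒳,
    ∀ (y : ∀ k : ℕ, Fin (k + 1) → Bool) (n : ℕ),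
      ∃ h ∈ ℋ, ∀ k ≤ n, ∀ i : Fin (k + 1),
        h (x k (fun j => y j.val) i) = y k i

namespace VCLGame

/-- A labelled point, given by the digits of a code and its label. -/
abbrev LabelledCode := (ℕ → ℕ) × Bool

/-- A tree of codes: `z u i d` is the `d`-th digit of the `i`-th code stored at node `u`; the code
with index `0` is a witness of consistency, the other ones are the points at the node. -/
abbrev CodeTree := List ℕ → ℕ → ℕ → ℕ

/-- The subtree below the child `y` of the root. -/
def CodeTree.sub (z : CodeTree) (y : ℕ) : CodeTree := fun u => z (y :: u)

/-- The tree with data `r` at the root and subtrees `t y`. -/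
def CodeTree.graft (r : ℕ → ℕ → ℕ) (t : ℕ → CodeTree) : CodeTree
  | [] => r
  | y :: u => t y u

/-- Equality of labels and of the first `n` digits. -/
def Agree (n : ℕ) (c c' : LabelledCode) : Prop := (∀ d < n, c.1 d = c'.1 d) ∧ c.2 = c'.2

lemma Agree.refl (n : ℕ) (c : LabelledCode) : Agree n c c := ⟨fun _ _ => rfl, rfl⟩

lemma Agree.symm {n : ℕ} {c c' : LabelledCode} (h : Agree n c c') : Agree n c' c :=
  ⟨fun d hd => (h.1 d hd).symm, h.2.symm⟩

lemma Agree.trans {n : ℕ} {c c' c'' : LabelledCode} (h : Agree n c c') (h' : Agree n c' c'') :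
    Agree n c c'' :=
  ⟨fun d hd => (h.1 d hd).trans (h'.1 d hd), h.2.trans h'.2⟩

lemma Agree.mono {m n : ℕ} (hmn : m ≤ n) {c c' : LabelledCode} (h : Agree n c c') :
    Agree m c c' :=
  ⟨fun d hd => h.1 d (hd.trans_le hmn), h.2⟩

lemma forall₂_agree_refl (n : ℕ) (L : List LabelledCode) : List.Forall₂ (Agree n) L L :=
  List.forall₂_same.2 fun c _ => Agree.refl n c

lemma forall₂_agree_symm {n : ℕ} {L L' : List LabelledCode} (h : List.Forall₂ (Agree n) L L') :
    List.Forall₂ (Agree n) L' L :=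
  (h.imp fun _ _ h => h.symm).flip

lemma forall₂_agree_trans {n : ℕ} {L L' L'' : List LabelledCode}
    (h : List.Forall₂ (Agree n) L L') (h' : List.Forall₂ (Agree n) L' L'') :
    List.Forall₂ (Agree n) L L'' := by
  induction h generalizing L'' with
  | nil => exact h'
  | cons hab _ ih =>
    cases h' with
    | cons hbc hr => exact .cons (hab.trans hbc) (ih hr)

/-- The `n`-digit approximation of a relation between labelled samples and witnesses. -/
def Approx (F : List LabelledCode → (ℕ → ℕ) → Prop) (n : ℕ) (L : List LabelledCode)
    (ζ : ℕ → ℕ) : Prop :=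
  ∃ L' ζ', F L' ζ' ∧ List.Forall₂ (Agree n) L L' ∧ ∀ d < n, ζ d = ζ' d

section

variable {F : List LabelledCode → (ℕ → ℕ) → Prop}

lemma Approx.congr {n : ℕ} {L L' : List LabelledCode} {ζ ζ' : ℕ → ℕ} (h : Approx F n L ζ)
    (hL : List.Forall₂ (Agree n) L L') (hζ : ∀ d < n, ζ d = ζ' d) : Approx F n L' ζ' := by
  obtain ⟨M, ξ, hF, hM, hξ⟩ := h
  exact ⟨M, ξ, hF, forall₂_agree_trans (forall₂_agree_symm hL) hM,
    fun d hd => (hζ d hd).symm.trans (hξ d hd)⟩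

lemma Approx.mono {m n : ℕ} (hmn : m ≤ n) {L : List LabelledCode} {ζ : ℕ → ℕ}
    (h : Approx F n L ζ) : Approx F m L ζ := by
  obtain ⟨M, ξ, hF, hM, hξ⟩ := h
  exact ⟨M, ξ, hF, hM.imp fun _ _ h => h.mono hmn, fun d hd => hξ d (hd.trans_le hmn)⟩

/-- The block of `k + 1` labelled points at a node with data `r`, labelled by the bits of `y`. -/
def block (k : ℕ) (r : ℕ → ℕ → ℕ) (y : ℕ) : List LabelledCode :=
  (List.range (k + 1)).map fun i => (r (i + 1), y.testBit i)

/-- Agreement of two trees rooted at depth `k`, up to precision `n`. -/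
def Ext : ℕ → ℕ → CodeTree → CodeTree → Prop
  | _, 0, _, _ => True
  | k, n + 1, z, z' => (∀ i ≤ k + 1, ∀ d < n + 1, z [] i d = z' [] i d) ∧
      ∀ y < 2 ^ (k + 1), Ext (k + 1) n (z.sub y) (z'.sub y)

variable (F) in
/-- Consistency of a tree rooted at depth `k`, up to precision `n`, with the sample `L`. -/
def Consistent : ℕ → ℕ → List LabelledCode → CodeTree → Prop
  | _, 0, _, _ => True
  | k, n + 1, L, z => Approx F (n + 1) L (z [] 0) ∧
      ∀ y < 2 ^ (k + 1), Consistent (k + 1) n (L ++ block k (z []) y) (z.sub y)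

lemma Ext.refl (k n : ℕ) (z : CodeTree) : Ext k n z z := by
  induction n generalizing k z with
  | zero => trivial
  | succ n ih => exact ⟨fun _ _ _ _ => rfl, fun y _ => ih _ _⟩

lemma Ext.symm {k n : ℕ} {z z' : CodeTree} (h : Ext k n z z') : Ext k n z' z := by
  induction n generalizing k z z' with
  | zero => trivial
  | succ n ih => exact ⟨fun i hi d hd => (h.1 i hi d hd).symm, fun y hy => ih (h.2 y hy)⟩

lemma Ext.trans {k n : ℕ} {z z' z'' : CodeTree} (h : Ext k n z z') (h' : Ext k n z' z'') :
    Ext k n z z'' := by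
  induction n generalizing k z z' z'' with
  | zero => trivial
  | succ n ih =>
    exact ⟨fun i hi d hd => (h.1 i hi d hd).trans (h'.1 i hi d hd),
      fun y hy => ih (h.2 y hy) (h'.2 y hy)⟩

lemma Ext.of_succ {k n : ℕ} {z z' : CodeTree} (h : Ext k (n + 1) z z') : Ext k n z z' := by
  induction n generalizing k z z' with
  | zero => trivial
  | succ n ih =>
    exact ⟨fun i hi d hd => h.1 i hi d (hd.trans (Nat.lt_succ_self _)),
      fun y hy => ih (h.2 y hy)⟩

lemma isOpen_setOf_ext (k n : ℕ) (z : CodeTree) : IsOpen {z' | Ext k n z z'} := by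
  induction n generalizing k z with
  | zero => simp [Ext]
  | succ n ih =>
    have h1 : IsOpen {z' : CodeTree | ∀ i ≤ k + 1, ∀ d < n + 1, z [] i d = z' [] i d} := by
      simp only [Set.ofPred_forall]
      refine (Set.finite_le_nat (k + 1)).isOpen_biInter fun i _ =>
        (Set.finite_lt_nat (n + 1)).isOpen_biInter fun d _ => ?_
      exact (isOpen_discrete {m : ℕ | z [] i d = m}).preimage
        (show Continuous fun z' : CodeTree => z' [] i d by fun_prop)
    have h2 : IsOpen {z' : CodeTree | ∀ y < 2 ^ (k + 1), Ext (k + 1) n (z.sub y) (z'.sub y)} := by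
      simp only [Set.ofPred_forall]
      refine (Set.finite_lt_nat (2 ^ (k + 1))).isOpen_biInter fun y _ => ?_
      refine (ih (k + 1) (z.sub y)).preimage (f := fun z' : CodeTree => z'.sub y) ?_
      exact continuous_pi fun u => continuous_apply _
    exact h1.inter h2

lemma block_agree {k n : ℕ} {r r' : ℕ → ℕ → ℕ} (y : ℕ)
    (h : ∀ i ≤ k + 1, ∀ d < n, r i d = r' i d) :
    List.Forall₂ (Agree n) (block k r y) (block k r' y) := by
  unfold block
  rw [List.forall₂_map_left_iff, List.forall₂_map_right_iff, List.forall₂_same]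
  intro i hi
  rw [List.mem_range] at hi
  exact ⟨fun d hd => h _ (by omega) d hd, rfl⟩

lemma Consistent.congr {k n : ℕ} {L L' : List LabelledCode} {z z' : CodeTree}
    (h : Consistent F k n L z) (hL : List.Forall₂ (Agree n) L L') (hz : Ext k n z z') :
    Consistent F k n L' z' := by
  induction n generalizing k L L' z z' with
  | zero => trivial
  | succ n ih =>
    refine ⟨h.1.congr hL (hz.1 0 (by omega)), fun y hy => ih (h.2 y hy) ?_ (hz.2 y hy)⟩
    exact List.rel_append (hL.imp fun _ _ h => h.mono (Nat.le_succ n))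
      (block_agree y fun i hi d hd => hz.1 i hi d (hd.trans (Nat.lt_succ_self _)))

lemma Consistent.of_succ {k n : ℕ} {L : List LabelledCode} {z : CodeTree}
    (h : Consistent F k (n + 1) L z) : Consistent F k n L z := by
  induction n generalizing k L z with
  | zero => trivial
  | succ n ih => exact ⟨h.1.mono (Nat.le_succ _), fun y hy => ih (h.2 y hy)⟩

lemma Consistent.mono {k m n : ℕ} (hmn : m ≤ n) {L : List LabelledCode} {z : CodeTree}
    (h : Consistent F k n L z) : Consistent F k m L z := by
  induction hmn with
  | refl => exact h
  | step _ ih => exact ih h.of_succ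

lemma ext_limit (k n : ℕ) (z : ℕ → CodeTree) (hz : ∀ m, Ext k m (z m) (z (m + 1))) :
    Ext k n (z n) fun u i d => z (u.length + d + 1) u i d := by
  induction n generalizing k z with
  | zero => trivial
  | succ n ih =>
    refine ⟨fun i hi d hd => ?_, fun y hy => ?_⟩
    · have key : ∀ m, d < m → z m [] i d = z (d + 1) [] i d := by
        intro m hm
        induction m, hm using Nat.le_induction with
        | base => rfl
        | succ m hm ih =>
          obtain ⟨m, rfl⟩ : ∃ m', m = m' + 1 := ⟨m - 1, by omega⟩
          exact (((hz (m + 1)).1 i hi d hm).symm).trans ih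
      simpa using key (n + 1) hd
    · have := ih (k + 1) (fun m => (z (m + 1)).sub y) fun m => (hz (m + 1)).2 y hy
      have h2 : CodeTree.sub (fun u i d => z (u.length + d + 1) u i d) y =
          fun u i d => (z (u.length + d + 1 + 1)).sub y u i d := by
        funext u i d
        simp only [CodeTree.sub, List.length_cons]
        congr 1
        omega
      rw [h2]
      exact this

/-! ### Domination of the trees extending a sample by a well-founded relation -/

section Dominated

variable {W : Type*} {r : W → W → Prop} (hr : WellFounded r) (δ : ℕ → CodeTree)

variable (F) in
/-- The tree of approximate code trees that extend `z` and are consistent with `L` has rank at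
most the rank of `s`. -/
def Dominated (k : ℕ) (L : List LabelledCode) : W → ℕ → CodeTree → Prop :=
  hr.fix fun s ih n z => ∀ a, Ext k n z (δ a) → Consistent F k (n + 1) L (δ a) →
    ∃ s', ∃ h : r s' s, ih s' h (n + 1) (δ a)

lemma dominated_iff {k : ℕ} {L : List LabelledCode} {s : W} {n : ℕ} {z : CodeTree} :
    Dominated F hr δ k L s n z ↔
      ∀ a, Ext k n z (δ a) → Consistent F k (n + 1) L (δ a) →
        ∃ s', r s' s ∧ Dominated F hr δ k L s' (n + 1) (δ a) := by
  unfold Dominated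
  rw [WellFounded.fix_eq]
  simp only [exists_prop]

lemma Dominated.congr {k : ℕ} {L : List LabelledCode} {s : W} {n : ℕ} {z z' : CodeTree}
    (h : Dominated F hr δ k L s n z) (hz : Ext k n z z') : Dominated F hr δ k L s n z' := by
  rw [dominated_iff] at h ⊢
  exact fun a ha hc => h a (hz.trans ha) hc

variable (hδ : ∀ k n z, ∃ a, Ext k n z (δ a))

include hδ in
lemma Dominated.exists_of_consistent {k : ℕ} {L : List LabelledCode} {s : W} {n : ℕ}
    {z z' : CodeTree} (h : Dominated F hr δ k L s n z) (hz : Ext k n z z')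
    (hc : Consistent F k (n + 1) L z') :
    ∃ s', r s' s ∧ Dominated F hr δ k L s' (n + 1) z' := by
  obtain ⟨a, ha⟩ := hδ k (n + 1) z'
  rw [dominated_iff] at h
  obtain ⟨s', hs', hd⟩ := h a (hz.trans ha.of_succ) (hc.congr (forall₂_agree_refl _ _) ha)
  exact ⟨s', hs', hd.congr hr δ ha.symm⟩

include hδ in
lemma not_dominated_graft {k : ℕ} {L : List LabelledCode} {ρ : ℕ → ℕ → ℕ}
    (hρ : ∀ n, Approx F n L (ρ 0)) (s : W) (n : ℕ) (t : ℕ → CodeTree)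
    (ht : ∀ y < 2 ^ (k + 1), ¬ Dominated F hr δ (k + 1) (L ++ block k ρ y) s n (t y)) :
    ¬ Dominated F hr δ k L s (n + 1) (CodeTree.graft ρ t) := by
  induction s using hr.induction generalizing n t with
  | _ s ih =>
    have h1 : ∀ y, ∃ t', y < 2 ^ (k + 1) → (Ext (k + 1) n (t y) t' ∧
        Consistent F (k + 1) (n + 1) (L ++ block k ρ y) t' ∧
        ∀ s', r s' s → ¬ Dominated F hr δ (k + 1) (L ++ block k ρ y) s' (n + 1) t') := by
      intro y
      by_cases hy : y < 2 ^ (k + 1)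
      · have := ht y hy
        rw [dominated_iff] at this
        push Not at this
        obtain ⟨a, h1, h2, h3⟩ := this
        exact ⟨δ a, fun _ => ⟨h1, h2, h3⟩⟩
      · exact ⟨t y, fun h => absurd h hy⟩
    choose t' ht' using h1
    intro hd
    obtain ⟨s', hs', hd'⟩ := hd.exists_of_consistent hr δ hδ (z' := CodeTree.graft ρ t')
      ⟨fun _ _ _ _ => rfl, fun y hy => (ht' y hy).1⟩
      ⟨hρ _, fun y hy => (ht' y hy).2.1⟩
    exact ih s' hs' (n + 1) t' (fun y hy => (ht' y hy).2.2 s' hs') hd'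

include hδ in
/-- If the sample `L` is consistent, then for every choice of the next block of points some
labelling strictly decreases the rank. -/
lemma Dominated.exists_block {k : ℕ} {L : List LabelledCode} {ρ : ℕ → ℕ → ℕ}
    (hρ : ∀ n, Approx F n L (ρ 0)) {s : W} {z : CodeTree} (h : Dominated F hr δ k L s 0 z) :
    ∃ y < 2 ^ (k + 1), ∃ s', r s' s ∧ Dominated F hr δ (k + 1) (L ++ block k ρ y) s' 0 z := by
  by_contra! hcon
  obtain ⟨s', hs', hd⟩ := h.exists_of_consistent hr δ hδ
    (z' := CodeTree.graft ρ fun _ => z) trivial ⟨hρ _, fun y _ => trivial⟩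
  exact not_dominated_graft hr δ hδ hρ s' 0 _ (fun y hy => hcon y hy s' hs') hd

end Dominated

/-! ### The well-founded relation of approximate code trees -/

variable (F) in
/-- One-step extension of approximate code trees (of given precisions) without initial sample. -/
def Refines (δ : ℕ → CodeTree) (s' s : ℕ × ℕ) : Prop :=
  s'.1 = s.1 + 1 ∧ Ext 0 s.1 (δ s.2) (δ s'.2) ∧ Consistent F 0 (s.1 + 1) [] (δ s'.2)

lemma dominated_refines (δ : ℕ → CodeTree) (hr : WellFounded (Refines F δ)) (s : ℕ × ℕ) :
    Dominated F hr δ 0 [] s s.1 (δ s.2) := by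
  induction s using hr.induction with
  | _ s ih =>
    rw [dominated_iff]
    intro a ha hc
    exact ⟨(s.1 + 1, a), ⟨rfl, ha, hc⟩, ih (s.1 + 1, a) ⟨rfl, ha, hc⟩⟩

lemma wellFounded_refines (δ : ℕ → CodeTree)
    (hF : ∀ z, ¬ ∀ n, Consistent F 0 n [] z) : WellFounded (Refines F δ) := by
  rw [wellFounded_iff_isEmpty_descending_chain]
  refine ⟨fun ⟨f, hf⟩ => ?_⟩
  have hlev : ∀ i, (f i).1 = (f 0).1 + i := by
    intro i
    induction i with
    | zero => rfl
    | succ i ih => rw [(hf i).1, ih]; rfl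
  set n₀ := (f 0).1
  set z : ℕ → CodeTree := fun m => δ (f (m - n₀)).2 with hzdef
  have hz : ∀ m, Ext 0 m (z m) (z (m + 1)) := by
    intro m
    by_cases hm : m < n₀
    · have : m + 1 - n₀ = m - n₀ := by omega
      simp only [hzdef, this]
      exact Ext.refl _ _ _
    · have h1 : m + 1 - n₀ = (m - n₀) + 1 := by omega
      have h2 := (hf (m - n₀)).2.1
      rw [hlev, Nat.add_sub_cancel' (not_lt.1 hm)] at h2
      simp only [hzdef, h1]
      exact h2
  refine hF (fun u i d => z (u.length + d + 1) u i d) fun n => ?_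
  have h1 := ext_limit 0 (n₀ + n + 1) z hz
  refine Consistent.mono (show n ≤ n₀ + n + 1 by omega) (Consistent.congr ?_ (.nil) h1)
  have h2 := (hf n).2.2
  rw [hlev] at h2
  have h3 : n₀ + n + 1 - n₀ = n + 1 := by omega
  simp only [hzdef, h3]
  exact h2

end

open MeasureTheory

/-- `L` is a labelled sample that is consistent with some concept of `ℋ`. -/
def ConsistentSample (ℋ : Set (𝒳 → Bool)) (L : List (𝒳 × Bool)) : Prop :=
  ∃ h ∈ ℋ, ∀ p ∈ L, h p.1 = p.2

/-- The code of a labelled point. -/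
def labelledCode (ι : 𝒳 → ℕ → ℕ) (p : 𝒳 × Bool) : LabelledCode := (ι p.1, p.2)

lemma eq_of_agree_of_tendsto {m : ℕ} {u : ℕ → Fin m → LabelledCode} {a b : Fin m → LabelledCode}
    (ha : Filter.Tendsto u Filter.atTop (nhds a)) (hb : ∀ n i, Agree n (b i) (u n i)) :
    a = b := by
  refine tendsto_nhds_unique ha ?_
  rw [tendsto_pi_nhds]
  refine fun i => Filter.Tendsto.prodMk_nhds ?_ ?_
  · rw [tendsto_pi_nhds]
    refine fun d => tendsto_const_nhds.congr' ?_
    filter_upwards [Filter.eventually_gt_atTop d] with n hn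
    exact (hb n i).1 d hn
  · exact tendsto_const_nhds.congr fun n => (hb n i).2

/-- Consistency of labelled samples with a measurable class is the projection of a relation that
is determined by its finite approximations. -/
theorem exists_closed_relation [MeasurableSpace 𝒳] [TopologicalSpace 𝒳] [PolishSpace 𝒳]
    [BorelSpace 𝒳] {ℋ : Set (𝒳 → Bool)} (hℋ : MeasurableClass 𝒳 ℋ) {ι : 𝒳 → ℕ → ℕ}
    (hι : Measurable ι) :
    ∃ F : List LabelledCode → (ℕ → ℕ) → Prop,
      (∀ L, ConsistentSample ℋ L → ∃ ζ, ∀ n, Approx F n (L.map (labelledCode ι)) ζ) ∧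
      ∀ M ζ, (∀ n, Approx F n M ζ) → ∃ L, L.map (labelledCode ι) = M ∧ ConsistentSample ℋ L := by
  obtain ⟨w⟩ := hℋ
  let _ := w.tΘ
  let _ := w.mΘ
  have := w.polish
  have := w.borel
  let φ : ∀ m : ℕ, w.Θ × (Fin m → 𝒳) → Fin m → LabelledCode :=
    fun m q i => (ι (q.2 i), w.f q.1 (q.2 i))
  have hφ : ∀ m, Measurable (φ m) := by
    intro m
    refine measurable_pi_lambda _ fun i => Measurable.prodMk ?_ ?_
    · exact hι.comp ((measurable_pi_apply i).comp measurable_snd)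
    · exact w.meas.comp (measurable_fst.prodMk ((measurable_pi_apply i).comp measurable_snd))
  have hg : ∀ m, ∃ g : (ℕ → ℕ) → Fin m → LabelledCode, Continuous g ∧
      ((Set.range (φ m)).Nonempty → Set.range g = Set.range (φ m)) := by
    intro m
    have h := MeasurableSet.univ.analyticSet_image (hφ m)
    rw [Set.image_univ, AnalyticSet] at h
    rcases h with h | ⟨g, hg, hr⟩
    · exact ⟨fun _ _ => (fun _ => 0, false), continuous_const, fun h' => by simp [h] at h'⟩
    · exact ⟨g, hg, fun _ => hr⟩
  choose g hgc hgr using hg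
  refine ⟨fun L ζ => (Set.range (φ L.length)).Nonempty ∧ List.ofFn (g L.length ζ) = L, ?_, ?_⟩
  · rintro L ⟨h, hh, hL⟩
    rw [w.range_eq] at hh
    obtain ⟨θ, rfl⟩ := hh
    have hlen : (L.map (labelledCode ι)).length = L.length := List.length_map _
    have h1 : φ L.length (θ, L.get ∘ Fin.cast rfl |> fun v i => (v i).1) ∈
        Set.range (φ L.length) := ⟨_, rfl⟩
    have hne : (Set.range (φ L.length)).Nonempty := ⟨_, h1⟩
    rw [← hgr _ hne] at h1
    obtain ⟨ζ, hζ⟩ := h1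
    refine ⟨ζ, fun n => ⟨L.map (labelledCode ι), ζ, ⟨?_, ?_⟩, forall₂_agree_refl _ _,
      fun _ _ => rfl⟩⟩
    · rw [hlen]; exact hne
    · rw [hlen, hζ]
      apply List.ext_get
      · simp
      · intro i h1 h2
        simp only [List.length_ofFn] at h1
        simpa [φ, labelledCode] using hL L[i] (List.getElem_mem h1)
  · intro M ζ hM
    choose L ζ' hF hL hζ using hM
    have hlen : ∀ n, (L n).length = M.length := fun n => (hL n).length_eq.symm
    have hne : (Set.range (φ M.length)).Nonempty := hlen 0 ▸ (hF 0).1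
    have hlim : Filter.Tendsto ζ' Filter.atTop (nhds ζ) := by
      rw [tendsto_pi_nhds]
      refine fun d => tendsto_const_nhds.congr' ?_
      filter_upwards [Filter.eventually_gt_atTop d] with n hn
      exact hζ n d hn
    have hM : g M.length ζ = M.get := by
      refine eq_of_agree_of_tendsto (((hgc M.length).tendsto ζ).comp hlim) fun n i => ?_
      have h1 := (hF n).2
      rw [hlen n] at h1
      have h2 := (List.forall₂_iff_get.1 (hL n)).2 i i.2 ((hlen n).symm ▸ i.2)
      have h3 : (L n).get ⟨i, (hlen n).symm ▸ i.2⟩ = g M.length (ζ' n) i := by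
        simp only [← h1, List.get_eq_getElem, List.getElem_ofFn]
      rw [h3] at h2
      exact h2
    have h1 : M.get ∈ Set.range (φ M.length) := hgr _ hne ▸ ⟨ζ, hM⟩
    obtain ⟨⟨θ, x⟩, hx⟩ := h1
    refine ⟨List.ofFn fun i => (x i, w.f θ (x i)), ?_, w.f θ, ?_, ?_⟩
    · rw [List.map_ofFn]
      conv_rhs => rw [← List.ofFn_get M, ← hx]
      rfl
    · exact w.range_eq.ge ⟨θ, rfl⟩
    · intro p hp
      rw [List.mem_ofFn] at hp
      obtain ⟨i, rfl⟩ := hp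
      rfl

/-- The labelled sample collected along the branch `b` of a code tree. -/
def branchSample (z : CodeTree) (b : ℕ → ℕ) : ℕ → List LabelledCode
  | 0 => []
  | k + 1 => branchSample z b k ++ block k (z ((List.range k).map b)) (b k)

lemma consistent_branchSample {F : List LabelledCode → (ℕ → ℕ) → Prop} {z : CodeTree}
    (hz : ∀ n, Consistent F 0 n [] z) {b : ℕ → ℕ} (hb : ∀ k, b k < 2 ^ (k + 1)) (k n : ℕ) :
    Consistent F k n (branchSample z b k) fun u => z ((List.range k).map b ++ u) := by
  induction k generalizing n with
  | zero => exact hz n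
  | succ k ih =>
    have h := (ih (n + 1)).2 (b k) (hb k)
    simp only [List.append_nil] at h
    convert h using 1
    · rfl
    funext u
    simp [CodeTree.sub, List.range_succ]

lemma block_subset_branchSample (z : CodeTree) (b : ℕ → ℕ) {k n : ℕ} (hkn : k < n) :
    block k (z ((List.range k).map b)) (b k) ⊆ branchSample z b n := by
  induction n, hkn using Nat.le_induction with
  | base => exact List.subset_append_right _ _
  | succ n _ ih => exact fun _ hx => List.mem_append_left _ (ih hx)

/-- A code tree that is consistent at every precision yields an infinite VCL tree. -/
theorem hasInfiniteVCLTree_of_consistent [Nonempty 𝒳] {ℋ : Set (𝒳 → Bool)} {ι : 𝒳 → ℕ → ℕ}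
    (hι : Function.Injective ι) {F : List LabelledCode → (ℕ → ℕ) → Prop}
    (hF : ∀ M ζ, (∀ n, Approx F n M ζ) →
      ∃ L, L.map (labelledCode ι) = M ∧ ConsistentSample ℋ L)
    {z : CodeTree} (hz : ∀ n, Consistent F 0 n [] z) : HasInfiniteVCLTree ℋ := by
  refine ⟨fun k y i => Function.invFun ι
    (z (List.ofFn fun j => Nat.ofBits (y j)) (i + 1)), fun y n => ?_⟩
  set b : ℕ → ℕ := fun k => Nat.ofBits (y k) with hb
  have hlt : ∀ k, b k < 2 ^ (k + 1) := fun k => Nat.ofBits_lt_two_pow _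
  obtain ⟨L, hL, h, hh, hLh⟩ := hF _ _ fun m =>
    (consistent_branchSample hz hlt (n + 1) (m + 1)).1.mono (Nat.le_succ m)
  refine ⟨h, hh, fun k hk i => ?_⟩
  have hpath : (List.ofFn fun j : Fin k => Nat.ofBits (y j)) = (List.range k).map b := by
    rw [List.ofFn_eq_map, ← List.map_coe_finRange_eq_range, List.map_map]
    rfl
  have hmem : (z ((List.range k).map b) (i + 1), (b k).testBit i) ∈ branchSample z b (n + 1) := by
    apply block_subset_branchSample z b (Nat.lt_succ_of_le hk)
    exact List.mem_map.2 ⟨i, List.mem_range.2 i.2, rfl⟩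
  rw [← hL, List.mem_map] at hmem
  obtain ⟨p, hp, hpe⟩ := hmem
  simp only [labelledCode, Prod.mk.injEq] at hpe
  change h (Function.invFun ι (z (List.ofFn fun j : Fin k => Nat.ofBits (y j)) (i + 1))) = y k i
  rw [hpath, ← hpe.1, Function.leftInverse_invFun hι, hLh p hp, hpe.2, hb,
    Nat.testBit_ofBits_lt _ _ i.2]

/-! ### Measurability helpers -/

lemma measurableSet_setOf_of_countable {A C : Type*} [MeasurableSpace A] [MeasurableSpace C]
    [Countable C] [MeasurableSingletonClass C] {c : A → C} (hc : Measurable c) {p : C → A → Prop}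
    (hp : ∀ c₀, MeasurableSet {a | p c₀ a}) : MeasurableSet {a | p (c a) a} := by
  have : {a | p (c a) a} = ⋃ c₀, c ⁻¹' {c₀} ∩ {a | p c₀ a} := by
    ext a
    simp
  rw [this]
  exact .iUnion fun c₀ => (hc (measurableSet_singleton c₀)).inter (hp c₀)

lemma measurable_of_countable_comp {A B C : Type*} [MeasurableSpace A] [MeasurableSpace B]
    [MeasurableSpace C] [Countable C] [MeasurableSingletonClass C] {c : A → C}
    (hc : Measurable c) {f : C → A → B} (hf : ∀ c₀, Measurable (f c₀)) :
    Measurable fun a => f (c a) a :=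
  fun _ ht => measurableSet_setOf_of_countable (p := fun c₀ a => f c₀ a ∈ _) hc
    fun c₀ => hf c₀ ht

lemma measurable_sInf_setOf {A : Type*} [MeasurableSpace A] {p : ℕ → A → Prop}
    (hp : ∀ j, MeasurableSet {a | p j a}) : Measurable fun a => sInf {j | p j a} := by
  refine measurable_to_countable' fun j => ?_
  have : (fun a => sInf {j | p j a}) ⁻¹' {j} =
      {a | (p j a ∧ ∀ i, i < j → ¬ p i a) ∨ ((∀ i, ¬ p i a) ∧ j = 0)} := by
    ext a
    simp only [Set.mem_preimage, Set.mem_singleton_iff]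
    constructor
    · rintro rfl
      by_cases h : {j | p j a}.Nonempty
      · exact .inl ⟨Nat.sInf_mem h, fun i hi => Nat.notMem_of_lt_sInf hi⟩
      · rw [Set.not_nonempty_iff_eq_empty] at h
        exact .inr ⟨fun i hi => (h ▸ hi : i ∈ (∅ : Set ℕ)), by rw [h, Nat.sInf_empty]⟩
    · rintro (⟨h1, h2⟩ | ⟨h1, rfl⟩)
      · exact le_antisymm (Nat.sInf_le h1) (le_csInf ⟨j, h1⟩ fun i hi => by
          by_contra hlt
          exact h2 i (not_le.1 hlt) hi)
      · rw [show {j | p j a} = ∅ from Set.eq_empty_of_forall_notMem h1, Nat.sInf_empty]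
  rw [this]
  have hp' : ∀ j, Measurable (p j) := fun j => measurableSet_setOfPred.1 (hp j)
  refine measurableSet_setOfPred.2 (((hp' j).and (.forall fun i => ?_)).or ?_)
  · exact measurable_const.imp (hp' i).not
  · exact (Measurable.forall fun i => (hp' i).not).and measurable_const

/-- A strategy in the Gale–Stewart game attached to VCL trees: in state `σ` it assigns to every
sequence of points a pattern on the first `dim σ` of them, and it updates its state when a
labelled sequence realizes the pattern. On consistent data only finitely many updates happen. -/
structure PatternStrategy.{u} {𝒳 : Type u} [MeasurableSpace 𝒳] (ℋ : Set (𝒳 → Bool)) where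
  State : Type u
  [measurableSpace : MeasurableSpace State]
  init : State
  dim : State → ℕ
  pat : State → (ℕ → 𝒳) → ℕ → Bool
  next : State → (ℕ → 𝒳 × Bool) → State
  rel : State → State → Prop
  wf : WellFounded rel
  measurable_dim : Measurable dim
  measurable_pat : ∀ i, Measurable fun p : State × (ℕ → 𝒳) => pat p.1 p.2 i
  measurable_next : Measurable fun p : State × (ℕ → 𝒳 × Bool) => next p.1 p.2
  dim_init : dim init = 1
  dim_next_le : ∀ σ e, dim (next σ e) ≤ dim σ + 1
  pat_congr : ∀ σ x x', (∀ i < dim σ, x i = x' i) → pat σ x = pat σ x'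
  next_congr : ∀ σ e e', (∀ i < dim σ, e i = e' i) → next σ e = next σ e'
  next_eq_self : ∀ σ e, ¬ (∀ i < dim σ, pat σ (fun j => (e j).1) i = (e i).2) → next σ e = σ
  progress : ∀ G : Set (𝒳 × Bool), (∀ L : List (𝒳 × Bool), (∀ p ∈ L, p ∈ G) →
    ConsistentSample ℋ L) → ∃ Inv : State → Prop, Inv init ∧ ∀ σ e, Inv σ →
      (∀ i < dim σ, pat σ (fun j => (e j).1) i = (e i).2) → (∀ i, e i ∈ G) →
        Inv (next σ e) ∧ rel (next σ e) σ

section Construction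

variable {F : List LabelledCode → (ℕ → ℕ) → Prop}

/-- The coded sample consisting of the first `m` terms of `e`. -/
def sampleCode (ι : 𝒳 → ℕ → ℕ) (m : ℕ) (e : ℕ → 𝒳 × Bool) : List LabelledCode :=
  (List.range m).map fun i => labelledCode ι (e i)

variable [MeasurableSpace 𝒳] {ι : 𝒳 → ℕ → ℕ}

lemma measurableSet_approx (hι : Measurable ι) (n m : ℕ) (M : List LabelledCode) (ζ : ℕ → ℕ) :
    MeasurableSet {e | Approx F n (sampleCode ι m e ++ M) ζ} := by
  let t : (ℕ → 𝒳 × Bool) → Fin m → (Fin n → ℕ) × Bool :=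
    fun e i => (fun d => ι (e i).1 d, (e i).2)
  have ht : Measurable t := by
    refine measurable_pi_lambda _ fun i => Measurable.prodMk (measurable_pi_lambda _ fun d => ?_) ?_
    · exact (measurable_pi_apply (d : ℕ)).comp
        (hι.comp (measurable_fst.comp (measurable_pi_apply (i : ℕ))))
    · exact measurable_snd.comp (measurable_pi_apply (i : ℕ))
  have : {e | Approx F n (sampleCode ι m e ++ M) ζ} =
      t ⁻¹' {a | ∃ e, t e = a ∧ Approx F n (sampleCode ι m e ++ M) ζ} := by
    ext e
    constructor
    · exact fun h => ⟨e, rfl, h⟩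
    · rintro ⟨e', he, h⟩
      refine h.congr (List.rel_append ?_ (forall₂_agree_refl _ _)) fun _ _ => rfl
      unfold sampleCode
      rw [List.forall₂_map_left_iff, List.forall₂_map_right_iff, List.forall₂_same]
      intro i hi
      have h1 := congrFun he ⟨i, List.mem_range.1 hi⟩
      simp only [t, Prod.mk.injEq] at h1
      exact ⟨fun d hd => congrFun h1.1 ⟨d, hd⟩, h1.2⟩
  rw [this]
  exact ht .of_discrete

lemma measurableSet_consistent (hι : Measurable ι) (k n m : ℕ) (M : List LabelledCode)
    (z : CodeTree) : MeasurableSet {e | Consistent F k n (sampleCode ι m e ++ M) z} := by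
  induction n generalizing k M z with
  | zero => exact .univ
  | succ n ih =>
    change MeasurableSet ({e | Approx F (n + 1) (sampleCode ι m e ++ M) (z [] 0)} ∩
      {e | ∀ y < 2 ^ (k + 1), Consistent F (k + 1) n
        (sampleCode ι m e ++ M ++ block k (z []) y) (z.sub y)})
    simp only [List.append_assoc]
    refine (measurableSet_approx hι _ _ _ _).inter ?_
    simp only [Set.ofPred_forall]
    exact .iInter fun y => .iInter fun _ => ih _ _ _

lemma measurableSet_dominated {W : Type*} [Countable W] {r : W → W → Prop} (hr : WellFounded r)
    (δ : ℕ → CodeTree) (hι : Measurable ι) (k m : ℕ) (s : W) (n : ℕ) (z : CodeTree) :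
    MeasurableSet {e | Dominated F hr δ k (sampleCode ι m e) s n z} := by
  induction s using hr.induction generalizing n z with
  | _ s ih =>
    have : {e | Dominated F hr δ k (sampleCode ι m e) s n z} =
        ⋂ a, ⋂ (_ : Ext k n z (δ a)),
          {e | Consistent F k (n + 1) (sampleCode ι m e ++ []) (δ a)}ᶜ ∪
          ⋃ s', ⋃ (_ : r s' s), {e | Dominated F hr δ k (sampleCode ι m e) s' (n + 1) (δ a)} := by
      ext e
      simp only [Set.mem_ofPred_eq, Set.mem_iInter, Set.mem_union, Set.mem_compl_iff,
        Set.mem_iUnion, List.append_nil]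
      rw [dominated_iff]
      simp only [exists_prop, imp_iff_not_or]
    rw [this]
    refine .iInter fun a => .iInter fun _ => .union (measurableSet_consistent hι _ _ _ _ _).compl ?_
    exact .iUnion fun s' => .iUnion fun h => ih s' h _ _

/-- The number of points collected in the first `k` updates. -/
def triangle : ℕ → ℕ
  | 0 => 0
  | k + 1 => triangle k + (k + 1)

/-- Replace the terms of `v` with indices from `triangle k` to `triangle (k + 1)` by the first
terms of `w`. -/
def appendBlock (k : ℕ) (v w : ℕ → 𝒳 × Bool) (i : ℕ) : 𝒳 × Bool :=
  if i < triangle k then v i else if i < triangle (k + 1) then w (i - triangle k) else v i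

lemma measurable_appendBlock (k : ℕ) :
    Measurable fun p : (ℕ → 𝒳 × Bool) × (ℕ → 𝒳 × Bool) => appendBlock k p.1 p.2 := by
  refine measurable_pi_lambda _ fun i => ?_
  unfold appendBlock
  split_ifs <;> fun_prop

omit [MeasurableSpace 𝒳] in
lemma sampleCode_appendBlock (k : ℕ) (v w : ℕ → 𝒳 × Bool) :
    sampleCode ι (triangle (k + 1)) (appendBlock k v w) =
      sampleCode ι (triangle k) v ++
        (List.range (k + 1)).map fun i => labelledCode ι (w i) := by
  unfold sampleCode
  conv_lhs => rw [triangle, List.range_add, List.map_append, List.map_map]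
  congr 1
  · refine List.map_congr_left fun i hi => ?_
    rw [List.mem_range] at hi
    simp [appendBlock, hi]
  · refine List.map_congr_left fun i hi => ?_
    rw [List.mem_range] at hi
    have : triangle k + i < triangle (k + 1) := by rw [triangle]; omega
    simp [appendBlock, this]

variable {δ : ℕ → CodeTree} (hr : WellFounded (Refines F δ))

/-- Labelling the next block of points `x` by the bits of `y`, where `(y, s')` is encoded by `j`,
is consistent with the sample `v` only at a strictly smaller rank `s'`. -/
def ForbiddenPattern (ι : 𝒳 → ℕ → ℕ) (s : ℕ × ℕ) (k : ℕ) (v : ℕ → 𝒳 × Bool) (x : ℕ → 𝒳)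
    (j : ℕ) : Prop :=
  (Denumerable.ofNat (ℕ × ℕ × ℕ) j).1 < 2 ^ (k + 1) ∧
    Refines F δ (Denumerable.ofNat (ℕ × ℕ × ℕ) j).2 s ∧
    Dominated F hr δ (k + 1) (sampleCode ι (triangle (k + 1)) (appendBlock k v fun i =>
      (x i, (Denumerable.ofNat (ℕ × ℕ × ℕ) j).1.testBit i)))
      (Denumerable.ofNat (ℕ × ℕ × ℕ) j).2 0 (δ 0)

omit [MeasurableSpace 𝒳] in
lemma forbiddenPattern_congr {s : ℕ × ℕ} {k : ℕ} {v : ℕ → 𝒳 × Bool} {x x' : ℕ → 𝒳}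
    (h : ∀ i < k + 1, x i = x' i) :
    ForbiddenPattern hr ι s k v x = ForbiddenPattern hr ι s k v x' := by
  funext j
  unfold ForbiddenPattern
  rw [sampleCode_appendBlock, sampleCode_appendBlock]
  rw [List.map_congr_left fun i hi => by rw [h i (List.mem_range.1 hi)]]

/-- A rank, a number of updates, and the sample collected so far. -/
abbrev GameState (𝒳 : Type*) := (ℕ × ℕ) × ℕ × (ℕ → 𝒳 × Bool)

/-- The selected forbidden pattern together with its rank. -/
@[irreducible]
noncomputable def pick (ι : 𝒳 → ℕ → ℕ) (σ : GameState 𝒳) (x : ℕ → 𝒳) :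
    ℕ × ℕ × ℕ :=
  Denumerable.ofNat (ℕ × ℕ × ℕ) (sInf {j | ForbiddenPattern hr ι σ.1 σ.2.1 σ.2.2 x j})

lemma measurable_pick (hι : Measurable ι) :
    Measurable fun p : GameState 𝒳 × (ℕ → 𝒳) => pick hr ι p.1 p.2 := by
  unfold pick
  refine (Measurable.of_discrete (f := Denumerable.ofNat (ℕ × ℕ × ℕ))).comp (measurable_sInf_setOf
    (p := fun j (p : GameState 𝒳 × (ℕ → 𝒳)) =>
      ForbiddenPattern hr ι p.1.1 p.1.2.1 p.1.2.2 p.2 j) fun j => ?_)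
  have hc : Measurable fun p : GameState 𝒳 × (ℕ → 𝒳) =>
      (p.1.1, p.1.2.1) := by fun_prop
  refine measurableSet_setOf_of_countable (p := fun c (p : GameState 𝒳 × (ℕ → 𝒳)) =>
    ForbiddenPattern hr ι c.1 c.2 p.1.2.2 p.2 j) hc fun c => ?_
  refine .inter (.const _) (.inter (.const _) ?_)
  refine (measurableSet_dominated hr δ hι (c.2 + 1) (triangle (c.2 + 1)) _ 0 (δ 0)).preimage
    (f := fun p : GameState 𝒳 × (ℕ → 𝒳) => appendBlock c.2 p.1.2.2 fun i =>
      (p.2 i, (Denumerable.ofNat (ℕ × ℕ × ℕ) j).1.testBit i)) ?_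
  have h1 : Measurable fun p : GameState 𝒳 × (ℕ → 𝒳) => (p.1.2.2,
      fun i => (p.2 i, (Denumerable.ofNat (ℕ × ℕ × ℕ) j).1.testBit i)) := by
    fun_prop
  exact (measurable_appendBlock c.2).comp h1

lemma measurable_pick_fst (hι : Measurable ι) :
    Measurable fun p : GameState 𝒳 × (ℕ → 𝒳 × Bool) =>
      pick hr ι p.1 fun j => (p.2 j).1 := by
  have h1 : Measurable fun p : GameState 𝒳 × (ℕ → 𝒳 × Bool) =>
      (p.1, fun j => (p.2 j).1) := by
    fun_prop
  exact (measurable_pick hr hι).comp h1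

/-- The labelled sequence `e` realizes the selected forbidden pattern. -/
def Realizes (ι : 𝒳 → ℕ → ℕ) (σ : GameState 𝒳) (e : ℕ → 𝒳 × Bool) : Prop :=
  ∀ i < σ.2.1 + 1, (pick hr ι σ fun j => (e j).1).1.testBit i = (e i).2

open Classical in
/-- The update of the state. -/
noncomputable def update (ι : 𝒳 → ℕ → ℕ) (σ : GameState 𝒳)
    (e : ℕ → 𝒳 × Bool) : GameState 𝒳 :=
  if Realizes hr ι σ e then
    ((pick hr ι σ fun j => (e j).1).2, σ.2.1 + 1, appendBlock σ.2.1 σ.2.2 e)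
  else σ

lemma measurableSet_realizes (hι : Measurable ι) :
    MeasurableSet {p : GameState 𝒳 × (ℕ → 𝒳 × Bool) |
      Realizes hr ι p.1 p.2} := by
  have hpick := measurable_pick_fst hr hι
  refine measurableSet_setOf_of_countable
    (c := fun p : GameState 𝒳 × (ℕ → 𝒳 × Bool) => p.1.2.1)
    (p := fun k p => ∀ i < k + 1,
      (pick hr ι p.1 fun j => (p.2 j).1).1.testBit i = (p.2 i).2) (by fun_prop)
    fun k => ?_
  simp only [Set.ofPred_forall]
  refine .iInter fun i => .iInter fun _ => measurableSet_eq_fun ?_ (by fun_prop)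
  exact (Measurable.of_discrete (f := fun y : ℕ => y.testBit i)).comp hpick.fst

lemma measurable_update (hι : Measurable ι) :
    Measurable fun p : GameState 𝒳 × (ℕ → 𝒳 × Bool) =>
      update hr ι p.1 p.2 := by
  have hpick := measurable_pick_fst hr hι
  refine Measurable.ite (measurableSet_realizes hr hι) ?_ measurable_fst
  refine hpick.snd.prodMk (Measurable.prodMk (by fun_prop) ?_)
  refine measurable_of_countable_comp
    (c := fun p : GameState 𝒳 × (ℕ → 𝒳 × Bool) => p.1.2.1)
    (f := fun k (p : GameState 𝒳 × (ℕ → 𝒳 × Bool)) =>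
      appendBlock k p.1.2.2 p.2) (by fun_prop) fun k => ?_
  exact (measurable_appendBlock k).comp
    (f := fun p : GameState 𝒳 × (ℕ → 𝒳 × Bool) => (p.1.2.2, p.2)) (by fun_prop)

end Construction

open Classical in
/-- A measurable class without infinite VCL tree has a measurable pattern strategy. -/
theorem exists_patternStrategy [Nonempty 𝒳] [TopologicalSpace 𝒳] [PolishSpace 𝒳]
    [MeasurableSpace 𝒳] [BorelSpace 𝒳] {ℋ : Set (𝒳 → Bool)} (hℋ : MeasurableClass 𝒳 ℋ)
    (htree : ¬ HasInfiniteVCLTree ℋ) : Nonempty (PatternStrategy ℋ) := by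
  obtain ⟨ι₀, hι₀, hinj⟩ := MeasurableSpace.measurable_injection_nat_bool_of_countablySeparated 𝒳
  set ι : 𝒳 → ℕ → ℕ := fun x i => (ι₀ x i).toNat with hιdef
  have hι : Measurable ι := measurable_pi_lambda _ fun i =>
    (Measurable.of_discrete (f := Bool.toNat)).comp ((measurable_pi_apply i).comp hι₀)
  have hιinj : Function.Injective ι := fun x x' h => hinj <| funext fun i =>
    by
      have := congrFun h i
      revert this
      simp only [hιdef]
      cases ι₀ x i <;> cases ι₀ x' i <;> simp
  obtain ⟨F, hF1, hF2⟩ := exists_closed_relation hℋ hι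
  set δ : ℕ → CodeTree := TopologicalSpace.denseSeq CodeTree
  have hδ : ∀ k n z, ∃ a, Ext k n z (δ a) := fun k n z =>
    (TopologicalSpace.denseRange_denseSeq CodeTree).exists_mem_open (isOpen_setOf_ext k n z)
      ⟨z, Ext.refl k n z⟩
  have hr : WellFounded (Refines F δ) := wellFounded_refines δ fun z hz =>
    htree (hasInfiniteVCLTree_of_consistent hιinj hF2 hz)
  obtain ⟨x₀⟩ := ‹Nonempty 𝒳›
  refine ⟨{
    State := GameState 𝒳
    init := ((0, 0), 0, fun _ => (x₀, false))
    dim := fun σ => σ.2.1 + 1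
    pat := fun σ x i => (pick hr ι σ x).1.testBit i
    next := update hr ι
    rel := InvImage (Refines F δ) Prod.fst
    wf := InvImage.wf _ hr
    measurable_dim := by fun_prop
    measurable_pat := fun i => (Measurable.of_discrete (f := fun y : ℕ => y.testBit i)).comp
      (measurable_pick hr hι).fst
    measurable_next := measurable_update hr hι
    dim_init := rfl
    dim_next_le := ?_
    pat_congr := ?_
    next_congr := ?_
    next_eq_self := fun σ e h => if_neg h
    progress := ?_ }⟩
  · intro σ e
    unfold update
    split_ifs <;> simp
  · intro σ x x' h
    unfold pick
    rw [forbiddenPattern_congr hr h]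
  · intro σ e e' h
    have h1 : (pick hr ι σ fun j => (e j).1) = pick hr ι σ fun j => (e' j).1 := by
      unfold pick
      rw [forbiddenPattern_congr hr fun i hi => congrArg Prod.fst (h i hi)]
    have h2 : Realizes hr ι σ e ↔ Realizes hr ι σ e' := by
      unfold Realizes
      rw [h1]
      exact forall₂_congr fun i hi => by rw [h i hi]
    have h3 : appendBlock σ.2.1 σ.2.2 e = appendBlock σ.2.1 σ.2.2 e' := by
      funext i
      unfold appendBlock
      split_ifs with h4 h5
      · rfl
      · rw [triangle] at h5
        exact h _ (by omega)
      · rfl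
    unfold update
    rw [h1, h3]
    exact if_congr h2 rfl rfl
  · intro G hG
    refine ⟨fun σ => (∀ i < triangle σ.2.1, σ.2.2 i ∈ G) ∧
      Dominated F hr δ σ.2.1 (sampleCode ι (triangle σ.2.1) σ.2.2) σ.1 0 (δ 0),
      ⟨fun i hi => absurd hi (Nat.not_lt_zero i), dominated_refines δ hr (0, 0)⟩, ?_⟩
    rintro ⟨s, k, v⟩ e ⟨hv, hd⟩ hm he
    simp only at hv hd hm
    have hL : ConsistentSample ℋ ((List.range (triangle k)).map v) := by
      refine hG _ fun p hp => ?_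
      obtain ⟨i, hi, rfl⟩ := List.mem_map.1 hp
      exact hv i (List.mem_range.1 hi)
    obtain ⟨ζ, hζ⟩ := hF1 _ hL
    rw [List.map_map] at hζ
    obtain ⟨y, hy, s', hs', hd'⟩ := hd.exists_block hr δ hδ
      (ρ := fun | 0 => ζ | i + 1 => ι (e i).1) hζ
    have hne : {j | ForbiddenPattern hr ι s k v (fun i => (e i).1) j}.Nonempty := by
      refine ⟨Encodable.encode (y, s'), ?_⟩
      simp only [Set.mem_ofPred_eq, ForbiddenPattern, Denumerable.ofNat_encode,
        sampleCode_appendBlock]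
      exact ⟨hy, hs', hd'⟩
    obtain ⟨-, h2, h3⟩ : ForbiddenPattern hr ι s k v (fun i => (e i).1) _ := Nat.sInf_mem hne
    have hpick : pick hr ι (s, k, v) (fun j => (e j).1) = Denumerable.ofNat (ℕ × ℕ × ℕ)
        (sInf {j | ForbiddenPattern hr ι s k v (fun i => (e i).1) j}) := by
      unfold pick
      rfl
    rw [← hpick] at h2 h3
    have hupd : update hr ι (s, k, v) e =
        ((pick hr ι (s, k, v) fun j => (e j).1).2, k + 1, appendBlock k v e) := if_pos hm
    rw [hupd]
    refine ⟨⟨fun i hi => ?_, ?_⟩, h2⟩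
    · simp only [appendBlock] at hi ⊢
      split_ifs with h4
      · exact hv i h4
      · exact he _
    · simp only
      convert h3 using 1
      rw [sampleCode_appendBlock, sampleCode_appendBlock]
      congr 1
      refine List.map_congr_left fun i hi => ?_
      exact congrArg (labelledCode ι) (Prod.ext rfl (hm i (List.mem_range.1 hi)).symm)

/-! ### Independent streams -/

section Stream

variable {E : Type*} [MeasurableSpace E] (P : Measure E) [IsProbabilityMeasure P]

/-- The law of a family of i.i.d. random variables indexed by `κ`. -/
noncomputable abbrev iid (κ : Type*) : Measure (κ → E) := Measure.infinitePi fun _ : κ => P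

lemma measurePreserving_comp_injective {κ κ' : Type*} {φ : κ' → κ} (hφ : Function.Injective φ) :
    MeasurePreserving (fun ω : κ → E => ω ∘ φ) (iid P κ) (iid P κ') := by
  classical
  have hm : Measurable fun ω : κ → E => ω ∘ φ :=
    measurable_pi_lambda _ fun i => measurable_pi_apply (φ i)
  refine ⟨hm, Measure.eq_infinitePi _ fun s t ht => ?_⟩
  rw [Measure.map_apply hm (.pi s.countable_toSet fun i _ => ht i)]
  rcases isEmpty_or_nonempty κ' with h | h
  · simp [Finset.eq_empty_of_isEmpty s]
  have h1 : (fun ω : κ → E => ω ∘ φ) ⁻¹' Set.pi s t =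
      Set.pi (s.map ⟨φ, hφ⟩ : Finset κ) (t ∘ Function.invFun φ) := by
    ext ω
    simp [Set.mem_pi, Function.leftInverse_invFun hφ _]
  rw [h1, Measure.infinitePi_pi _ (t := t ∘ Function.invFun φ) fun i _ => ht _, Finset.prod_map]
  simp [Function.leftInverse_invFun hφ _]

lemma measurePreserving_sumElim (κ κ' : Type*) :
    MeasurePreserving (fun p : (κ → E) × (κ' → E) => Sum.elim p.1 p.2)
      ((iid P κ).prod (iid P κ')) (iid P (κ ⊕ κ')) := by
  have hm : Measurable fun p : (κ → E) × (κ' → E) => Sum.elim p.1 p.2 := by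
    refine measurable_pi_lambda _ fun i => ?_
    cases i <;> simp only [Sum.elim_inl, Sum.elim_inr] <;> fun_prop
  refine ⟨hm, Measure.eq_infinitePi _ fun s t ht => ?_⟩
  rw [Measure.map_apply hm (.pi s.countable_toSet fun i _ => ht i)]
  have h1 : (fun p : (κ → E) × (κ' → E) => Sum.elim p.1 p.2) ⁻¹' Set.pi s t =
      Set.pi s.toLeft (fun i => t (.inl i)) ×ˢ Set.pi s.toRight fun i => t (.inr i) := by
    ext p
    simp [Set.mem_pi, Sum.forall]
  rw [h1, Measure.prod_prod, Measure.infinitePi_pi _ fun i _ => ht _,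
    Measure.infinitePi_pi _ fun i _ => ht _]
  conv_rhs => rw [← Finset.toLeft_disjSum_toRight (u := s), Finset.prod_disjSum]

lemma measurePreserving_comp_prod {κ κ₁ κ₂ : Type*} {φ : κ₁ → κ} {ψ : κ₂ → κ}
    (h : Function.Injective (Sum.elim φ ψ)) :
    MeasurePreserving (fun ω : κ → E => (ω ∘ φ, ω ∘ ψ)) (iid P κ)
      ((iid P κ₁).prod (iid P κ₂)) := by
  have hm : Measurable fun ω : κ₁ ⊕ κ₂ → E => (ω ∘ Sum.inl, ω ∘ Sum.inr) :=
    (measurable_pi_lambda _ fun i => measurable_pi_apply _).prodMk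
      (measurable_pi_lambda _ fun i => measurable_pi_apply _)
  have h1 : MeasurePreserving (fun ω : κ₁ ⊕ κ₂ → E => (ω ∘ Sum.inl, ω ∘ Sum.inr))
      (iid P (κ₁ ⊕ κ₂)) ((iid P κ₁).prod (iid P κ₂)) := by
    refine ⟨hm, ?_⟩
    have h2 := measurePreserving_sumElim P κ₁ κ₂
    rw [← h2.map_eq, Measure.map_map hm h2.measurable]
    exact Measure.map_id
  exact h1.comp (measurePreserving_comp_injective P h)

/-- Separation of the first row of an i.i.d. array. -/
lemma measurePreserving_head_tail (K : Type*) :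
    MeasurePreserving (fun τ : ℕ × K → E => (fun j => τ (0, j), fun q : ℕ × K => τ (q.1 + 1, q.2)))
      (iid P (ℕ × K)) ((iid P K).prod (iid P (ℕ × K))) := by
  refine measurePreserving_comp_prod P (φ := fun j => (0, j))
    (ψ := fun q : ℕ × K => (q.1 + 1, q.2)) ?_
  rintro (i | ⟨i, j⟩) (i' | ⟨i', j'⟩) h <;> simp_all

lemma lintegral_prod_rows {K : Type*} {f : (K → E) → ℝ≥0∞} (hf : Measurable f) (N : ℕ) :
    ∫⁻ τ, ∏ i ∈ Finset.range N, f (fun j => τ (i, j)) ∂(iid P (ℕ × K)) =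
      (∫⁻ e, f e ∂(iid P K)) ^ N := by
  induction N with
  | zero => simp
  | succ N ih =>
    have hrow : ∀ i, Measurable fun τ : ℕ × K → E => f fun j => τ (i, j) := fun i =>
      hf.comp (measurable_pi_lambda _ fun j => measurable_pi_apply _)
    have hg : Measurable fun τ : ℕ × K → E => ∏ i ∈ Finset.range N, f (fun j => τ (i, j)) :=
      Finset.measurable_fun_prod _ fun i _ => hrow i
    have h := (measurePreserving_head_tail P K).lintegral_comp
      ((hf.comp measurable_fst).mul (hg.comp measurable_snd))
    simp only [Finset.prod_range_succ']
    rw [pow_succ', ← ih, ← lintegral_prod_mul hf.aemeasurable hg.aemeasurable]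
    refine Eq.trans (lintegral_congr fun τ => ?_) h
    simp [mul_comm]

end Stream

/-! ### A set of full measure on which finite samples are consistent -/

lemma exists_full_consistent_set [MeasurableSpace 𝒳] {ℋ : Set (𝒳 → Bool)}
    {P : Measure (𝒳 × Bool)} (hP : Realizable ℋ P) :
    ∃ G : Set (𝒳 × Bool), (∀ᵐ p ∂P, p ∈ G) ∧
      ∀ L : List (𝒳 × Bool), (∀ p ∈ L, p ∈ G) → ConsistentSample ℋ L := by
  have h : ∀ j : ℕ, ∃ h ∈ ℋ, errP P h < 2⁻¹ ^ j := by
    intro j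
    have : (⨅ h ∈ ℋ, errP P h) < 2⁻¹ ^ j := by
      rw [show (⨅ h ∈ ℋ, errP P h) = 0 from hP]
      exact ENNReal.pow_pos (by simp) j
    simpa only [iInf_lt_iff, exists_prop] using this
  choose h hℋ herr using h
  refine ⟨{p | ∀ᶠ j in Filter.atTop, h j p.1 = p.2}, ?_, fun L hL => ?_⟩
  · have hsum : ∑' j, P {p | h j p.1 ≠ p.2} ≠ ∞ := by
      refine ne_top_of_le_ne_top ?_ (ENNReal.tsum_le_tsum fun j => (herr j).le)
      rw [ENNReal.tsum_geometric]
      simp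
    filter_upwards [ae_eventually_notMem hsum] with p hp
    filter_upwards [hp] with j hj
    simpa using hj
  · have : ∀ᶠ j in Filter.atTop, ∀ p ∈ L, h j p.1 = p.2 := by
      induction L with
      | nil => simp
      | cons a L ih =>
        filter_upwards [ih fun p hp => hL p (List.mem_cons_of_mem _ hp), hL a (by simp)]
          with j h1 h2
        simpa [h2] using fun a b hab => h1 (a, b) hab
    obtain ⟨j, hj⟩ := this.exists
    exact ⟨h j, hℋ j, hj⟩

/-! ### Convergence of the pattern strategy on i.i.d. windows -/

namespace PatternStrategy

attribute [instance] PatternStrategy.measurableSpace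

section

variable [MeasurableSpace 𝒳] {ℋ : Set (𝒳 → Bool)} (S : PatternStrategy ℋ)

/-- The labelled sequence `e` realizes the pattern of the state `σ`. -/
def Match (σ : S.State) (e : ℕ → 𝒳 × Bool) : Prop :=
  ∀ i < S.dim σ, S.pat σ (fun j => (e j).1) i = (e i).2

lemma measurableSet_match :
    MeasurableSet {p : S.State × (ℕ → 𝒳 × Bool) | S.Match p.1 p.2} := by
  refine measurableSet_setOf_of_countable (c := fun p : S.State × (ℕ → 𝒳 × Bool) => S.dim p.1)
    (p := fun d p => ∀ i < d, S.pat p.1 (fun j => (p.2 j).1) i = (p.2 i).2)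
    (S.measurable_dim.comp measurable_fst) fun d => ?_
  simp only [Set.ofPred_forall]
  refine .iInter fun i => .iInter fun _ => measurableSet_eq_fun ?_ (by fun_prop)
  exact (S.measurable_pat i).comp
    (f := fun p : S.State × (ℕ → 𝒳 × Bool) => (p.1, fun j => (p.2 j).1)) (by fun_prop)

/-- The state reached from `σ` after playing on the first `r` rows of `τ`. -/
def run : ℕ → S.State → (ℕ × ℕ → 𝒳 × Bool) → S.State
  | 0, σ, _ => σ
  | r + 1, σ, τ => run r (S.next σ fun j => τ (0, j)) fun q => τ (q.1 + 1, q.2)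

lemma measurable_run (r : ℕ) :
    Measurable fun p : S.State × (ℕ × ℕ → 𝒳 × Bool) => S.run r p.1 p.2 := by
  induction r with
  | zero => exact measurable_fst
  | succ r ih =>
    have h1 : Measurable fun p : S.State × (ℕ × ℕ → 𝒳 × Bool) =>
        S.next p.1 fun j => p.2 (0, j) :=
      S.measurable_next.comp
        (f := fun p : S.State × (ℕ × ℕ → 𝒳 × Bool) => (p.1, fun j => p.2 (0, j))) (by fun_prop)
    exact ih.comp (f := fun p : S.State × (ℕ × ℕ → 𝒳 × Bool) =>
      (S.next p.1 fun j => p.2 (0, j), fun q => p.2 (q.1 + 1, q.2))) (h1.prodMk (by fun_prop))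

lemma dim_run_le (r : ℕ) (σ : S.State) (τ : ℕ × ℕ → 𝒳 × Bool) :
    S.dim (S.run r σ τ) ≤ S.dim σ + r := by
  induction r generalizing σ τ with
  | zero => exact le_rfl
  | succ r ih =>
    refine (ih _ _).trans ?_
    have := S.dim_next_le σ fun j => τ (0, j)
    omega

lemma run_congr (r : ℕ) (σ : S.State) {τ τ' : ℕ × ℕ → 𝒳 × Bool}
    (h : ∀ t < r, ∀ j < S.dim σ + r, τ (t, j) = τ' (t, j)) :
    S.run r σ τ = S.run r σ τ' := by
  induction r generalizing σ τ τ' with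
  | zero => rfl
  | succ r ih =>
    have h0 : S.next σ (fun j => τ (0, j)) = S.next σ fun j => τ' (0, j) :=
      S.next_congr _ _ _ fun j hj => h 0 (Nat.succ_pos r) j (by omega)
    simp only [run, h0]
    refine ih _ fun t ht j hj => h _ (by omega) _ ?_
    have := S.dim_next_le σ fun j => τ' (0, j)
    omega

variable (P : Measure (𝒳 × Bool)) [IsProbabilityMeasure P]

/-- The probability that the pattern of a state is realized. -/
noncomputable def per (σ : S.State) : ℝ≥0∞ := iid P ℕ {e | S.Match σ e}

lemma measurable_per : Measurable (S.per P) :=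
  measurable_measure_prodMk_left S.measurableSet_match

/-- The probability that the state reached after `r` rows lies in `B`. -/
noncomputable def hit (B : Set S.State) (r : ℕ) (σ : S.State) : ℝ≥0∞ :=
  iid P (ℕ × ℕ) {τ | S.run r σ τ ∈ B}

variable {P} {B : Set S.State}

lemma measurable_hit (hB : MeasurableSet B) (r : ℕ) : Measurable (S.hit P B r) :=
  measurable_measure_prodMk_left (S.measurable_run r hB)

lemma measurable_next_right (σ : S.State) : Measurable (S.next σ) :=
  S.measurable_next.comp (measurable_const.prodMk measurable_id)

lemma hit_succ (hB : MeasurableSet B) (r : ℕ) (σ : S.State) :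
    S.hit P B (r + 1) σ = ∫⁻ e, S.hit P B r (S.next σ e) ∂(iid P ℕ) := by
  have hs : MeasurableSet {p : (ℕ → 𝒳 × Bool) × (ℕ × ℕ → 𝒳 × Bool) |
      S.run r (S.next σ p.1) p.2 ∈ B} :=
    (S.measurable_run r).comp (f := fun p : (ℕ → 𝒳 × Bool) × (ℕ × ℕ → 𝒳 × Bool) =>
      (S.next σ p.1, p.2)) (((S.measurable_next_right σ).comp measurable_fst).prodMk
      measurable_snd) hB
  have h := (measurePreserving_head_tail P ℕ).measure_preimage hs.nullMeasurableSet
  rw [Measure.prod_apply hs] at h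
  exact h

lemma hit_zero (σ : S.State) [Decidable (σ ∈ B)] :
    S.hit P B 0 σ = if σ ∈ B then 1 else 0 := by
  unfold hit run
  split_ifs with h <;> simp [h]

lemma hit_le_one (r : ℕ) (σ : S.State) : S.hit P B r σ ≤ 1 := prob_le_one

omit [IsProbabilityMeasure P] in
lemma ae_next_eq_of_per_eq_zero {σ : S.State} (hσ : S.per P σ = 0) :
    ∀ᵐ e ∂(iid P ℕ), S.next σ e = σ := by
  have : ∀ᵐ e ∂(iid P ℕ), ¬ S.Match σ e := by
    simpa [ae_iff, per] using hσ
  filter_upwards [this] with e he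
  exact S.next_eq_self σ e he

lemma hit_eq_zero (hB : MeasurableSet B) {σ : S.State} (hσB : σ ∉ B) (hσ : S.per P σ = 0)
    (r : ℕ) : S.hit P B r σ = 0 := by
  classical
  induction r with
  | zero => rw [hit_zero, if_neg hσB]
  | succ r ih =>
    rw [S.hit_succ hB, lintegral_congr_ae (g := 0), lintegral_zero_fun]
    filter_upwards [S.ae_next_eq_of_per_eq_zero hσ] with e he
    rw [he, ih, Pi.zero_apply]

lemma antitone_hit (hB : MeasurableSet B) (h : ∀ σ ∉ B, S.per P σ = 0) (σ : S.State) :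
    Antitone fun r => S.hit P B r σ := by
  classical
  refine antitone_nat_of_succ_le fun r => ?_
  induction r generalizing σ with
  | zero =>
    by_cases hσ : σ ∈ B
    · rw [S.hit_zero, if_pos hσ]
      exact S.hit_le_one _ _
    · rw [S.hit_eq_zero hB hσ (h σ hσ)]
      exact zero_le
  | succ r ih =>
    rw [S.hit_succ hB, S.hit_succ hB r]
    exact lintegral_mono fun e => ih _

lemma iInf_hit_eq_zero (hP : Realizable ℋ P) :
    ⨅ r, S.hit P {σ | S.per P σ ≠ 0} r S.init = 0 := by
  classical
  obtain ⟨G, hG, hcons⟩ := exists_full_consistent_set hP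
  obtain ⟨Inv, hinit, hstep⟩ := S.progress G hcons
  have hB : MeasurableSet {σ | S.per P σ ≠ 0} :=
    S.measurable_per P (measurableSet_singleton 0).compl
  have hanti := S.antitone_hit (P := P) hB fun σ hσ => by simpa using hσ
  have hGae : ∀ᵐ e ∂(iid P ℕ), ∀ i, e i ∈ G := by
    rw [ae_all_iff]
    intro i
    exact (measurePreserving_eval_infinitePi (fun _ : ℕ => P) i).quasiMeasurePreserving.ae hG
  have hlim : ∀ σ, ⨅ r, S.hit P {σ | S.per P σ ≠ 0} r σ =
      ∫⁻ e, ⨅ r, S.hit P {σ | S.per P σ ≠ 0} r (S.next σ e) ∂(iid P ℕ) := by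
    intro σ
    rw [lintegral_iInf (f := fun r e => S.hit P {σ | S.per P σ ≠ 0} r (S.next σ e))
      (fun r => (S.measurable_hit hB r).comp (S.measurable_next_right σ))
      (fun r r' hr e => hanti _ hr)]
    · simp only [← S.hit_succ hB]
      exact ((hanti σ).iInf_nat_add 1).symm
    · rw [← S.hit_succ hB]
      exact ne_top_of_le_ne_top ENNReal.one_ne_top (S.hit_le_one _ _)
  suffices h : ∀ σ, Inv σ → ⨅ r, S.hit P {σ | S.per P σ ≠ 0} r σ = 0 from h _ hinit
  intro σ
  induction σ using S.wf.induction with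
  | _ σ ih =>
    intro hσ
    set ℓ : S.State → ℝ≥0∞ := fun σ => ⨅ r, S.hit P {σ | S.per P σ ≠ 0} r σ with hℓ
    change ℓ σ = 0
    by_cases hper : S.per P σ = 0
    · exact le_antisymm ((iInf_le _ 0).trans
        (S.hit_eq_zero hB (by simpa using hper) hper 0).le) zero_le
    have hms : MeasurableSet {e | S.Match σ e} :=
      S.measurableSet_match.preimage measurable_prodMk_left
    have h1 : ℓ σ = ℓ σ * iid P ℕ {e | S.Match σ e}ᶜ := by
      calc ℓ σ = ∫⁻ e, ℓ (S.next σ e) ∂(iid P ℕ) := hlim σ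
        _ = ∫⁻ e, {e | S.Match σ e}ᶜ.indicator (fun _ => ℓ σ) e ∂(iid P ℕ) := by
          refine lintegral_congr_ae ?_
          filter_upwards [hGae] with e he
          by_cases hm : S.Match σ e
          · rw [Set.indicator_of_notMem (by simpa using hm)]
            obtain ⟨h1, h2⟩ := hstep σ e hσ hm he
            exact ih _ h2 h1
          · rw [Set.indicator_of_mem (by simpa using hm), S.next_eq_self σ e hm]
        _ = _ := lintegral_indicator_const hms.compl _
    have hfin : ℓ σ ≠ ∞ :=
      ne_top_of_le_ne_top ENNReal.one_ne_top ((iInf_le _ 0).trans (S.hit_le_one _ _))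
    by_contra h0
    have h2 : iid P ℕ {e | S.Match σ e}ᶜ = 1 := by
      have := (ENNReal.mul_right_inj h0 hfin).1 (h1.symm.trans (mul_one _).symm)
      exact this
    exact hper ((prob_compl_eq_one_iff hms).1 h2)

/-- With probability close to one, the strategy has stabilized after finitely many rows. -/
theorem exists_stable (hP : Realizable ℋ P) {ε : ℝ≥0∞} (hε : 0 < ε) :
    ∃ K r₀ : ℕ, ∀ r, r₀ ≤ r →
      iid P (ℕ × ℕ) {τ | ¬ (S.per P (S.run r S.init τ) = 0 ∧ S.dim (S.run r S.init τ) ≤ K)} ≤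
        ε := by
  obtain ⟨r₀, hr₀⟩ := iInf_lt_iff.1 ((S.iInf_hit_eq_zero hP).trans_lt hε)
  refine ⟨r₀ + 1, r₀, fun r hr => ?_⟩
  set B : Set S.State := {σ | ¬ (S.per P σ = 0 ∧ S.dim σ ≤ r₀ + 1)}
  have hB : MeasurableSet B := by
    refine MeasurableSet.compl (.inter ?_ ?_)
    · exact S.measurable_per P (measurableSet_singleton 0)
    · exact S.measurable_dim measurableSet_Iic
  have hanti := S.antitone_hit (P := P) hB (fun σ hσ => (not_not.1 hσ).1) S.init
  calc S.hit P B r S.init ≤ S.hit P B r₀ S.init := hanti hr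
    _ ≤ S.hit P {σ | S.per P σ ≠ 0} r₀ S.init := by
      refine measure_mono fun τ hτ hper => hτ ⟨hper, ?_⟩
      refine (S.dim_run_le _ _ _).trans ?_
      rw [S.dim_init, add_comm]
    _ ≤ ε := hr₀.le

end

end PatternStrategy

/-! ### The one-inclusion graph -/

section OneInclusion

open Finset

variable {α : Type*} [DecidableEq α]

/-- The number of edges in direction `a` of the one-inclusion graph of `𝒜`. -/
def edgeCount (a : α) (𝒜 : Finset (Finset α)) : ℕ :=
  #(𝒜.nonMemberSubfamily a ∩ 𝒜.memberSubfamily a)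

lemma edgeCount_nonMember_add_member {a b : α} (hab : b ≠ a) (𝒜 : Finset (Finset α)) :
    edgeCount b 𝒜 = edgeCount b (𝒜.nonMemberSubfamily a) + edgeCount b (𝒜.memberSubfamily a) := by
  rw [edgeCount, ← card_memberSubfamily_add_card_nonMemberSubfamily a, add_comm]
  congr 2
  · ext s
    simp only [mem_inter, mem_nonMemberSubfamily, mem_memberSubfamily, mem_insert]
    grind
  · ext s
    simp only [mem_inter, mem_nonMemberSubfamily, mem_memberSubfamily, mem_insert,
      Finset.insert_comm a b]
    grind

lemma edgeCount_add_le (b : α) (𝒜 ℬ : Finset (Finset α)) :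
    edgeCount b 𝒜 + edgeCount b ℬ ≤ edgeCount b (𝒜 ∪ ℬ) + edgeCount b (𝒜 ∩ ℬ) := by
  simp only [edgeCount, nonMemberSubfamily_union, nonMemberSubfamily_inter,
    memberSubfamily_union, memberSubfamily_inter]
  rw [← card_union_add_card_inter]
  refine Nat.add_le_add (card_le_card ?_) (card_le_card ?_) <;>
  · intro s
    simp only [mem_union, mem_inter]
    tauto

lemma sum_edgeCount_le (U : Finset α) (d : ℕ) (𝒜 : Finset (Finset α)) (hU : ∀ s ∈ 𝒜, s ⊆ U)
    (hd : ∀ T, 𝒜.Shatters T → #T ≤ d) : ∑ a ∈ U, edgeCount a 𝒜 ≤ d * #𝒜 := by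
  induction U using Finset.induction_on generalizing d 𝒜 with
  | empty => simp
  | insert a U ha ih =>
    set N := 𝒜.nonMemberSubfamily a with hN
    set M := 𝒜.memberSubfamily a with hM
    have hNU : ∀ s ∈ N, s ⊆ U := fun s hs => by
      rw [hN, mem_nonMemberSubfamily] at hs
      exact (subset_insert_iff_of_notMem hs.2).1 (hU s hs.1)
    have hMU : ∀ s ∈ M, s ⊆ U := fun s hs => by
      rw [hM, mem_memberSubfamily] at hs
      exact (subset_insert_iff_of_notMem hs.2).1 ((subset_insert a s).trans (hU _ hs.1))
    have hunion : ∑ b ∈ U, edgeCount b (N ∪ M) ≤ d * #(N ∪ M) := by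
      refine ih d _ (fun s hs => (mem_union.1 hs).elim (hNU s) (hMU s)) fun T hT => hd T ?_
      have haT : a ∉ T := by
        obtain ⟨u, hu, hTu⟩ := hT.exists_superset
        exact fun h => ha ((mem_union.1 hu).elim (hNU u) (hMU u) (hTu h))
      intro t ht
      obtain ⟨u, hu, rfl⟩ := hT ht
      rcases mem_union.1 hu with hu | hu
      · exact ⟨u, (mem_nonMemberSubfamily.1 hu).1, rfl⟩
      · exact ⟨insert a u, (mem_memberSubfamily.1 hu).1, inter_insert_of_notMem haT⟩
    have hinter : ∑ b ∈ U, edgeCount b (N ∩ M) + #(N ∩ M) ≤ d * #(N ∩ M) := by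
      rcases (N ∩ M).eq_empty_or_nonempty with h0 | ⟨v, hv⟩
      · simp [h0, edgeCount, nonMemberSubfamily]
      have hsh : ∀ T, (N ∩ M).Shatters T → #T + 1 ≤ d := by
        intro T hT
        have haT : a ∉ T := by
          obtain ⟨u, hu, hTu⟩ := hT.exists_superset
          exact fun h => ha (hNU u (mem_inter.1 hu).1 (hTu h))
        rw [← card_insert_of_notMem haT]
        refine hd _ fun t ht => ?_
        obtain ⟨u, hu, hut⟩ := hT (t := t.erase a) (by
          intro x hx
          rcases mem_insert.1 (ht (mem_of_mem_erase hx)) with rfl | h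
          · simp at hx
          · exact h)
        rw [mem_inter, hN, hM, mem_nonMemberSubfamily, mem_memberSubfamily] at hu
        by_cases hat : a ∈ t
        · refine ⟨insert a u, hu.2.1, ?_⟩
          rw [← insert_inter_distrib, hut, insert_erase hat]
        · refine ⟨u, hu.1.1, ?_⟩
          rw [insert_inter_of_notMem hu.1.2, hut, erase_eq_of_notMem hat]
      obtain ⟨d, rfl⟩ : ∃ e, d = e + 1 :=
        ⟨d - 1, by have := hsh ∅ fun t ht => ⟨v, hv, by simp_all⟩; simp at this; omega⟩
      have := ih d _ (fun s hs => hNU s (mem_inter.1 hs).1) fun T hT => by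
        have := hsh T hT; omega
      rw [add_mul, one_mul]
      omega
    have hcard : #N + #M = #𝒜 := by
      rw [add_comm]; exact card_memberSubfamily_add_card_nonMemberSubfamily a 𝒜
    have hsum : ∑ b ∈ U, edgeCount b 𝒜 ≤
        ∑ b ∈ U, edgeCount b (N ∪ M) + ∑ b ∈ U, edgeCount b (N ∩ M) := by
      rw [← sum_add_distrib]
      refine sum_le_sum fun b hb => ?_
      rw [edgeCount_nonMember_add_member (a := a) (by rintro rfl; exact ha hb)]
      exact edgeCount_add_le b N M
    rw [sum_insert ha, ← hcard, ← card_union_add_card_inter, mul_add]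
    have : edgeCount a 𝒜 = #(N ∩ M) := rfl
    omega

lemma exists_card_neighbors_le [Fintype α] {d : ℕ} {𝒜 : Finset (Finset α)} (hne : 𝒜.Nonempty)
    (hd : ∀ T, 𝒜.Shatters T → #T ≤ d) :
    ∃ s ∈ 𝒜, #{j | symmDiff s {j} ∈ 𝒜} ≤ 2 * d := by
  by_contra! h
  have h1 : ∑ s ∈ 𝒜, #{j | symmDiff s {j} ∈ 𝒜} = ∑ j, #{s ∈ 𝒜 | symmDiff s {j} ∈ 𝒜} :=
    sum_card_bipartiteAbove_eq_sum_card_bipartiteBelow _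
  have h2 (j : α) : #{s ∈ 𝒜 | symmDiff s {j} ∈ 𝒜} ≤ 2 * edgeCount j 𝒜 := by
    set X := 𝒜.nonMemberSubfamily j ∩ 𝒜.memberSubfamily j with hX
    have hsub : {s ∈ 𝒜 | symmDiff s {j} ∈ 𝒜} ⊆ X ∪ X.image (insert j) := by
      intro s hs
      obtain ⟨hs1, hs2⟩ := mem_filter.1 hs
      by_cases hj : j ∈ s
      · have he : symmDiff s {j} = s.erase j := by ext x; simp [mem_symmDiff]; grind
        rw [he] at hs2
        refine mem_union_right _ (mem_image.2 ⟨s.erase j, ?_, insert_erase hj⟩)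
        simp [hX, hs2, insert_erase hj, hs1]
      · have he : symmDiff s {j} = insert j s := by ext x; simp [mem_symmDiff]; grind
        rw [he] at hs2
        refine mem_union_left _ ?_
        simp [hX, hs2, hs1, hj]
    calc _ ≤ #X + #(X.image (insert j)) := (card_le_card hsub).trans (card_union_le X _)
      _ ≤ #X + #X := Nat.add_le_add_left card_image_le _
      _ = 2 * edgeCount j 𝒜 := (two_mul _).symm
  have h3 := sum_edgeCount_le univ d 𝒜 (fun s _ => subset_univ s) hd
  have h4 : ∑ s ∈ 𝒜, (2 * d + 1) ≤ ∑ s ∈ 𝒜, #{j | symmDiff s {j} ∈ 𝒜} :=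
    sum_le_sum fun s hs => h s hs
  have h5 : ∑ j, #{s ∈ 𝒜 | symmDiff s {j} ∈ 𝒜} ≤ 2 * ∑ j, edgeCount j 𝒜 := by
    rw [mul_sum]; exact sum_le_sum fun j _ => h2 j
  rw [sum_const, smul_eq_mul] at h4
  have h6 := hne.card_pos
  nlinarith

end OneInclusion

section Guess

variable {I : Type*} [DecidableEq I]

/-- The vertex adjacent to `b` in direction `j`. -/
def flipAt (b : I → Bool) (j : I) : I → Bool := Function.update b j (!b j)

/-- The layers of `V` obtained by repeatedly removing the vertices of degree at most `D`. -/
def peel (D : ℕ) (V : Set (I → Bool)) : ℕ → Set (I → Bool)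
  | 0 => V
  | i + 1 => {b ∈ peel D V i | D < {j | flipAt b j ∈ peel D V i}.ncard}

lemma antitone_peel (D : ℕ) (V : Set (I → Bool)) : Antitone (peel D V) :=
  antitone_nat_of_succ_le fun _ _ hb => hb.1

open Classical in
/-- The label at `j` predicted by orienting the one-inclusion graph of `V` along its layers. -/
noncomputable def guess (D : ℕ) (V : Set (I → Bool)) (b : I → Bool) (j : I) : Bool :=
  decide (¬ ∃ i, Function.update b j false ∈ peel D V i ∧ Function.update b j true ∉ peel D V i)

lemma guess_congr (D : ℕ) (V : Set (I → Bool)) {b b' : I → Bool} {j : I}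
    (h : ∀ i ≠ j, b i = b' i) : guess D V b j = guess D V b' j := by
  have h1 (v : Bool) : Function.update b j v = Function.update b' j v := by
    ext i
    rcases eq_or_ne i j with rfl | hi
    · simp
    · simp [hi, h i hi]
  simp [guess, h1]

lemma ncard_guess_ne_le [Finite I] {D : ℕ} {V : Set (I → Bool)} {y : I → Bool} (hy : y ∈ V)
    {n : ℕ} (hn : y ∉ peel D V n) : {j | guess D V y j ≠ y j}.ncard ≤ D := by
  classical
  obtain ⟨i, hi, hi'⟩ : ∃ i, y ∈ peel D V i ∧ y ∉ peel D V (i + 1) := by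
    by_contra! h
    exact hn (Nat.rec hy h n)
  have hdeg : {j | flipAt y j ∈ peel D V i}.ncard ≤ D := by
    by_contra! h
    exact hi' ⟨hi, h⟩
  refine (Set.ncard_le_ncard (fun j hj => ?_) (Set.toFinite _)).trans hdeg
  rw [Set.mem_ofPred_eq] at hj ⊢
  have hself : Function.update y j (y j) = y := Function.update_eq_self j y
  cases hyj : y j
  · rw [hyj] at hj hself
    simp only [guess, hself, ne_eq, Bool.not_eq_false, decide_eq_true_eq] at hj
    rw [flipAt, hyj]
    by_contra h
    exact hj ⟨i, hi, h⟩
  · rw [hyj] at hj hself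
    simp only [guess, hself, ne_eq, Bool.not_eq_true, decide_eq_false_iff_not, not_not] at hj
    obtain ⟨k, hk, hk'⟩ := hj
    rw [flipAt, hyj]
    refine antitone_peel D V ?_ hk
    by_contra! hki
    exact hk' (antitone_peel D V hki.le hi)

lemma exists_peel_eq_empty [Fintype I] {d : ℕ} {V : Set (I → Bool)}
    (hd : ∀ T : Finset I, (∀ f : I → Bool, ∃ b ∈ V, ∀ j ∈ T, b j = f j) → T.card ≤ d) :
    ∃ n, peel (2 * d) V n = ∅ := by
  classical
  obtain ⟨n, hn⟩ := WellFoundedGT.monotone_chain_condition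
    (⟨fun i => OrderDual.toDual (peel (2 * d) V i), antitone_peel (2 * d) V⟩ :
      ℕ →o (Set (I → Bool))ᵒᵈ)
  refine ⟨n, Set.not_nonempty_iff_eq_empty.1 fun ⟨b, hb⟩ => ?_⟩
  let v (s : Finset I) : I → Bool := fun j => decide (j ∈ s)
  let 𝒜 : Finset (Finset I) := {s | v s ∈ peel (2 * d) V n}
  have h𝒜 : 𝒜.Nonempty := ⟨Finset.univ.filter fun j => b j, by simpa [𝒜, v] using hb⟩
  obtain ⟨s, hs, hdeg⟩ := exists_card_neighbors_le (d := d) h𝒜 fun T hT => hd T fun f => by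
    obtain ⟨u, hu, hut⟩ := hT (T.filter_subset fun j => f j)
    refine ⟨v u, antitone_peel _ _ (Nat.zero_le n) (Finset.mem_filter.1 hu).2, fun j hj => ?_⟩
    have := congrArg (j ∈ ·) hut
    simp only [Finset.mem_inter, hj, true_and, Finset.mem_filter, eq_iff_iff] at this
    simp [v, this]
  have hs1 : v s ∈ peel (2 * d) V n := (Finset.mem_filter.1 hs).2
  have hpeel : peel (2 * d) V n = peel (2 * d) V (n + 1) := hn (n + 1) n.le_succ
  have hs2 : v s ∈ peel (2 * d) V (n + 1) := hpeel ▸ hs1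
  have hs3 := hs2.2
  have hflip (j : I) : flipAt (v s) j = v (symmDiff s {j}) := by
    ext i
    rcases eq_or_ne i j with rfl | hi
    · simp [flipAt, v, Finset.mem_symmDiff]
    · simp [flipAt, v, Finset.mem_symmDiff, hi]
  simp only [hflip] at hs3
  refine hs3.not_ge (le_of_eq_of_le ?_ hdeg)
  rw [Set.ncard_eq_toFinset_card']
  congr 1
  ext j
  simp [𝒜]

variable {D : ℕ} {V V' : Set (I → Bool)} {π : Equiv.Perm I}

lemma update_comp_perm (b : I → Bool) (j : I) (v : Bool) :
    Function.update b (π j) v ∘ π = Function.update (b ∘ π) j v :=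
  Function.update_comp_eq_of_injective b π.injective j v

lemma mem_peel_perm (h : ∀ b, b ∈ V ↔ b ∘ π ∈ V') (i : ℕ) (b : I → Bool) :
    b ∈ peel D V i ↔ b ∘ π ∈ peel D V' i := by
  induction i generalizing b with
  | zero => exact h b
  | succ i ih =>
    have : {j | flipAt b j ∈ peel D V i} = π '' {j | flipAt (b ∘ π) j ∈ peel D V' i} := by
      ext j
      obtain ⟨k, rfl⟩ := π.surjective j
      simp [flipAt, ih, update_comp_perm]
    simp only [peel, Set.mem_ofPred_eq, ih b, this, Set.ncard_image_of_injective _ π.injective]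

lemma guess_perm (h : ∀ b, b ∈ V ↔ b ∘ π ∈ V') (b : I → Bool) (j : I) :
    guess D V b (π j) = guess D V' (b ∘ π) j := by
  simp [guess, mem_peel_perm h, update_comp_perm]

end Guess

namespace PatternStrategy

variable [MeasurableSpace 𝒳] {ℋ : Set (𝒳 → Bool)} (S : PatternStrategy ℋ) {M : ℕ}

/-- The labellings of `x` in which no subsequence of `x` realizes the pattern of `σ`. -/
def labellings (σ : S.State) (x : Fin (M + 1) → 𝒳) : Set (Fin (M + 1) → Bool) :=
  {b | ∀ π : Equiv.Perm (Fin (M + 1)), ∃ l < S.dim σ,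
    S.pat σ (fun i => x (π (Fin.ofNat (M + 1) i))) l ≠ b (π (Fin.ofNat (M + 1) l))}

/-- The one-inclusion prediction at the `j`-th point of a sample. -/
noncomputable def predict (σ : S.State) (x : Fin (M + 1) → 𝒳) (b : Fin (M + 1) → Bool)
    (j : Fin (M + 1)) : Bool :=
  guess (2 * S.dim σ) (S.labellings σ x) b j

lemma measurableSet_mem_labellings (b : Fin (M + 1) → Bool) :
    MeasurableSet {p : S.State × (Fin (M + 1) → 𝒳) | b ∈ S.labellings p.1 p.2} := by
  have (π : Equiv.Perm (Fin (M + 1))) (l : ℕ) : Measurable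
      fun p : S.State × (Fin (M + 1) → 𝒳) =>
        S.pat p.1 (fun i => p.2 (π (Fin.ofNat (M + 1) i))) l :=
    (S.measurable_pat l).comp (f := fun p : S.State × (Fin (M + 1) → 𝒳) =>
      (p.1, fun i => p.2 (π (Fin.ofNat (M + 1) i)))) (by fun_prop)
  simp only [labellings, Set.mem_ofPred_eq]
  refine measurableSet_setOfPred.2 (Measurable.forall fun π => Measurable.exists fun l => ?_)
  refine Measurable.and ?_ ?_
  · exact measurableSet_setOfPred.1 (measurableSet_lt measurable_const
      (S.measurable_dim.comp measurable_fst))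
  · exact Measurable.not (measurableSet_setOfPred.1
      (measurableSet_eq_fun (this π l) measurable_const))

lemma measurable_predict (j : Fin (M + 1)) :
    Measurable fun p : S.State × (Fin (M + 1) → 𝒳) × (Fin (M + 1) → Bool) =>
      S.predict p.1 p.2.1 p.2.2 j := by
  let c (p : S.State × (Fin (M + 1) → 𝒳) × (Fin (M + 1) → Bool)) :
      ℕ × ((Fin (M + 1) → Bool) → Prop) × (Fin (M + 1) → Bool) :=
    (S.dim p.1, fun b => b ∈ S.labellings p.1 p.2.1, p.2.2)
  have hc : Measurable c := by
    refine (S.measurable_dim.comp measurable_fst).prodMk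
      (Measurable.prodMk (measurable_pi_lambda _ fun b => ?_) (by fun_prop))
    exact (measurableSet_setOfPred.1 (S.measurableSet_mem_labellings b)).comp
      (g := fun p : S.State × (Fin (M + 1) → 𝒳) => b ∈ S.labellings p.1 p.2)
      (f := fun p : S.State × (Fin (M + 1) → 𝒳) × (Fin (M + 1) → Bool) => (p.1, p.2.1))
      (by fun_prop)
  exact (Measurable.of_discrete (f := fun q : ℕ × ((Fin (M + 1) → Bool) → Prop) ×
    (Fin (M + 1) → Bool) => guess (2 * q.1) {b | q.2.1 b} q.2.2 j)).comp hc

lemma predict_congr (σ : S.State) (x : Fin (M + 1) → 𝒳) {b b' : Fin (M + 1) → Bool}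
    {j : Fin (M + 1)} (h : ∀ i ≠ j, b i = b' i) : S.predict σ x b j = S.predict σ x b' j :=
  guess_congr _ _ h

lemma predict_perm (σ : S.State) (x : Fin (M + 1) → 𝒳) (b : Fin (M + 1) → Bool)
    (π : Equiv.Perm (Fin (M + 1))) (j : Fin (M + 1)) :
    S.predict σ (x ∘ π) (b ∘ π) j = S.predict σ x b (π j) := by
  refine (guess_perm (fun b => ?_) b j).symm
  refine ⟨fun h ρ => h (ρ.trans π), fun h ρ => ?_⟩
  simpa using h (ρ.trans π.symm)

lemma card_le_of_shatters (σ : S.State) (x : Fin (M + 1) → 𝒳) (T : Finset (Fin (M + 1)))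
    (hT : ∀ f : Fin (M + 1) → Bool, ∃ b ∈ S.labellings σ x, ∀ j ∈ T, b j = f j) :
    T.card ≤ S.dim σ := by
  by_contra! hlt
  obtain ⟨T', hT', hcard⟩ := Finset.exists_subset_card_eq hlt.le
  have hM : S.dim σ ≤ M + 1 := hlt.le.trans (by simpa using T.card_le_univ)
  have hcard' : Fintype.card {l : Fin (M + 1) // l.val < S.dim σ} = Fintype.card {l // l ∈ T'} := by
    rw [Fintype.card_coe, hcard, Fintype.card_subtype, Fin.card_filter_val_lt, min_eq_right hM]
  let e := Fintype.equivOfCardEq hcard'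
  let π : Equiv.Perm (Fin (M + 1)) := e.extendSubtype
  obtain ⟨b, hb, hbT⟩ := hT fun j =>
    S.pat σ (fun i => x (π (Fin.ofNat (M + 1) i))) (π.symm j).val
  obtain ⟨l, hl, hne⟩ := hb π
  have hval : (Fin.ofNat (M + 1) l).val = l := Nat.mod_eq_of_lt (hl.trans_le hM)
  have hmem : π (Fin.ofNat (M + 1) l) ∈ T :=
    hT' (e.extendSubtype_mem (Fin.ofNat (M + 1) l) (hval.symm ▸ hl))
  apply hne
  rw [hbT _ hmem, Equiv.symm_apply_apply, hval]

lemma ncard_predict_ne_le (σ : S.State) {x : Fin (M + 1) → 𝒳} {y : Fin (M + 1) → Bool}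
    (hy : y ∈ S.labellings σ x) : {j | S.predict σ x y j ≠ y j}.ncard ≤ 2 * S.dim σ := by
  obtain ⟨n, hn⟩ := exists_peel_eq_empty (S.card_le_of_shatters σ x)
  exact ncard_guess_ne_le hy (n := n) (by simp [hn])

variable (P : Measure (𝒳 × Bool)) [IsProbabilityMeasure P]

lemma ae_mem_labellings {σ : S.State} (hσ : S.per P σ = 0) (hM : S.dim σ ≤ M + 1) :
    ∀ᵐ z ∂(iid P (Fin (M + 1))), (fun j => (z j).2) ∈ S.labellings σ fun j => (z j).1 := by
  have hmatch : MeasurableSet {e | S.Match σ e} :=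
    S.measurableSet_match.preimage measurable_prodMk_left
  have hpull : iid P (Fin (M + 1)) {z | S.Match σ fun l => z (Fin.ofNat (M + 1) l)} = 0 := by
    have hmeas : MeasurableSet {z : Fin (M + 1) → 𝒳 × Bool |
        S.Match σ fun l => z (Fin.ofNat (M + 1) l)} :=
      hmatch.preimage (f := fun (z : Fin (M + 1) → 𝒳 × Bool) (l : ℕ) => z (Fin.ofNat (M + 1) l))
        (by fun_prop)
    rw [← (measurePreserving_comp_injective P
      (Fin.val_injective (n := M + 1))).measure_preimage hmeas.nullMeasurableSet]
    refine (congrArg (iid P ℕ) ?_).trans hσ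
    ext e
    have hval (l : ℕ) (hl : l < S.dim σ) : (Fin.ofNat (M + 1) l).val = l :=
      Nat.mod_eq_of_lt (hl.trans_le hM)
    simp only [Match, Set.mem_preimage, Set.mem_ofPred_eq, Function.comp_apply]
    rw [S.pat_congr σ (fun j => (e (Fin.ofNat (M + 1) j).val).1) (fun j => (e j).1)
      fun i hi => by rw [hval i hi]]
    exact forall₂_congr fun i hi => by rw [hval i hi]
  have hπ : ∀ᵐ z ∂(iid P (Fin (M + 1))), ∀ π : Equiv.Perm (Fin (M + 1)),
      ¬ S.Match σ fun l => z (π (Fin.ofNat (M + 1) l)) := by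
    refine ae_all_iff.2 fun π => ?_
    have h0 : ∀ᵐ z ∂(iid P (Fin (M + 1))), ¬ S.Match σ fun l => z (Fin.ofNat (M + 1) l) := by
      simpa [ae_iff] using hpull
    exact (measurePreserving_comp_injective P π.injective).quasiMeasurePreserving.ae h0
  filter_upwards [hπ] with z hz π
  simpa [Match] using hz π

lemma measurableSet_predict_ne (j : Fin (M + 1)) :
    MeasurableSet {p : S.State × (Fin (M + 1) → 𝒳 × Bool) |
      S.predict p.1 (fun i => (p.2 i).1) (fun i => (p.2 i).2) j ≠ (p.2 j).2} := by
  refine (measurableSet_eq_fun ?_ (by fun_prop)).compl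
  exact (S.measurable_predict j).comp (f := fun p : S.State × (Fin (M + 1) → 𝒳 × Bool) =>
    (p.1, fun i => (p.2 i).1, fun i => (p.2 i).2)) (by fun_prop)

/-- Averaging over the transpositions bounds the error of the one-inclusion prediction. -/
lemma mul_measure_predict_ne_le {σ : S.State} (hσ : S.per P σ = 0) (hM : S.dim σ ≤ M + 1) :
    (M + 1 : ℕ) * iid P (Fin (M + 1))
      {z | S.predict σ (fun i => (z i).1) (fun i => (z i).2) 0 ≠ (z 0).2} ≤
      (2 * S.dim σ : ℕ) := by
  let W (j : Fin (M + 1)) : Set (Fin (M + 1) → 𝒳 × Bool) :=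
    {z | S.predict σ (fun i => (z i).1) (fun i => (z i).2) j ≠ (z j).2}
  have hW (j) : MeasurableSet (W j) :=
    (S.measurableSet_predict_ne j).preimage measurable_prodMk_left
  have hswap (j) : iid P (Fin (M + 1)) (W j) = iid P (Fin (M + 1)) (W 0) := by
    rw [← (measurePreserving_comp_injective P (Equiv.swap 0 j).injective).measure_preimage
      (hW 0).nullMeasurableSet]
    congr 1
    ext z
    have := S.predict_perm σ (fun i => (z i).1) (fun i => (z i).2) (Equiv.swap 0 j) 0
    rw [Equiv.swap_apply_left] at this
    simp only [W, Set.mem_preimage, Set.mem_ofPred_eq, Function.comp_apply, Equiv.swap_apply_left,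
      ← this]
    rfl
  calc _ = ∑ j, iid P (Fin (M + 1)) (W j) := by simp [hswap, W]
    _ = ∑ j, ∫⁻ z, (W j).indicator 1 z ∂(iid P (Fin (M + 1))) := by
      simp_rw [lintegral_indicator_one (hW _)]
    _ = ∫⁻ z, ∑ j, (W j).indicator 1 z ∂(iid P (Fin (M + 1))) :=
      (lintegral_finsetSum _ fun j _ => measurable_one.indicator (hW j)).symm
    _ ≤ ∫⁻ _, (2 * S.dim σ : ℕ) ∂(iid P (Fin (M + 1))) := by
      refine lintegral_mono_ae ?_
      filter_upwards [S.ae_mem_labellings P hσ hM] with z hz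
      refine le_of_eq_of_le ?_ (Nat.cast_le.2 (S.ncard_predict_ne_le σ hz))
      classical
      rw [Set.ncard_eq_toFinset_card']
      simp [Set.indicator_apply, W, Finset.card_filter, ite_not]
    _ = _ := by simp

end PatternStrategy

namespace PatternStrategy

/-! ### The learner -/

variable [MeasurableSpace 𝒳] {ℋ : Set (𝒳 → Bool)} (S : PatternStrategy ℋ)

/-- The `i`-th copy of an array inside the odd coordinates of `ω`. -/
def window {E : Type*} (i : ℕ) (ω : ℕ → E) : ℕ × ℕ → E :=
  fun q => ω (2 * Nat.pair i (Nat.pair q.1 q.2) + 1)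

/-- The initial segment of length `M + 1` of the even coordinates of `ω`. -/
def evens {E : Type*} (M : ℕ) (ω : ℕ → E) : Fin (M + 1) → E := fun m => ω (2 * m)

/-- The one-inclusion prediction at the point `(ω 0).1` using the `i`-th window. -/
noncomputable def ballot (r M i : ℕ) (ω : ℕ → 𝒳 × Bool) : Bool :=
  S.predict (S.run r S.init (window i ω)) (fun m => (evens M ω m).1) (fun m => (evens M ω m).2) 0

/-- The majority of the first `N` ballots. -/
noncomputable def vote (r M N : ℕ) (ω : ℕ → 𝒳 × Bool) : Bool :=
  decide (N < 2 * ((Finset.range N).filter fun i => S.ballot r M i ω = true).card)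

lemma measurable_window {E : Type*} [MeasurableSpace E] (i : ℕ) :
    Measurable (window i : (ℕ → E) → ℕ × ℕ → E) :=
  measurable_pi_lambda _ fun _ => measurable_pi_apply _

lemma measurable_evens {E : Type*} [MeasurableSpace E] (M : ℕ) :
    Measurable (evens M : (ℕ → E) → Fin (M + 1) → E) :=
  measurable_pi_lambda _ fun _ => measurable_pi_apply _

lemma measurable_run_init (r : ℕ) :
    Measurable fun τ : ℕ × ℕ → 𝒳 × Bool => S.run r S.init τ :=
  (S.measurable_run r).comp measurable_prodMk_left

lemma measurable_ballot (r M i : ℕ) : Measurable (S.ballot r M i) := by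
  have h1 := (S.measurable_run_init r).comp (measurable_window (E := 𝒳 × Bool) i)
  have h2 := measurable_evens (E := 𝒳 × Bool) M
  exact (S.measurable_predict 0).comp (h1.prodMk (Measurable.prodMk
    (f := fun ω m => (evens M ω m).1) (g := fun ω m => (evens M ω m).2)
    (by fun_prop) (by fun_prop)))

lemma measurable_vote (r M N : ℕ) : Measurable (S.vote r M N) := by
  have h : Measurable fun ω (i : Fin N) => S.ballot r M i ω :=
    measurable_pi_lambda _ fun i => S.measurable_ballot r M i
  have hv : S.vote r M N = (fun b : Fin N → Bool =>
      decide (N < 2 * (Finset.univ.filter fun i => b i = true).card)) ∘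
        fun ω (i : Fin N) => S.ballot r M i ω := by
    ext ω
    simp only [vote, Function.comp_apply, Finset.card_filter, Finset.sum_range]
  rw [hv]
  exact (Measurable.of_discrete).comp h

lemma vote_congr {r M N n : ℕ} (hM : 2 * M ≤ n)
    (hN : ∀ i < N, ∀ t < r, ∀ j < r + 1, 2 * Nat.pair i (Nat.pair t j) + 1 ≤ n)
    {ω ω' : ℕ → 𝒳 × Bool} (h0 : (ω 0).1 = (ω' 0).1) (h : ∀ k < n, ω (k + 1) = ω' (k + 1)) :
    S.vote r M N ω = S.vote r M N ω' := by
  have hb (i : ℕ) (hi : i < N) : S.ballot r M i ω = S.ballot r M i ω' := by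
    have hrun : S.run r S.init (window i ω) = S.run r S.init (window i ω') :=
      S.run_congr r _ fun t ht j hj => h _ (hN i hi t ht j (by rw [S.dim_init] at hj; omega))
    have hne (m : Fin (M + 1)) (hm : m ≠ 0) : evens M ω m = evens M ω' m := by
      have hm0 : m.val ≠ 0 := fun h => hm (Fin.ext h)
      obtain ⟨k, hk⟩ : ∃ k, 2 * m.val = k + 1 := ⟨2 * m.val - 1, by omega⟩
      rw [evens, evens, hk]
      exact h k (by have := m.is_lt; omega)
    have hx : (fun m => (evens M ω m).1) = fun m => (evens M ω' m).1 := by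
      ext m
      rcases eq_or_ne m 0 with rfl | hm
      · exact h0
      · rw [hne m hm]
    rw [ballot, ballot, hrun, hx]
    exact S.predict_congr _ _ fun m hm => by rw [hne m hm]
  rw [vote, vote, Finset.filter_congr fun i hi => by rw [hb i (Finset.mem_range.1 hi)]]

lemma le_two_mul_card_of_vote_ne {r M N : ℕ} {ω : ℕ → 𝒳 × Bool} {y : Bool}
    (h : S.vote r M N ω ≠ y) :
    N ≤ 2 * ((Finset.range N).filter fun i => S.ballot r M i ω ≠ y).card := by
  cases y
  · simp only [vote, ne_eq, Bool.not_eq_false, decide_eq_true_eq] at h ⊢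
    exact h.le
  · simp only [vote, ne_eq, Bool.not_eq_true, decide_eq_false_iff_not, not_lt] at h ⊢
    have := Finset.card_filter_add_card_filter_not (s := Finset.range N)
      fun i => S.ballot r M i ω = true
    simp only [Bool.not_eq_true, Finset.card_range] at this
    omega

section Error

variable (P : Measure (𝒳 × Bool)) [IsProbabilityMeasure P]

/-- The windows leading to a state of dimension at most `K` whose pattern is almost surely not
realized. -/
def stable (r K : ℕ) : Set (ℕ × ℕ → 𝒳 × Bool) :=
  {τ | S.per P (S.run r S.init τ) = 0 ∧ S.dim (S.run r S.init τ) ≤ K}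

lemma measurableSet_stable (r K : ℕ) : MeasurableSet (S.stable P r K) :=
  (((S.measurable_per P).comp (S.measurable_run_init r)) (measurableSet_singleton 0)).inter
    ((S.measurable_dim.comp (S.measurable_run_init r)) measurableSet_Iic)

lemma measurableSet_ballot_ne (r M i : ℕ) :
    MeasurableSet {ω | S.ballot r M i ω ≠ (ω 0).2} :=
  (measurableSet_eq_fun (S.measurable_ballot r M i) (by fun_prop)).compl

lemma measure_stable_inter_ballot_ne_le {r K M : ℕ} (hK : K ≤ M + 1) (i : ℕ) :
    iid P ℕ (window i ⁻¹' S.stable P r K ∩ {ω | S.ballot r M i ω ≠ (ω 0).2}) ≤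
      (2 * K : ℕ) / (M + 1 : ℕ) := by
  have hinj : Function.Injective (Sum.elim
      (fun q : ℕ × ℕ => 2 * Nat.pair i (Nat.pair q.1 q.2) + 1)
      (fun m : Fin (M + 1) => 2 * m.val)) := by
    rintro (⟨a, b⟩ | m) (⟨c, d⟩ | m') h
    · have : Nat.pair i (Nat.pair a b) = Nat.pair i (Nat.pair c d) := by
        simp only [Sum.elim_inl] at h; omega
      simp only [Nat.pair_eq_pair, true_and] at this
      rw [this.1, this.2]
    · simp only [Sum.elim_inl, Sum.elim_inr] at h; omega
    · simp only [Sum.elim_inl, Sum.elim_inr] at h; omega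
    · simp only [Sum.elim_inr] at h
      rw [Fin.ext (by omega : m.val = m'.val)]
  have hmp := measurePreserving_comp_prod P hinj
  let A : Set ((ℕ × ℕ → 𝒳 × Bool) × (Fin (M + 1) → 𝒳 × Bool)) :=
    {p | p.1 ∈ S.stable P r K ∧
      S.predict (S.run r S.init p.1) (fun m => (p.2 m).1) (fun m => (p.2 m).2) 0 ≠ (p.2 0).2}
  have hA : MeasurableSet A :=
    (measurable_fst (S.measurableSet_stable P r K)).inter
      ((S.measurableSet_predict_ne 0).preimage
        (((S.measurable_run_init r).comp measurable_fst).prodMk measurable_snd))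
  have hpre : window i ⁻¹' S.stable P r K ∩ {ω | S.ballot r M i ω ≠ (ω 0).2} =
      (fun ω => (ω ∘ (fun q : ℕ × ℕ => 2 * Nat.pair i (Nat.pair q.1 q.2) + 1),
        ω ∘ fun m : Fin (M + 1) => 2 * m.val)) ⁻¹' A := rfl
  rw [hpre, hmp.measure_preimage hA.nullMeasurableSet, Measure.prod_apply hA]
  calc _ ≤ ∫⁻ _, ((2 * K : ℕ) / (M + 1 : ℕ) : ℝ≥0∞) ∂(iid P (ℕ × ℕ)) := by
        refine lintegral_mono fun τ => ?_
        by_cases hτ : τ ∈ S.stable P r K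
        · have := S.mul_measure_predict_ne_le P hτ.1 (hτ.2.trans hK)
          rw [ENNReal.le_div_iff_mul_le (by simp) (by simp), mul_comm]
          refine le_trans ?_ (this.trans (Nat.cast_le.2 (Nat.mul_le_mul_left 2 hτ.2)))
          gcongr
          exact fun z hz => hz.2
        · have : Prod.mk τ ⁻¹' A = ∅ := by
            ext z
            simp [A, hτ]
          simp [this]
    _ = _ := by simp

/-- The majority errs with small probability if most windows lead to a stable state. -/
lemma measure_vote_ne_le {r K M N : ℕ} (hK : K ≤ M + 1) (hN : 0 < N)
    (hr : iid P (ℕ × ℕ) (S.stable P r K)ᶜ ≤ 255⁻¹) :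
    iid P ℕ {ω | S.vote r M N ω ≠ (ω 0).2} ≤ 2⁻¹ ^ N + 4 * ((2 * K : ℕ) / (M + 1 : ℕ)) := by
  classical
  let f : (ℕ × ℕ → 𝒳 × Bool) → ℝ≥0∞ := fun τ => if τ ∈ S.stable P r K then 1 else 256
  have hf : Measurable f :=
    Measurable.ite (S.measurableSet_stable P r K) measurable_const measurable_const
  let Q (i : ℕ) : Set (ℕ → 𝒳 × Bool) :=
    window i ⁻¹' S.stable P r K ∩ {ω | S.ballot r M i ω ≠ (ω 0).2}
  have hQ (i : ℕ) : MeasurableSet (Q i) :=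
    (measurable_window i (S.measurableSet_stable P r K)).inter (S.measurableSet_ballot_ne r M i)
  have hfint : ∫⁻ τ, f τ ∂(iid P (ℕ × ℕ)) ≤ 2 := by
    have hf' : f = fun τ => 1 + (S.stable P r K)ᶜ.indicator (fun _ => 255) τ := by
      ext τ
      by_cases h : τ ∈ S.stable P r K <;> simp [f, h]
      norm_num
    rw [hf', lintegral_add_left measurable_const,
      lintegral_indicator_const (S.measurableSet_stable P r K).compl]
    calc _ ≤ 1 + 255 * (255⁻¹ : ℝ≥0∞) := by
          gcongr
          simp
      _ = 2 := by rw [ENNReal.mul_inv_cancel (by simp) (by simp)]; norm_num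
  have hprod : ∫⁻ ω, ∏ i ∈ Finset.range N, f (window i ω) ∂(iid P ℕ) ≤ 2 ^ N := by
    have hinj : Function.Injective fun q : ℕ × (ℕ × ℕ) =>
        2 * Nat.pair q.1 (Nat.pair q.2.1 q.2.2) + 1 := by
      rintro ⟨i, a, b⟩ ⟨j, c, d⟩ h
      have : Nat.pair i (Nat.pair a b) = Nat.pair j (Nat.pair c d) := by
        simp only at h; omega
      simp only [Nat.pair_eq_pair] at this
      rw [this.1, this.2.1, this.2.2]
    have hmp := measurePreserving_comp_injective P hinj
    have hF : Measurable fun τ : ℕ × (ℕ × ℕ) → 𝒳 × Bool =>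
        ∏ i ∈ Finset.range N, f fun q => τ (i, q) :=
      Finset.measurable_prod _ fun i _ => hf.comp (by fun_prop)
    refine le_of_eq_of_le ((hmp.lintegral_comp hF).trans (lintegral_prod_rows P hf N)) ?_
    gcongr
  have hpt (ω : ℕ → 𝒳 × Bool) :
      {ω | S.vote r M N ω ≠ (ω 0).2}.indicator (1 : (ℕ → 𝒳 × Bool) → ℝ≥0∞) ω ≤
      4⁻¹ ^ N * ∏ i ∈ Finset.range N, f (window i ω) +
        4 / N * ∑ i ∈ Finset.range N, (Q i).indicator 1 ω := by
    refine Set.indicator_apply_le' (fun hω => ?_) fun _ => zero_le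
    set b := ((Finset.range N).filter fun i => window i ω ∉ S.stable P r K).card with hb
    set g := ((Finset.range N).filter fun i => ω ∈ Q i).card with hg
    have hbg : N ≤ 2 * (b + g) := by
      refine (S.le_two_mul_card_of_vote_ne hω).trans (Nat.mul_le_mul_left 2 ?_)
      rw [hb, hg]
      refine (Finset.card_le_card fun i hi => ?_).trans (Finset.card_union_le _ _)
      simp only [Finset.mem_union, Finset.mem_filter, Q, Set.mem_inter_iff, Set.mem_preimage,
        Set.mem_ofPred_eq] at hi ⊢
      tauto
    have hprodb : ∏ i ∈ Finset.range N, f (window i ω) = 256 ^ b := by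
      simp [f, Finset.prod_ite, hb]
    have hsumg : ∑ i ∈ Finset.range N, (Q i).indicator (1 : (ℕ → 𝒳 × Bool) → ℝ≥0∞) ω = g := by
      simp [Set.indicator_apply, hg, Finset.card_filter]
    rw [hprodb, hsumg, Pi.one_apply]
    rcases le_total N (4 * b) with h | h
    · refine le_add_right ?_
      have h4 : (4 : ℝ≥0∞) ^ N ≤ 256 ^ b := by
        calc (4 : ℝ≥0∞) ^ N ≤ 4 ^ (4 * b) := pow_le_pow_right₀ (by norm_num) h
          _ = 256 ^ b := by rw [pow_mul]; norm_num
      rw [← ENNReal.inv_pow, mul_comm, ← div_eq_mul_inv,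
        ENNReal.le_div_iff_mul_le (by simp) (by simp), one_mul]
      exact h4
    · refine le_add_left ?_
      have h4 : N ≤ 4 * g := by omega
      rw [← ENNReal.mul_div_right_comm, ENNReal.le_div_iff_mul_le (by simp [hN.ne']) (by simp),
        one_mul]
      exact_mod_cast h4
  have hV : MeasurableSet {ω | S.vote r M N ω ≠ (ω 0).2} :=
    (measurableSet_eq_fun (S.measurable_vote r M N) (by fun_prop)).compl
  have hfw : Measurable fun ω => ∏ i ∈ Finset.range N, f (window i ω) :=
    Finset.measurable_prod _ fun i _ => hf.comp (measurable_window i)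
  rw [← lintegral_indicator_one hV]
  refine (lintegral_mono hpt).trans ?_
  rw [lintegral_add_left (hfw.const_mul _), lintegral_const_mul _ hfw, lintegral_const_mul _
    (Finset.measurable_sum _ fun i _ => measurable_one.indicator (hQ i)),
    lintegral_finsetSum _ fun i _ => measurable_one.indicator (hQ i)]
  simp_rw [lintegral_indicator_one (hQ _)]
  refine add_le_add ?_ ?_
  · calc _ ≤ (4⁻¹ : ℝ≥0∞) ^ N * 2 ^ N := by gcongr
      _ = 2⁻¹ ^ N := by
        rw [← mul_pow]
        congr 1
        rw [← ENNReal.toReal_eq_toReal_iff' (by finiteness) (by finiteness)]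
        norm_num
  · calc _ ≤ (4 / N : ℝ≥0∞) * ∑ i ∈ Finset.range N, ((2 * K : ℕ) / (M + 1 : ℕ) : ℝ≥0∞) := by
          gcongr with i
          exact S.measure_stable_inter_ballot_ne_le P hK i
      _ = _ := by
        rw [Finset.sum_const, Finset.card_range, nsmul_eq_mul, ← mul_assoc,
          ENNReal.div_mul_cancel (by simp [hN.ne']) (by simp)]

end Error

end PatternStrategy

lemma measurePreserving_sample_test {E : Type*} [MeasurableSpace E] (P : Measure E)
    [IsProbabilityMeasure P] (n : ℕ) :
    MeasurePreserving (fun ω : ℕ → E => (fun k : Fin n => ω (k + 1), ω 0)) (iid P ℕ)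
      ((Measure.pi fun _ : Fin n => P).prod P) := by
  have hinj : Function.Injective (Sum.elim (fun k : Fin n => k.val + 1) fun _ : Unit => 0) := by
    rintro (k | k) (l | l) h
    · simp only [Sum.elim_inl, add_left_inj] at h
      rw [Fin.ext h]
    · simp at h
    · simp at h
    · rfl
  have h1 := measurePreserving_comp_prod P hinj
  have h2 : MeasurePreserving (Function.eval ()) (iid P Unit) P :=
    measurePreserving_eval_infinitePi _ ()
  have h3 := (MeasurePreserving.id (iid P (Fin n))).prod h2
  rw [iid, Measure.infinitePi_eq_pi] at h3
  exact h3.comp (by simpa [iid, Measure.infinitePi_eq_pi] using h1)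

lemma expErr_eq [MeasurableSpace 𝒳] (P : Measure (𝒳 × Bool)) [IsProbabilityMeasure P]
    (A : LearningAlgorithm 𝒳) {n : ℕ}
    (hA : Measurable fun q : (Fin n → 𝒳 × Bool) × 𝒳 => A.H n q.1 q.2) :
    expErr P A n =
      iid P ℕ {ω | A.H n (fun k => ω (k + 1)) (ω 0).1 ≠ (ω 0).2} := by
  have hm : MeasurableSet {p : (Fin n → 𝒳 × Bool) × (𝒳 × Bool) | A.H n p.1 p.2.1 ≠ p.2.2} :=
    (measurableSet_eq_fun (hA.comp (f := fun p : (Fin n → 𝒳 × Bool) × (𝒳 × Bool) => (p.1, p.2.1))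
      (by fun_prop)) (by fun_prop)).compl
  exact (((measurePreserving_sample_test P n).measure_preimage hm.nullMeasurableSet).trans
    (Measure.prod_apply hm)).symm

lemma expErr_le_one [MeasurableSpace 𝒳] (P : Measure (𝒳 × Bool)) [IsProbabilityMeasure P]
    (A : LearningAlgorithm 𝒳) (n : ℕ) : expErr P A n ≤ 1 :=
  (lintegral_mono fun _ => prob_le_one).trans (by simp)

/-- The test point `x` followed by the sample `s` and an irrelevant tail. -/
def stream {n : ℕ} (s : Fin n → 𝒳 × Bool) (x : 𝒳) : ℕ → 𝒳 × Bool
  | 0 => (x, false)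
  | k + 1 => if h : k < n then s ⟨k, h⟩ else (x, false)

lemma measurable_stream [MeasurableSpace 𝒳] (n : ℕ) :
    Measurable fun q : (Fin n → 𝒳 × Bool) × 𝒳 => stream q.1 q.2 := by
  refine measurable_pi_lambda _ fun k => ?_
  cases k with
  | zero => exact measurable_snd.prodMk measurable_const
  | succ k =>
    by_cases h : k < n
    · simp only [stream, h, dite_true]
      fun_prop
    · simp only [stream, h, dite_false]
      fun_prop

lemma two_mul_pair_lt {N i t j : ℕ} (hi : i < N) (ht : t < N.sqrt) (hj : j < N.sqrt + 1) :
    2 * Nat.pair i (Nat.pair t j) + 1 < 2 * (4 * N) ^ 2 := by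
  have h0 : N.sqrt ^ 2 ≤ N := Nat.sqrt_le' N
  have h1 : Nat.pair t j < 4 * N := by
    refine (Nat.pair_lt_max_add_one_sq t j).trans_le ?_
    have : max t j + 1 ≤ 2 * N.sqrt := by omega
    calc _ ≤ (2 * N.sqrt) ^ 2 := Nat.pow_le_pow_left this 2
      _ ≤ 4 * N := by nlinarith
  have h2 : Nat.pair i (Nat.pair t j) < (4 * N) ^ 2 :=
    (Nat.pair_lt_max_add_one_sq _ _).trans_le (Nat.pow_le_pow_left (by omega) 2)
  omega

lemma two_mul_sq_log_le {n : ℕ} (hn : 2 ^ 14 ≤ n) : 2 * (4 * (Nat.log 2 n + 1)) ^ 2 ≤ n := by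
  have h1 (L : ℕ) (hL : 14 ≤ L) : 2 * (4 * (L + 1)) ^ 2 ≤ 2 ^ L := by
    induction L, hL using Nat.le_induction with
    | base => norm_num
    | succ L hL ih =>
      have h2 : (L + 1 + 1) ^ 2 ≤ 2 * (L + 1) ^ 2 := by nlinarith
      rw [pow_succ 2 L, mul_pow]
      rw [mul_pow] at ih
      linarith
  exact (h1 _ (Nat.le_log_of_pow_le one_lt_two hn)).trans (Nat.pow_log_le_self 2 (by omega))

namespace PatternStrategy

variable [MeasurableSpace 𝒳] {ℋ : Set (𝒳 → Bool)} (S : PatternStrategy ℋ)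

/-- The majority learner, with logarithmically many windows. -/
noncomputable def predictor (n : ℕ) (s : Fin n → 𝒳 × Bool) (x : 𝒳) : Bool :=
  S.vote (Nat.log 2 n + 1).sqrt (n / 2) (Nat.log 2 n + 1) (stream s x)

lemma measurable_predictor (n : ℕ) :
    Measurable fun q : (Fin n → 𝒳 × Bool) × 𝒳 => S.predictor n q.1 q.2 :=
  (S.measurable_vote _ _ _).comp (measurable_stream n)

/-- The learning algorithm obtained from a pattern strategy. -/
noncomputable def learner : LearningAlgorithm 𝒳 where
  H := S.predictor
  meas n _ _ := (S.measurable_predictor n).nullMeasurable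

theorem exists_expErr_learner_le (P : Measure (𝒳 × Bool)) [IsProbabilityMeasure P]
    (hP : Realizable ℋ P) :
    ∃ C : ℕ, 0 < C ∧ ∀ n, 1 ≤ n → expErr P S.learner n ≤ (C : ℝ≥0∞) / n := by
  obtain ⟨K, r₀, hK⟩ := S.exists_stable hP (ε := 255⁻¹) (by simp)
  set n₀ := max (2 ^ 14) (max (2 * K) (2 ^ r₀ ^ 2)) with hn₀
  refine ⟨n₀ + (16 * K + 1), by omega, fun n hn => ?_⟩
  have hn0 : (n : ℝ≥0∞) ≠ 0 := by simp; omega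
  rcases lt_or_ge n n₀ with hlt | hge
  · refine (expErr_le_one P S.learner n).trans ?_
    rw [ENNReal.le_div_iff_mul_le (by simp [hn0]) (by simp), one_mul]
    exact_mod_cast hlt.le.trans (Nat.le_add_right _ _)
  have hn14 : 2 ^ 14 ≤ n := le_trans (le_max_left _ _) hge
  have hnK : 2 * K ≤ n := le_trans (by simp [hn₀]) hge
  have hnr : 2 ^ r₀ ^ 2 ≤ n := le_trans (by simp [hn₀]) hge
  set N := Nat.log 2 n + 1 with hN
  have hr : r₀ ≤ N.sqrt :=
    Nat.le_sqrt'.2 ((Nat.le_log_of_pow_le one_lt_two hnr).trans (Nat.le_succ _))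
  have hvote (ω : ℕ → 𝒳 × Bool) : S.predictor n (fun k => ω (k + 1)) (ω 0).1 =
      S.vote N.sqrt (n / 2) N ω := by
    refine S.vote_congr (n := n) (by omega) (fun i hi t ht j hj => ?_) rfl fun k hk => ?_
    · exact (two_mul_pair_lt hi ht hj).le.trans (two_mul_sq_log_le hn14)
    · simp [stream, hk]
  rw [expErr_eq P S.learner (S.measurable_predictor n)]
  simp only [learner, hvote]
  refine (S.measure_vote_ne_le P (K := K) (by omega) (Nat.succ_pos _) (hK _ hr)).trans ?_
  have hpow : (2⁻¹ : ℝ≥0∞) ^ N ≤ 1 / n := by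
    rw [← ENNReal.inv_pow, one_div, ENNReal.inv_le_inv]
    exact_mod_cast (Nat.lt_pow_succ_log_self one_lt_two n).le
  have hdiv : 4 * ((2 * K : ℕ) / (n / 2 + 1 : ℕ) : ℝ≥0∞) ≤ (16 * K : ℕ) / n := by
    rw [ENNReal.le_div_iff_mul_le (by simp [hn0]) (by simp), ← mul_div_assoc,
      ENNReal.mul_comm_div, ← mul_div_assoc]
    refine ENNReal.div_le_of_le_mul ?_
    have : n ≤ 2 * (n / 2 + 1) := by omega
    exact_mod_cast (by nlinarith : 4 * (2 * K) * n ≤ 16 * K * (n / 2 + 1))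
  calc _ ≤ 1 / (n : ℝ≥0∞) + (16 * K : ℕ) / n := add_le_add hpow hdiv
    _ ≤ _ := by
      rw [← ENNReal.add_div]
      gcongr
      exact_mod_cast (by omega : 1 + 16 * K ≤ n₀ + (16 * K + 1))

end PatternStrategy

end VCLGame

/-- **Theorem 5.3 (linear upper bound).** If a measurable concept class `ℋ` on a Polish space has
no infinite VCL tree, then there exists a learning algorithm such that for every realizable `P`
there is `C > 0` with `E[er_P(ĥ_n)] ≤ C/n` for all `n ≥ 1`; i.e. `ℋ` is learnable at rate
`1/n`. -/
theorem linear_upper_bound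
    (𝒳 : Type*) [TopologicalSpace 𝒳] [PolishSpace 𝒳] [MeasurableSpace 𝒳] [BorelSpace 𝒳]
    (ℋ : Set (𝒳 → Bool)) (hmeas : MeasurableClass 𝒳 ℋ)
    (htree : ¬ HasInfiniteVCLTree ℋ) :
    (∃ A : LearningAlgorithm 𝒳,
      ∀ P : MeasureTheory.Measure (𝒳 × Bool),
        MeasureTheory.IsProbabilityMeasure P → Realizable ℋ P →
          ∃ C > (0 : ℝ), ∀ n : ℕ, 1 ≤ n →
            expErr P A n ≤ ENNReal.ofReal (C / n)) ∧
    LearnableAtRate ℋ (fun n => 1 / max (n : ℝ) 1) := by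
  suffices h : ∃ A : LearningAlgorithm 𝒳,
      ∀ P : MeasureTheory.Measure (𝒳 × Bool), MeasureTheory.IsProbabilityMeasure P →
        Realizable ℋ P → ∃ C : ℕ, 0 < C ∧ ∀ n, 1 ≤ n → expErr P A n ≤ (C : ℝ≥0∞) / n by
    obtain ⟨A, hA⟩ := h
    have hC (C n : ℕ) (hn : 1 ≤ n) : (C : ℝ≥0∞) / n = ENNReal.ofReal (C / n) := by
      rw [ENNReal.ofReal_div_of_pos (by exact_mod_cast hn), ENNReal.ofReal_natCast,
        ENNReal.ofReal_natCast]
    refine ⟨⟨A, fun P hP hreal => ?_⟩, A, fun P hP hreal => ?_⟩ <;>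
      obtain ⟨C, hC0, hAC⟩ := hA P hP hreal
    · exact ⟨C, by exact_mod_cast hC0, fun n hn => (hAC n hn).trans_eq (hC C n hn)⟩
    · refine ⟨C, by exact_mod_cast hC0, 1, one_pos, fun n => ?_⟩
      rcases Nat.eq_zero_or_pos n with rfl | hn
      · refine (VCLGame.expErr_le_one P A 0).trans ?_
        simpa [Nat.one_le_iff_ne_zero] using hC0.ne'
      · refine (hAC n hn).trans_eq ?_
        have h1 : max (n : ℝ) 1 = n := max_eq_left (by exact_mod_cast hn)
        simp [hC C n hn, h1, div_eq_mul_inv]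
  rcases isEmpty_or_nonempty 𝒳 with h𝒳 | h𝒳
  · refine ⟨⟨fun _ _ _ => false, fun n μ _ => measurable_const.nullMeasurable⟩, fun P hP _ => ?_⟩
    exact absurd hP.measure_univ (by simp [Set.univ_eq_empty_iff.2 inferInstance])
  · obtain ⟨S⟩ := VCLGame.exists_patternStrategy hmeas htree
    exact ⟨S.learner, fun P _ hP => S.exists_expErr_learner_le P hP⟩
end

section
/- Lemma 5.5 (one-inclusion prediction from forbidden patterns): Let 𝒳 be a Polish space, t ≥ 1, and let g : 𝒳^t → {0,1}^t be universally measurable. For every n ≥ 1 there is a universally measurable function Ŷ_n^g : (𝒳 × {0,1})^{n-1} × 𝒳 → {0,1} such that for every (x_1,y_1,…,x_n,y_n) ∈ (𝒳 × {0,1})^n satisfying g(x_{i_1},…,x_{i_t}) ≠ (y_{i_1},…,y_{i_t}) for all pairwise distinct indices 1 ≤ i_1,…,i_t ≤ n, one has (1/n!)·∑_{σ ∈ Sym(n)} 1[ Ŷ_n^g(x_{σ(1)},y_{σ(1)},…,x_{σ(n-1)},y_{σ(n-1)},x_{σ(n)}) ≠ y_{σ(n)} ] < t/n, where Sym(n)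 is the group of permutations of {1,…,n}. -/
open Function

/-- A predicate `p` on labellings shatters `t` coordinates. -/
def ShattersCoords {n : ℕ} (p : (Fin n → Bool) → Prop) (t : ℕ) : Prop :=
  ∃ ι : Fin t → Fin n, Injective ι ∧ ∀ v : Fin t → Bool, ∃ y, p y ∧ y ∘ ι = v

lemma sum_labelling_succ {n : ℕ} (f : (Fin (n + 1) → Bool) → ℕ) :
    ∑ y, f y = ∑ y : Fin n → Bool, (f (Fin.cons false y) + f (Fin.cons true y)) := by
  rw [← (Fin.consEquiv (fun _ : Fin (n + 1) => Bool)).sum_comp, Fintype.sum_prod_type,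
    Fintype.sum_bool, Finset.sum_add_distrib, add_comm]
  rfl

open Classical in
/-- The one-inclusion graph of a class that shatters no `t` coordinates has at most
`(t - 1)` times as many edges as vertices. -/
lemma one_inclusion_density {n : ℕ} (p : (Fin n → Bool) → Prop) (t : ℕ)
    (h : ¬ ShattersCoords p t) :
    (∑ j, ∑ y, if p y ∧ y j = false ∧ p (update y j true) then 1 else 0) +
      (∑ y, if p y then 1 else 0) ≤ t * ∑ y, if p y then 1 else 0 := by
  induction n generalizing t with
  | zero =>
    obtain _ | t := t
    · have : ∀ y, ¬ p y := fun y hy =>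
        h ⟨Fin.elim0, fun i => i.elim0, fun v => ⟨y, hy, Subsingleton.elim _ _⟩⟩
      simp [this]
    · simp only [Finset.univ_eq_empty, Finset.sum_empty, zero_add]
      exact Nat.le_mul_of_pos_left _ (Nat.succ_pos t)
  | succ n ih =>
    obtain _ | t := t
    · have : ∀ y, ¬ p y := fun y hy =>
        h ⟨Fin.elim0, fun i => i.elim0, fun v => ⟨y, hy, Subsingleton.elim _ _⟩⟩
      simp [this]
    have hU := ih (fun y => p (Fin.cons false y) ∨ p (Fin.cons true y)) (t + 1) (by
      rintro ⟨ι, hι, hv⟩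
      refine h ⟨Fin.succ ∘ ι, (Fin.succ_injective n).comp hι, fun v => ?_⟩
      obtain ⟨y, hy | hy, rfl⟩ := hv v
      · exact ⟨_, hy, by ext; simp⟩
      · exact ⟨_, hy, by ext; simp⟩)
    have hI := ih (fun y => p (Fin.cons false y) ∧ p (Fin.cons true y)) t (by
      rintro ⟨ι, hι, hv⟩
      refine h ⟨Fin.cons 0 (Fin.succ ∘ ι), ?_, fun v => ?_⟩
      · rw [Fin.cons_injective_iff]
        exact ⟨by rintro ⟨i, hi⟩; exact Fin.succ_ne_zero _ hi,
          (Fin.succ_injective n).comp hι⟩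
      · obtain ⟨y, hy, hyv⟩ := hv (fun i => v i.succ)
        refine ⟨Fin.cons (v 0) y, ?_, ?_⟩
        · cases v 0
          exacts [hy.1, hy.2]
        · ext i
          refine Fin.cases ?_ (fun i => ?_) i
          · simp
          · simpa using congrFun hyv i)
    rw [Fin.sum_univ_succ]
    simp only [sum_labelling_succ (n := n), Fin.cons_zero, Fin.cons_succ, Fin.update_cons_zero,
      ← Fin.cons_update, Bool.true_eq_false, false_and, and_false, if_false, add_zero, true_and]
    have hedge : (∑ j : Fin n, ∑ y : Fin n → Bool,
        ((if p (Fin.cons false y) ∧ y j = false ∧ p (Fin.cons false (update y j true))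
          then 1 else 0) +
         (if p (Fin.cons true y) ∧ y j = false ∧ p (Fin.cons true (update y j true))
          then 1 else 0))) ≤
        (∑ j : Fin n, ∑ y : Fin n → Bool, if (p (Fin.cons false y) ∨ p (Fin.cons true y)) ∧
          y j = false ∧ (p (Fin.cons false (update y j true)) ∨
            p (Fin.cons true (update y j true))) then 1 else 0) +
        (∑ j : Fin n, ∑ y : Fin n → Bool, if (p (Fin.cons false y) ∧ p (Fin.cons true y)) ∧
          y j = false ∧ (p (Fin.cons false (update y j true)) ∧
            p (Fin.cons true (update y j true))) then 1 else 0) := by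
      simp only [← Finset.sum_add_distrib]
      refine Finset.sum_le_sum fun j _ => Finset.sum_le_sum fun y _ => ?_
      by_cases h1 : p (Fin.cons false y) <;> by_cases h2 : p (Fin.cons true y) <;>
      by_cases h3 : y j = false <;> by_cases h4 : p (Fin.cons false (update y j true)) <;>
      by_cases h5 : p (Fin.cons true (update y j true)) <;>
      simp [h1, h2, h3, h4, h5, -Fin.cons_update]
    have hcard : (∑ y : Fin n → Bool, ((if p (Fin.cons false y) then 1 else 0) +
        (if p (Fin.cons true y) then 1 else 0))) =
        (∑ y : Fin n → Bool, if p (Fin.cons false y) ∨ p (Fin.cons true y) then 1 else 0) +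
        (∑ y : Fin n → Bool, if p (Fin.cons false y) ∧ p (Fin.cons true y) then 1 else 0) := by
      simp only [← Finset.sum_add_distrib]
      refine Finset.sum_congr rfl fun y _ => ?_
      by_cases h1 : p (Fin.cons false y) <;> by_cases h2 : p (Fin.cons true y) <;> simp [h1, h2]
    rw [hcard]
    nlinarith

/-- A transitive action of a finite group is equidistributed. -/
lemma card_mul_sum_smul {G O : Type*} [Group G] [Fintype G] [Fintype O] [MulAction G O]
    [MulAction.IsPretransitive G O] (f : O → ℕ) (o : O) :
    Fintype.card O * ∑ a : G, f (a • o) = Fintype.card G * ∑ z, f z := by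
  have hconst : ∀ z, ∑ a : G, f (a • z) = ∑ a : G, f (a • o) := fun z => by
    obtain ⟨b, rfl⟩ := MulAction.exists_smul_eq G o z
    simp only [← mul_smul]
    exact Equiv.sum_comp (Equiv.mulRight b) fun a => f (a • o)
  calc Fintype.card O * ∑ a : G, f (a • o) = ∑ z, ∑ a : G, f (a • z) := by simp [hconst]
    _ = ∑ a : G, ∑ z, f z := by
      rw [Finset.sum_comm]
      exact Finset.sum_congr rfl fun a _ => Equiv.sum_comp (MulAction.toPerm a) f
    _ = _ := by simp

lemma sum_perm_apply {n : ℕ} (f : Fin (n + 1) → ℕ) (a : Fin (n + 1)) :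
    ∑ σ : Equiv.Perm (Fin (n + 1)), f (σ a) = n.factorial * ∑ i, f i := by
  have h := card_mul_sum_smul (G := Equiv.Perm (Fin (n + 1))) f a
  rw [Fintype.card_perm, Fintype.card_fin, Nat.factorial_succ, mul_assoc] at h
  exact Nat.eq_of_mul_eq_mul_left n.succ_pos h

/-- A labelling of `Fin n` with enough labels of each kind restricts to a given labelling. -/
lemma exists_injective_comp_eq {n t : ℕ} (y : Fin n → Bool) (v : Fin t → Bool)
    (h : ∀ b, Fintype.card {i // v i = b} ≤ Fintype.card {j // y j = b}) :
    ∃ ι : Fin t → Fin n, Injective ι ∧ y ∘ ι = v := by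
  have e b := (Function.Embedding.nonempty_of_card_le (h b)).some
  refine ⟨fun i => e (v i) ⟨i, rfl⟩, fun i j hij => ?_, funext fun i => (e (v i) ⟨i, rfl⟩).2⟩
  have hv : v i = v j := by
    rw [← (e (v i) ⟨i, rfl⟩).2, ← (e (v j) ⟨j, rfl⟩).2]; exact congrArg y hij
  have hval : ∀ b (hb : v i = b), (e b ⟨i, hb⟩ : Fin n) = e (v i) ⟨i, rfl⟩ := by
    rintro _ rfl; rfl
  exact congrArg Subtype.val ((e (v j)).injective (Subtype.ext ((hval _ hv).trans hij)))

open MulAction in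
lemma card_le_card_orbit {β : Type*} [Finite β] {m : ℕ} (r : Fin (m + 1) → β)
    {a b : Fin (m + 1)} (hab : r a ≠ r b) :
    m + 1 ≤ Nat.card (orbit (Equiv.Perm (Fin (m + 1)))ᵈᵐᵃ r) := by
  classical
  let τ : Fin (m + 1) → Equiv.Perm (Fin (m + 1)) := fun j =>
    if j ≠ a ∧ r j = r a then Equiv.swap j b else Equiv.swap a j
  have : Injective fun j => (⟨DomMulAct.mk (τ j) • r, mem_orbit _ _⟩ :
      orbit (Equiv.Perm (Fin (m + 1)))ᵈᵐᵃ r) := by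
    intro i j hij
    have hf : ∀ k, r (τ i k) = r (τ j k) := fun k => congrFun (congrArg Subtype.val hij) k
    by_contra hne
    have h1 := hf i
    have h2 := hf j
    have h3 := hf a
    have h4 := hf b
    simp only [τ] at h1 h2 h3 h4
    grind
  simpa using Nat.card_le_card_of_injective _ this

open Classical in
/-- Density of the edges in the last direction in a permutation-invariant family of classes. -/
lemma invariant_density {I : Type*} [Fintype I] {m : ℕ}
    [MulAction (Equiv.Perm (Fin (m + 1)))ᵈᵐᵃ I] (t : ℕ) (W : I × (Fin (m + 1) → Bool) → Prop)
    (hW : ∀ (a : (Equiv.Perm (Fin (m + 1)))ᵈᵐᵃ) c, W (a • c) ↔ W c)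
    (hsh : ∀ i, ¬ ShattersCoords (fun y => W (i, y)) t) :
    (m + 1) * (Finset.univ.filter fun c : I × (Fin (m + 1) → Bool) =>
        W c ∧ c.2 (Fin.last m) = false ∧ W (c.1, update c.2 (Fin.last m) true)).card +
      (Finset.univ.filter W).card ≤ t * (Finset.univ.filter W).card := by
  have hconst : ∀ j, (∑ c : I × (Fin (m + 1) → Bool),
      if W c ∧ c.2 j = false ∧ W (c.1, update c.2 j true) then 1 else 0) =
      ∑ c : I × (Fin (m + 1) → Bool), if W c ∧ c.2 (Fin.last m) = false ∧
        W (c.1, update c.2 (Fin.last m) true) then 1 else 0 := fun j => by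
    let a : (Equiv.Perm (Fin (m + 1)))ᵈᵐᵃ := DomMulAct.mk (Equiv.swap j (Fin.last m))
    symm
    rw [← Equiv.sum_comp (MulAction.toPerm a)]
    refine Finset.sum_congr rfl fun c _ => ?_
    have h1 : (a • c).2 (Fin.last m) = c.2 j :=
      congrArg c.2 (Equiv.swap_apply_right j (Fin.last m))
    have h2 : ((a • c).1, update (a • c).2 (Fin.last m) true) = a • (c.1, update c.2 j true) := by
      refine Prod.ext rfl (funext fun k => ?_)
      change update (c.2 ∘ Equiv.swap j (Fin.last m)) _ true k =
        update c.2 j true (Equiv.swap j (Fin.last m) k)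
      simp only [update_apply, comp_apply]
      congr 1
      rw [Equiv.swap_apply_eq_iff, Equiv.swap_apply_left]
    simp only [MulAction.toPerm_apply, h1, h2, hW]
  have := Finset.sum_le_sum fun i (_ : i ∈ Finset.univ) => one_inclusion_density _ t (hsh i)
  rw [Finset.sum_add_distrib, ← Finset.mul_sum, Finset.sum_comm] at this
  simp only [Finset.card_filter, Fintype.sum_prod_type] at hconst ⊢
  simp only [hconst] at this
  simpa using this

open Classical in
/-- An orientation of the one-inclusion graphs of a permutation-invariant family of classes,
all of whose orbits are large, that errs on less than `t` permutations in every `m + 1`. -/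
lemma exists_invariant_predictor {I : Type*} [Fintype I] {m : ℕ}
    [MulAction (Equiv.Perm (Fin (m + 1)))ᵈᵐᵃ I] (t : ℕ) (V : I × (Fin (m + 1) → Bool) → Prop)
    (hV : ∀ (a : (Equiv.Perm (Fin (m + 1)))ᵈᵐᵃ) c, V (a • c) ↔ V c)
    (hsh : ∀ i, ¬ ShattersCoords (fun y => V (i, y)) t)
    (hcard : ∀ c, V c → m + 1 ≤ Nat.card (MulAction.orbit (Equiv.Perm (Fin (m + 1)))ᵈᵐᵃ c)) :
    ∃ A : I → (Fin m → Bool) → Bool, ∀ i y, V (i, y) →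
      (∑ σ : Equiv.Perm (Fin (m + 1)),
        if A (DomMulAct.mk σ • i) (fun j => y (σ j.castSucc)) ≠ y (σ (Fin.last m))
        then 1 else 0) < t * m.factorial := by
  let G := (Equiv.Perm (Fin (m + 1)))ᵈᵐᵃ
  let Q := MulAction.orbitRel.Quotient G (I × (Fin (m + 1) → Bool))
  let κ : I × (Fin (m + 1) → Bool) → Q := Quotient.mk _
  have hκ : ∀ c c', κ c = κ c' ↔ c ∈ MulAction.orbit G c' := fun c c' =>
    Quotient.eq.trans MulAction.orbitRel_apply
  have hκV : ∀ {c c'}, κ c = κ c' → (V c ↔ V c') := fun {c c'} h => by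
    obtain ⟨a, rfl⟩ := (hκ c c').1 h
    exact hV a c'
  let size : Q → ℕ := fun q => (Finset.univ.filter fun c => κ c = q).card
  have hsize : ∀ c, size (κ c) = Nat.card (MulAction.orbit G c) := fun c => by
    rw [Nat.card_eq_fintype_card]
    simp only [size, hκ]
    exact (Fintype.card_subtype _).symm
  let cap : Q → ℕ := fun q => (t * size q - 1) / (m + 1)
  let ends : I × (Fin m → Bool) → Bool → I × (Fin (m + 1) → Bool) :=
    fun e b => (e.1, Fin.snoc e.2 b)
  let E := {e : I × (Fin m → Bool) // ∀ b, V (ends e b)}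
  let S : E → Finset Q := fun e => Finset.univ.image fun b => κ (ends e.1 b)
  obtain ⟨f, hf, hfS⟩ : ∃ f : E → Σ _ : Q, ℕ, Injective f ∧
      ∀ e, f e ∈ (S e).sigma fun q => Finset.range (cap q) := by
    rw [← Finset.all_card_le_biUnion_card_iff_exists_injective]
    intro F
    let N := F.biUnion S
    have hN : (F.biUnion fun e => (S e).sigma fun q => Finset.range (cap q)) =
        N.sigma fun q => Finset.range (cap q) := by
      ext ⟨q, k⟩
      simp only [N, Finset.mem_biUnion, Finset.mem_sigma]
      tauto
    rw [hN, Finset.card_sigma]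
    simp only [Finset.card_range]
    have hNV : ∀ c, κ c ∈ N → V c := fun c hc => by
      obtain ⟨e, -, he⟩ := Finset.mem_biUnion.1 hc
      obtain ⟨b, -, hb⟩ := Finset.mem_image.1 he
      exact (hκV hb).1 (e.2 b)
    have hdens : (m + 1) * (Finset.univ.filter fun c : I × (Fin (m + 1) → Bool) =>
        κ c ∈ N ∧ c.2 (Fin.last m) = false ∧
          κ (c.1, update c.2 (Fin.last m) true) ∈ N).card +
        (Finset.univ.filter fun c => κ c ∈ N).card ≤
        t * (Finset.univ.filter fun c => κ c ∈ N).card := by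
      convert invariant_density t (fun c => κ c ∈ N) (fun a c => by
        rw [(hκ (a • c) c).2 (MulAction.mem_orbit _ _)])
        (fun i ⟨ι, hι, h⟩ => hsh i ⟨ι, hι, fun v => (h v).imp fun y hy => ⟨hNV _ hy.1, hy.2⟩⟩)
    have hF : F.card ≤ (Finset.univ.filter fun c : I × (Fin (m + 1) → Bool) =>
        κ c ∈ N ∧ c.2 (Fin.last m) = false ∧
          κ (c.1, update c.2 (Fin.last m) true) ∈ N).card := by
      refine Finset.card_le_card_of_injOn (fun e => ends e.1 false) (fun e he => ?_) ?_
      · have hmem : ∀ b, κ (ends e.1 b) ∈ N := fun b =>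
          Finset.mem_biUnion.2 ⟨e, he, Finset.mem_image_of_mem _ (Finset.mem_univ b)⟩
        have h := hmem true
        simp only [ends] at h
        rw [← Fin.update_snoc_last (α := fun _ => Bool) false] at h
        exact Finset.mem_coe.2 (Finset.mem_filter.2
          ⟨Finset.mem_univ _, hmem false,
            Fin.snoc_last (α := fun _ => Bool) false e.1.2, h⟩)
      · intro e _ e' _ h
        obtain ⟨h1, h2⟩ := Prod.ext_iff.1 h
        exact Subtype.ext (Prod.ext h1 (Fin.snoc_injective2 (α := fun _ => Bool) h2).1)
    have hW : (Finset.univ.filter fun c => κ c ∈ N).card = ∑ q ∈ N, size q := by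
      rw [Finset.card_eq_sum_card_fiberwise (f := κ) (t := N) (fun c hc => by simpa using hc)]
      refine Finset.sum_congr rfl fun q hq => ?_
      simp only [size, Finset.filter_filter]
      congr 1
      ext c
      simp only [Finset.mem_filter, Finset.mem_univ, true_and, and_iff_right_iff_imp]
      rintro rfl
      exact hq
    have hcap : t * ∑ q ∈ N, size q ≤ (m + 1) * ∑ q ∈ N, cap q + ∑ q ∈ N, size q := by
      rw [Finset.mul_sum, Finset.mul_sum, ← Finset.sum_add_distrib]
      refine Finset.sum_le_sum fun q hq => ?_
      obtain ⟨c, rfl⟩ := Quotient.exists_rep q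
      have h1 : m + 1 ≤ size (κ c) := (hsize c).symm ▸ hcard c (hNV c hq)
      have h2 : t * size (κ c) - 1 < (m + 1) * (cap (κ c) + 1) :=
        Nat.lt_mul_div_succ _ m.succ_pos
      change t * size (κ c) ≤ (m + 1) * cap (κ c) + size (κ c)
      rw [mul_add] at h2
      omega
    simp only [hW] at hdens
    have := Nat.mul_le_mul_left (m + 1) hF
    exact Nat.le_of_mul_le_mul_left (by omega : (m + 1) * F.card ≤ (m + 1) * _) m.succ_pos
  let A : I → (Fin m → Bool) → Bool := fun i y =>
    if h : ∀ b, V (ends (i, y) b) then decide ((f ⟨(i, y), h⟩).1 ≠ κ (ends (i, y) true))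
    else decide (V (ends (i, y) true))
  let err : I × (Fin (m + 1) → Bool) → Prop := fun c =>
    A c.1 (Fin.init c.2) ≠ c.2 (Fin.last m)
  have herr : ∀ c, V c → err c →
      ∃ h : ∀ b, V (ends (c.1, Fin.init c.2) b), (f ⟨(c.1, Fin.init c.2), h⟩).1 = κ c := by
    rintro ⟨i, y⟩ hc he
    obtain ⟨y, b, rfl⟩ : ∃ y' b, y = Fin.snoc y' b := ⟨_, _, (Fin.snoc_init_self y).symm⟩
    simp only [err, A, Fin.init_snoc, Fin.snoc_last] at he ⊢
    by_cases h : ∀ b, V (ends (i, y) b)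
    · refine ⟨h, ?_⟩
      have hS := (Finset.mem_sigma.1 (hfS ⟨(i, y), h⟩)).1
      obtain ⟨b', -, hb'⟩ := Finset.mem_image.1 hS
      rw [dif_pos h] at he
      cases b <;> cases b' <;> simp_all [ends]
    · rw [dif_neg h] at he
      rw [Bool.forall_bool] at h
      cases b <;> simp_all [ends]
  refine ⟨A, fun i y hc => ?_⟩
  set c := (i, y) with hcdef
  have hbad : (Finset.univ.filter fun z => κ z = κ c ∧ err z).card ≤ cap (κ c) := by
    rw [← Finset.card_range (cap (κ c))]
    refine Finset.card_le_card_of_injOn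
      (fun z => if h : ∀ b, V (ends (z.1, Fin.init z.2) b)
        then (f ⟨(z.1, Fin.init z.2), h⟩).2 else 0) ?_ ?_
    · intro z hz
      obtain ⟨hz1, hz2⟩ := (Finset.mem_filter.1 hz).2
      obtain ⟨h, hfz⟩ := herr z ((hκV hz1).2 hc) hz2
      have := (Finset.mem_sigma.1 (hfS ⟨_, h⟩)).2
      rw [hfz, hz1] at this
      simpa only [dif_pos h, Finset.mem_coe] using this
    · intro z hz z' hz' hzz
      obtain ⟨hz1, hz2⟩ := (Finset.mem_filter.1 hz).2
      obtain ⟨hz1', hz2'⟩ := (Finset.mem_filter.1 hz').2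
      obtain ⟨h, hfz⟩ := herr z ((hκV hz1).2 hc) hz2
      obtain ⟨h', hfz'⟩ := herr z' ((hκV hz1').2 hc) hz2'
      simp only [dif_pos h, dif_pos h'] at hzz
      have heq := hf (Sigma.ext (hfz.trans (hz1.trans (hz1'.symm.trans hfz'.symm)))
        (heq_of_eq hzz))
      obtain ⟨h1, h2⟩ := Prod.ext_iff.1 (congrArg Subtype.val heq)
      simp only [err] at hz2 hz2'
      refine Prod.ext h1 ?_
      rw [← Fin.snoc_init_self z.2, ← Fin.snoc_init_self z'.2]
      simp only at h1 h2
      rw [h1, h2] at hz2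
      rw [h2, Bool.eq_not.2 hz2.symm, Bool.eq_not.2 hz2'.symm]
  have : Fintype G := Fintype.ofEquiv _ DomMulAct.mk
  have hcount := card_mul_sum_smul (G := G)
    (fun z : MulAction.orbit G c => if err z then 1 else 0) ⟨c, MulAction.mem_orbit_self c⟩
  have hG : Fintype.card G = (m + 1) * m.factorial := by
    rw [← Nat.factorial_succ, ← Fintype.card_fin (m + 1), ← Fintype.card_perm]
    exact Fintype.card_congr DomMulAct.mk.symm
  have hbad' : (∑ z : MulAction.orbit G c, if err z then 1 else 0) ≤ cap (κ c) := by
    refine le_trans (le_of_eq ?_) hbad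
    rw [← Finset.card_filter, ← Finset.card_map (Embedding.subtype _)]
    congr 1
    ext z
    simp only [Finset.mem_map, Finset.mem_filter, Finset.mem_univ, true_and, hκ,
      Embedding.subtype_apply, Subtype.exists, exists_and_right, exists_eq_right]
    exact exists_prop
  have hsum : (∑ a : G, if err (a • c) then 1 else 0) = ∑ σ : Equiv.Perm (Fin (m + 1)),
      if A (DomMulAct.mk σ • i) (fun j => y (σ j.castSucc)) ≠ y (σ (Fin.last m))
        then 1 else 0 := by
    rw [← Equiv.sum_comp DomMulAct.mk]
    rfl
  have hlt : (m + 1) * cap (κ c) < t * size (κ c) := by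
    have hpos : 0 < size (κ c) := Finset.card_pos.2 ⟨c, by simp⟩
    have ht : 0 < t := Nat.pos_of_ne_zero fun h => hsh i
      ⟨fun _ => 0, fun a => absurd a.2 (by omega), fun v =>
        ⟨y, hc, funext fun a => absurd a.2 (by omega)⟩⟩
    have h1 := Nat.mul_div_le (t * size (κ c) - 1) (m + 1)
    have h2 := Nat.mul_pos ht hpos
    change (m + 1) * ((t * size (κ c) - 1) / (m + 1)) < _
    omega
  rw [← hsum]
  rw [hsize, Nat.card_eq_fintype_card] at hlt
  rw [hG] at hcount
  have hle := Nat.mul_le_mul_left ((m + 1) * m.factorial) hbad'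
  have hlt' := Nat.mul_lt_mul_of_pos_right hlt m.factorial_pos
  refine Nat.lt_of_mul_lt_mul_left (a := Fintype.card (MulAction.orbit G c)) ?_
  calc _ = _ := hcount
    _ ≤ _ := hle
    _ = (m + 1) * cap (κ c) * m.factorial := by ring
    _ < _ := hlt'
    _ = _ := by ring

/-- The number of labels `true`. -/
def trueCount {n : ℕ} (y : Fin n → Bool) : ℕ := ∑ i, if y i = true then 1 else 0

lemma sum_falses {n : ℕ} (y : Fin n → Bool) :
    (∑ i, if y i = false then 1 else 0) = n - trueCount y := by
  have : (∑ i, if y i = false then 1 else 0) + trueCount y = n := by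
    rw [trueCount, ← Finset.sum_add_distrib, Finset.sum_eq_card_nsmul (b := 1)]
    · simp
    · intro i _; cases y i <;> simp
  omega

lemma trueCount_le {n : ℕ} (y : Fin n → Bool) : trueCount y ≤ n := by
  simpa [trueCount] using Finset.card_le_univ (Finset.univ.filter fun i => y i = true)

open Classical in
/-- The prediction rule for a sample in which all the points coincide. -/
noncomputable def thresholdRule {n m : ℕ} (H : Set (Fin n → Bool)) (t : ℕ) (y : Fin m → Bool) :
    Bool :=
  decide (∀ j, trueCount y < j → j ≤ t → ∃ z ∈ H, trueCount z = j)

open Classical in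
lemma thresholdRule_error_lt {m t : ℕ} (H : Set (Fin (m + 1) → Bool)) (v : Fin t → Bool)
    (hv : ∀ y ∈ H, ∀ ι : Fin t → Fin (m + 1), Injective ι → y ∘ ι ≠ v)
    (y : Fin (m + 1) → Bool) (hy : y ∈ H) :
    (∑ σ : Equiv.Perm (Fin (m + 1)),
      if thresholdRule H t (fun j : Fin m => y (σ j.castSucc)) ≠ y (σ (Fin.last m))
      then 1 else 0) < t * m.factorial := by
  have hno : ∀ z ∈ H, trueCount v ≤ trueCount z →
      t - trueCount v ≤ m + 1 - trueCount z → False := fun z hz h1 h2 => by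
    obtain ⟨ι, hι, h⟩ := exists_injective_comp_eq z v (fun b => by
      rw [Fintype.card_subtype, Fintype.card_subtype, Finset.card_filter, Finset.card_filter]
      cases b
      · rw [sum_falses, sum_falses]; exact h2
      · exact h1)
    exact hv z hz ι hι h
  have hvt := trueCount_le v
  have hyn := trueCount_le y
  have hcount : ∀ σ : Equiv.Perm (Fin (m + 1)),
      trueCount (fun j : Fin m => y (σ j.castSucc)) +
        (if y (σ (Fin.last m)) = true then 1 else 0) = trueCount y := fun σ => by
    rw [trueCount, trueCount, ← Equiv.sum_comp σ, Fin.sum_univ_castSucc]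
  by_cases hp : ∀ j, trueCount y < j → j ≤ t → ∃ z ∈ H, trueCount z = j
  · have herr : ∀ σ : Equiv.Perm (Fin (m + 1)),
        thresholdRule H t (fun j : Fin m => y (σ j.castSucc)) = true := fun σ => by
      have := hcount σ
      refine decide_eq_true fun j hj hjt => ?_
      rcases lt_or_ge (trueCount y) j with h | h
      · exact hp j h hjt
      · refine ⟨y, hy, ?_⟩
        split_ifs at this <;> omega
    have hlt : m + 1 - trueCount y < t := by
      by_contra hge
      rcases le_or_gt (trueCount v) (trueCount y) with h | h
      · exact hno y hy h (by omega)
      · obtain ⟨z, hz, hzv⟩ := hp _ h hvt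
        exact hno z hz hzv.ge (by omega)
    simp only [herr, ne_eq, Bool.true_eq, Bool.not_eq_true]
    rw [sum_perm_apply (fun i => if y i = false then 1 else 0), sum_falses, mul_comm]
    exact Nat.mul_lt_mul_of_pos_right hlt m.factorial_pos
  · have hlt : trueCount y < t := by
      by_contra hge
      exact hp fun j h1 h2 => absurd h1 (by omega)
    have herr : ∀ σ : Equiv.Perm (Fin (m + 1)), y (σ (Fin.last m)) = false →
        thresholdRule H t (fun j : Fin m => y (σ j.castSucc)) = false := fun σ hσ => by
      have := hcount σ
      rw [hσ, if_neg Bool.false_ne_true, add_zero] at this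
      refine decide_eq_false ?_
      rwa [this]
    calc _ ≤ ∑ σ : Equiv.Perm (Fin (m + 1)), if y (σ (Fin.last m)) = true then 1 else 0 := by
          refine Finset.sum_le_sum fun σ _ => ?_
          cases hσ : y (σ (Fin.last m))
          · simp [herr σ hσ]
          · split_ifs <;> simp_all
      _ = trueCount y * m.factorial := by
          rw [sum_perm_apply (fun i => if y i = true then 1 else 0), mul_comm, trueCount]
      _ < _ := Nat.mul_lt_mul_of_pos_right hlt m.factorial_pos

/-- The labellings avoiding every pattern on distinct indices. -/
def avoidingClass {n t : ℕ} (D : (Fin t → Fin n) → Fin t → Bool) : Set (Fin n → Bool) :=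
  {y | ∀ ι, Injective ι → D ι ≠ y ∘ ι}

lemma not_shattersCoords_avoidingClass {n t : ℕ} (D : (Fin t → Fin n) → Fin t → Bool) :
    ¬ ShattersCoords (· ∈ avoidingClass D) t := fun ⟨ι, hι, h⟩ => by
  obtain ⟨y, hy, hyD⟩ := h (D ι)
  exact hy ι hι hyD.symm

/-- The number of indices strictly below a given index, for a strict comparison `C`. -/
def rank {n : ℕ} (C : Fin n → Fin n → Bool) (j : Fin n) : Fin (n + 1) :=
  ⟨(Finset.univ.filter fun l => C l j = true).card,
    Nat.lt_succ_of_le ((Finset.card_le_univ _).trans_eq (Fintype.card_fin n))⟩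

lemma rank_comp_perm {n : ℕ} (C : Fin n → Fin n → Bool) (σ : Equiv.Perm (Fin n)) :
    rank (fun l j => C (σ l) (σ j)) = rank C ∘ σ := by
  ext j
  simp only [rank, comp_apply]
  refine Finset.card_equiv σ fun i => ?_
  simp

lemma eq_of_rank_eq {n : ℕ} (x : Fin n → ℝ) {i j : Fin n}
    (h : rank (fun l j => decide (x l < x j)) i = rank (fun l j => decide (x l < x j)) j) :
    x i = x j := by
  have hlt : ∀ {i j}, x i < x j →
      rank (fun l j => decide (x l < x j)) i < rank (fun l j => decide (x l < x j)) j := by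
    intro i j hij
    simp only [rank, Fin.mk_lt_mk]
    refine Finset.card_lt_card
      ((Finset.ssubset_iff_of_subset fun l hl => ?_).2 ⟨i, ?_, ?_⟩)
    · simp only [Finset.mem_filter, Finset.mem_univ, true_and, decide_eq_true_eq] at hl ⊢
      exact hl.trans hij
    · simpa using hij
    · simp
  rcases lt_trichotomy (x i) (x j) with h' | h' | h'
  · exact absurd h (hlt h').ne
  · exact h'
  · exact absurd h (hlt h').ne'

open scoped Pointwise in
open Classical in
/-- A rule with few errors for classes shattering no `t` coordinates and non-constant ranks. -/
lemma exists_rank_predictor (m t : ℕ) :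
    ∃ A : (Fin (m + 1) → Fin (m + 2)) → Set (Fin (m + 1) → Bool) → (Fin m → Bool) → Bool,
      ∀ r H y, y ∈ H → ¬ ShattersCoords (· ∈ H) t → (∃ a b, r a ≠ r b) →
        (∑ σ : Equiv.Perm (Fin (m + 1)),
          if A (r ∘ σ) (DomMulAct.mk σ • H) (fun j => y (σ j.castSucc)) ≠ y (σ (Fin.last m))
          then 1 else 0) < t * m.factorial := by
  let G := (Equiv.Perm (Fin (m + 1)))ᵈᵐᵃ
  have hsh : ∀ (a : G) (H : Set (Fin (m + 1) → Bool)), ShattersCoords (· ∈ a • H) t →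
      ShattersCoords (· ∈ H) t := by
    rintro a H ⟨ι, hι, h⟩
    obtain ⟨σ, rfl⟩ := DomMulAct.mk.surjective a
    refine ⟨σ ∘ ι, σ.injective.comp hι, fun v => ?_⟩
    obtain ⟨_, ⟨y, hy, rfl⟩, rfl⟩ := h v
    exact ⟨y, hy, rfl⟩
  have hne : ∀ (a : G) (r : Fin (m + 1) → Fin (m + 2)), (∃ i j, (a • r) i ≠ (a • r) j) →
      ∃ i j, r i ≠ r j := fun a r ⟨i, j, h⟩ => ⟨_, _, h⟩
  obtain ⟨A, hA⟩ := exists_invariant_predictor (m := m)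
    (I := (Fin (m + 1) → Fin (m + 2)) × Set (Fin (m + 1) → Bool)) t
    (fun c => c.2 ∈ c.1.2 ∧ ¬ ShattersCoords (· ∈ c.1.2) t ∧ ∃ i j, c.1.1 i ≠ c.1.1 j)
    (fun a c => and_congr Set.smul_mem_smul_set_iff (and_congr
      (not_congr ⟨hsh a _, fun h =>
        hsh a⁻¹ _ (by rwa [Prod.smul_fst, Prod.smul_snd, inv_smul_smul])⟩)
      ⟨hne a _, fun h => hne a⁻¹ _ (by rwa [Prod.smul_fst, Prod.smul_fst, inv_smul_smul])⟩))
    (fun i ⟨ι, hι, h⟩ => (h fun _ => false).elim fun y hy =>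
      hy.1.2.1 ⟨ι, hι, fun v => (h v).imp fun y hy => ⟨hy.1.1, hy.2⟩⟩)
    (fun c ⟨_, _, i, j, hij⟩ => (card_le_card_orbit c.1.1 hij).trans <| by
      refine Nat.card_le_card_of_surjective
        (fun z : MulAction.orbit G c => ⟨z.1.1.1, ?_⟩) ?_
      · obtain ⟨_, a, rfl⟩ := z
        exact ⟨a, rfl⟩
      · rintro ⟨_, a, rfl⟩
        exact ⟨⟨a • c, a, rfl⟩, rfl⟩)
  exact ⟨fun r H => A (r, H), fun r H y hy hH hr => hA (r, H) y ⟨hy, hH, hr⟩⟩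

lemma UniversallyMeasurable.nullMeasurable_comp {α β γ : Type*} [MeasurableSpace α]
    [MeasurableSpace β] [MeasurableSpace γ] {g : β → γ} (hg : UniversallyMeasurable g)
    {f : α → β} (hf : Measurable f) (μ : MeasureTheory.Measure α)
    [MeasureTheory.IsProbabilityMeasure μ] : MeasureTheory.NullMeasurable (g ∘ f) μ :=
  (hg (μ.map f) (MeasureTheory.Measure.isProbabilityMeasure_map
    hf.aemeasurable)).comp_quasiMeasurePreserving (hf.quasiMeasurePreserving μ)

/-- **Lemma 5.5 (one-inclusion prediction from forbidden patterns).** Let `g : 𝒳^t → {0,1}^t` be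
universally measurable, `t ≥ 1`.  For every `n = m + 1 ≥ 1` there is a universally measurable
predictor `Ŷ : (𝒳 × {0,1})^{n-1} × 𝒳 → {0,1}` such that for every data set
`(x_1,y_1,…,x_n,y_n)` in which no `t` distinct indices realize a pattern of `g`, the average
over all permutations `σ` of the indicator that `Ŷ` errs on `(x_{σ(n)}, y_{σ(n)})` given the
other `n-1` labelled points is less than `t/n`. -/
theorem one_inclusion_prediction
    (𝒳 : Type*) [TopologicalSpace 𝒳] [PolishSpace 𝒳] [MeasurableSpace 𝒳] [BorelSpace 𝒳]
    (t : ℕ) (ht : 1 ≤ t) (g : (Fin t → 𝒳) → Fin t → Bool)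
    (hg : UniversallyMeasurable g) (m : ℕ) :
    ∃ Y : (Fin m → 𝒳 × Bool) → 𝒳 → Bool,
      UniversallyMeasurable (fun q : (Fin m → 𝒳 × Bool) × 𝒳 => Y q.1 q.2) ∧
      ∀ (x : Fin (m + 1) → 𝒳) (y : Fin (m + 1) → Bool),
        (∀ ι : Fin t → Fin (m + 1), Function.Injective ι → g (x ∘ ι) ≠ y ∘ ι) →
        (∑ σ : Equiv.Perm (Fin (m + 1)),
            if Y (fun i : Fin m => (x (σ i.castSucc), y (σ i.castSucc)))
                  (x (σ (Fin.last m))) ≠ y (σ (Fin.last m))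
            then (1 : ℝ) else 0) / (Nat.factorial (m + 1) : ℝ)
          < (t : ℝ) / ((m : ℝ) + 1) := by
  classical
  obtain ⟨A, hA⟩ := exists_rank_predictor m t
  obtain ⟨f, hf⟩ := MeasureTheory.exists_measurableEmbedding_real 𝒳
  let D : (Fin (m + 1) → 𝒳) → (Fin t → Fin (m + 1)) → Fin t → Bool := fun x ι => g (x ∘ ι)
  let C : (Fin (m + 1) → 𝒳) → Fin (m + 1) → Fin (m + 1) → Bool :=
    fun x l j => decide (f (x l) < f (x j))
  let F : ((Fin t → Fin (m + 1)) → Fin t → Bool) × (Fin (m + 1) → Fin (m + 1) → Bool) ×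
      (Fin m → Bool) → Bool := fun d =>
    if ∃ a b, rank d.2.1 a ≠ rank d.2.1 b then A (rank d.2.1) (avoidingClass d.1) d.2.2
    else thresholdRule (avoidingClass d.1) t d.2.2
  let pts : (Fin m → 𝒳 × Bool) × 𝒳 → Fin (m + 1) → 𝒳 := fun q =>
    Fin.snoc (fun i => (q.1 i).1) q.2
  let Y : (Fin m → 𝒳 × Bool) → 𝒳 → Bool := fun q z =>
    F (D (pts (q, z)), C (pts (q, z)), fun i => (q i).2)
  have hpts : Measurable pts := by
    refine measurable_pi_iff.2 fun i => ?_
    refine Fin.lastCases ?_ (fun i => ?_) i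
    · simpa [pts] using measurable_snd
    · simp only [pts, Fin.snoc_castSucc]
      fun_prop
  refine ⟨Y, fun μ hμ => ?_, fun x y hxy => ?_⟩
  · have hD : @Measurable (MeasureTheory.NullMeasurableSpace _ μ) _ _ _ fun q => D (pts q) :=
      measurable_pi_iff.2 fun ι => (hg.nullMeasurable_comp (f := fun q => pts q ∘ ι)
        (measurable_pi_iff.2 fun i => (measurable_pi_apply _).comp hpts) μ).measurable'
    have hx : ∀ i, Measurable fun q => f (pts q i) := fun i =>
      hf.measurable.comp ((measurable_pi_apply i).comp hpts)
    have hC : Measurable fun q => C (pts q) := measurable_pi_iff.2 fun l =>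
      measurable_pi_iff.2 fun j => measurable_to_bool <| by
        simpa [C, Set.preimage] using measurableSet_lt (hx l) (hx j)
    have hlab : Measurable fun (q : (Fin m → 𝒳 × Bool) × 𝒳) i => (q.1 i).2 := by fun_prop
    exact (Measurable.of_discrete (f := F)).comp
      (hD.prodMk ((hC.prodMk hlab).nullMeasurable (μ := μ)).measurable')
  open Pointwise in
  have hclass : ∀ σ : Equiv.Perm (Fin (m + 1)), avoidingClass (D (x ∘ σ)) =
      DomMulAct.mk σ • avoidingClass (D x) := fun σ => by
    ext z
    rw [Set.mem_smul_set_iff_inv_smul_mem]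
    have hinv : (DomMulAct.mk σ)⁻¹ • z = z ∘ σ.symm := rfl
    rw [hinv]
    refine ⟨fun h ι hι e => h (σ.symm ∘ ι) (σ.symm.injective.comp hι) ?_,
      fun h ι hι e => h (σ ∘ ι) (σ.injective.comp hι) ?_⟩
    · rw [← comp_assoc, ← e]
      exact congrArg g (funext fun i => by simp)
    · rw [comp_assoc, ← comp_assoc σ.symm, Equiv.symm_comp_self, id_comp, ← e]
      rfl
  have hY : ∀ σ : Equiv.Perm (Fin (m + 1)),
      Y (fun i : Fin m => (x (σ i.castSucc), y (σ i.castSucc))) (x (σ (Fin.last m))) =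
      F (D (x ∘ σ), C (x ∘ σ), fun i => y (σ i.castSucc)) := fun σ => by
    have : pts (fun i : Fin m => (x (σ i.castSucc), y (σ i.castSucc)), x (σ (Fin.last m))) =
        x ∘ σ := Fin.snoc_init_self (x ∘ σ)
    simp only [Y, this]
  have hrank : ∀ σ : Equiv.Perm (Fin (m + 1)), rank (C (x ∘ σ)) = rank (C x) ∘ σ :=
    rank_comp_perm (C x)
  have hmain : (∑ σ : Equiv.Perm (Fin (m + 1)),
      if Y (fun i : Fin m => (x (σ i.castSucc), y (σ i.castSucc)))
          (x (σ (Fin.last m))) ≠ y (σ (Fin.last m)) then 1 else 0) < t * m.factorial := by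
    simp only [hY]
    by_cases hr : ∃ a b, rank (C x) a ≠ rank (C x) b
    · have := hA (rank (C x)) (avoidingClass (D x)) y hxy
        (not_shattersCoords_avoidingClass _) hr
      convert this using 6 with σ
      obtain ⟨a, b, hab⟩ := hr
      simp only [F, hrank, hclass]
      exact if_pos ⟨σ.symm a, σ.symm b, by simpa using hab⟩
    · push Not at hr
      have hx : ∀ i, x i = x 0 := fun i => hf.injective (eq_of_rank_eq (f ∘ x) (hr i 0))
      have := thresholdRule_error_lt (avoidingClass (D x)) (g fun _ => x 0)
        (fun z hz ι hι h => hz ι hι (h ▸ congrArg g (funext fun i => hx (ι i)))) y hxy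
      convert this using 6 with σ
      have hσ : x ∘ σ = x := funext fun i => (hx _).trans (hx i).symm
      simp only [F, hσ]
      exact if_neg (by push Not; exact hr)
  rw [div_lt_div_iff₀ (by positivity) (by positivity), Nat.factorial_succ]
  have hcast : (∑ σ : Equiv.Perm (Fin (m + 1)),
      if Y (fun i : Fin m => (x (σ i.castSucc), y (σ i.castSucc)))
          (x (σ (Fin.last m))) ≠ y (σ (Fin.last m)) then (1 : ℝ) else 0) <
        t * m.factorial := by exact_mod_cast hmain
  push_cast
  calc _ < (t * m.factorial : ℝ) * (m + 1) :=
        mul_lt_mul_of_pos_right hcast (by positivity)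
    _ = _ := by ring
end

section
/- Theorem 5.7 (arbitrarily slow rates): Let 𝒳 be a Polish space and ℋ a concept class whose members are universally measurable. If ℋ has an infinite VCL tree, then for every rate function R : ℕ → [0,1] with R(n) → 0 and every learning algorithm ĥ_n, there exists a realizable distribution P on 𝒳 × {0,1} such that E[er_P(ĥ_n)] ≥ R(n)/40 for infinitely many n. In particular, ℋ requires arbitrarily slow rates. -/
open scoped ENNReal

variable {𝒳 : Type*}

open MeasureTheory

/-! ### Discrete measures -/

instance Sigma.instDiscreteMeasurableSpace {ι : Type*} {α : ι → Type*}
    [∀ i, MeasurableSpace (α i)] [∀ i, DiscreteMeasurableSpace (α i)] :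
    DiscreteMeasurableSpace (Sigma α) where
  forall_measurableSet s := by
    refine MeasurableSpace.measurableSet_iInf.2 fun i => ?_
    exact (MeasurableSet.of_discrete : MeasurableSet (Sigma.mk i ⁻¹' s))

theorem lintegral_map_of_countable {α β : Type*} [MeasurableSpace α] [Countable α]
    [DiscreteMeasurableSpace α] [MeasurableSpace β] [MeasurableSingletonClass β]
    (μ : Measure α) (g : α → β) (f : β → ℝ≥0∞) :
    ∫⁻ b, f b ∂(μ.map g) = ∫⁻ a, f (g a) ∂μ := by
  conv_lhs => rw [← Measure.sum_smul_dirac μ]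
  rw [Measure.map_sum (Measurable.of_discrete).aemeasurable, lintegral_sum_measure,
    lintegral_countable']
  refine tsum_congr fun a => ?_
  rw [Measure.map_smul, Measure.map_dirac' Measurable.of_discrete, lintegral_smul_measure,
    lintegral_dirac, smul_eq_mul, mul_comm]

/-! ### The path through a tree traced out by a labelling -/

/-- Positions along an infinite path of a VCL tree: a level `k` and one of its `k + 1` points. -/
abbrev VCLPosition : Type := Σ k : ℕ, Fin (k + 1)

namespace VCLPosition

/-- The labelled example of the tree `x` at a position of the path traced out by `y`. -/
def labelled (x : ∀ k : ℕ, (∀ j : Fin k, Fin (j.val + 1) → Bool) → Fin (k + 1) → 𝒳)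
    (y : ∀ k : ℕ, Fin (k + 1) → Bool) (z : VCLPosition) : 𝒳 × Bool :=
  (x z.1 (fun j => y j.val) z.2, y z.1 z.2)

/-- The positions revealing the label at position `⟨k, j⟩`: that position, and all those on
deeper levels. -/
def revealing (k : ℕ) (j : Fin (k + 1)) : Set VCLPosition :=
  {z | k < z.1 ∨ z = ⟨k, j⟩}

/-- The contribution to the expected error of `A` of the test points on level `k`, restricted to
samples that do not reveal the label of the test point. -/
noncomputable def hiddenErr [MeasurableSpace 𝒳] (ν : Measure VCLPosition) (A : LearningAlgorithm 𝒳)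
    (n : ℕ) (x : ∀ k : ℕ, (∀ j : Fin k, Fin (j.val + 1) → Bool) → Fin (k + 1) → 𝒳) (k : ℕ)
    (y : ∀ k : ℕ, Fin (k + 1) → Bool) : ℝ≥0∞ :=
  ∑ j : Fin (k + 1), ν {⟨k, j⟩} * Measure.pi (fun _ : Fin n => ν)
    {s | (∀ t, s t ∉ revealing k j) ∧
      A.H n (fun t => labelled x y (s t)) (x k (fun i => y i.val) j) ≠ y k j}

/-- Flipping the label of a single position of level `k`. -/
def flipAt {k : ℕ} (j : Fin (k + 1)) (w : Fin (k + 1) → Bool) : Fin (k + 1) → Bool :=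
  Function.update w j (!w j)

theorem flipAt_involutive {k : ℕ} (j : Fin (k + 1)) : Function.Involutive (flipAt j) := by
  intro w
  simp [flipAt]

theorem labelled_flipAt {k : ℕ}
    {x : ∀ k : ℕ, (∀ j : Fin k, Fin (j.val + 1) → Bool) → Fin (k + 1) → 𝒳} (y : ∀ k : ℕ, Fin (k + 1) → Bool) (j : Fin (k + 1))
    (w : Fin (k + 1) → Bool) {z : VCLPosition} (hz : z ∉ revealing k j) :
    labelled x (Function.update y k (flipAt j w)) z = labelled x (Function.update y k w) z := by
  obtain ⟨i, l⟩ := z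
  simp only [revealing, Set.mem_ofPred_eq, not_or, not_lt] at hz
  obtain ⟨hik, hne⟩ := hz
  have hpre : ∀ v : Fin (k + 1) → Bool,
      (fun m : Fin i => Function.update y k v m.val) = fun m : Fin i => y m.val := by
    intro v
    funext m
    rw [Function.update_of_ne (by omega)]
  simp only [labelled, hpre]
  rcases hik.eq_or_lt with rfl | hlt
  · have : l ≠ j := fun e => hne (by rw [e])
    simp [flipAt, Function.update_of_ne this]
  · rw [Function.update_of_ne hlt.ne, Function.update_of_ne hlt.ne]

variable [MeasurableSpace 𝒳] (ν : Measure VCLPosition) (A : LearningAlgorithm 𝒳) (n : ℕ)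
  (x : ∀ k : ℕ, (∀ j : Fin k, Fin (j.val + 1) → Bool) → Fin (k + 1) → 𝒳) (k : ℕ)

theorem sum_indicator_le_measure (S : Set VCLPosition) :
    ∑ j : Fin (k + 1), S.indicator (fun z => ν {z}) ⟨k, j⟩ ≤ ν S := by
  classical
  have h1 : ∀ j : Fin (k + 1), S.indicator (fun z => ν {z}) ⟨k, j⟩ = ν (S ∩ {⟨k, j⟩}) := by
    intro j
    by_cases h : (⟨k, j⟩ : VCLPosition) ∈ S
    · rw [Set.indicator_of_mem h, Set.inter_eq_right.2 (by simpa using h)]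
    · rw [Set.indicator_of_notMem h, Set.inter_singleton_eq_empty.2 h, measure_empty]
  simp only [h1]
  rw [← measure_biUnion_finset]
  · exact measure_mono (by simp)
  · intro i _ j _ hij
    refine Disjoint.mono Set.inter_subset_right Set.inter_subset_right ?_
    simpa using hij
  · exact fun _ _ => MeasurableSet.of_discrete

theorem hiddenErr_le_expErr [MeasurableSingletonClass 𝒳] [IsProbabilityMeasure ν]
    (y : ∀ k : ℕ, Fin (k + 1) → Bool) :
    hiddenErr ν A n x k y ≤ expErr (ν.map (labelled x y)) A n := by
  have hm : Measurable (labelled x y) := Measurable.of_discrete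
  have : IsProbabilityMeasure (ν.map (labelled x y)) :=
    Measure.isProbabilityMeasure_map hm.aemeasurable
  rw [expErr, ← Measure.pi_map_pi (fun _ => hm.aemeasurable), lintegral_map_of_countable]
  calc hiddenErr ν A n x k y
      ≤ ∑ j : Fin (k + 1), ∫⁻ s, {s : Fin n → VCLPosition |
          A.H n (fun t => labelled x y (s t)) (x k (fun i => y i.val) j) ≠ y k j}.indicator
            (fun _ => ν {⟨k, j⟩}) s ∂Measure.pi (fun _ : Fin n => ν) := by
        refine Finset.sum_le_sum fun j _ => ?_
        rw [lintegral_indicator_const MeasurableSet.of_discrete]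
        gcongr
        exact fun hs => hs.2
    _ = ∫⁻ s, ∑ j : Fin (k + 1), {s : Fin n → VCLPosition |
          A.H n (fun t => labelled x y (s t)) (x k (fun i => y i.val) j) ≠ y k j}.indicator
            (fun _ => ν {⟨k, j⟩}) s ∂Measure.pi (fun _ : Fin n => ν) :=
        (lintegral_finsetSum _ fun _ _ => Measurable.of_discrete).symm
    _ ≤ _ := by
        refine lintegral_mono fun s => ?_
        refine le_trans ?_ (Measure.le_map_apply hm.aemeasurable _)
        refine le_trans (le_of_eq ?_) (sum_indicator_le_measure ν k _)
        exact Finset.sum_congr rfl fun j _ => rfl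

variable {x k}

theorem hiddenErr_congr {y y' : ∀ k : ℕ, Fin (k + 1) → Bool} (h : ∀ i ≤ k, y i = y' i) :
    hiddenErr ν A n x k y = hiddenErr ν A n x k y' := by
  have hpre : ∀ i ≤ k, (fun l : Fin i => y l.val) = fun l : Fin i => y' l.val :=
    fun i hi => funext fun l => h l (by omega)
  unfold hiddenErr
  refine Finset.sum_congr rfl fun j _ => ?_
  congr 2
  ext s
  refine and_congr_right fun hs => ?_
  have hex : (fun t => labelled x y (s t)) = fun t => labelled x y' (s t) := by
    funext t
    have : (s t).1 ≤ k := not_lt.1 fun hlt => hs t (Or.inl hlt)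
    simp only [labelled, h _ this, hpre _ this]
  rw [hex, hpre k le_rfl, h k le_rfl]

/-- Averaging over the labels of level `k`, the learner can do no better than guess at a test point
whose label is hidden. -/
theorem exists_hiddenErr_ge (y : ∀ k : ℕ, Fin (k + 1) → Bool) :
    ∃ w : Fin (k + 1) → Bool,
      ∑ j : Fin (k + 1), ν {⟨k, j⟩} * Measure.pi (fun _ : Fin n => ν)
        {s | ∀ t, s t ∉ revealing k j} ≤ 2 * hiddenErr ν A n x k (Function.update y k w) := by
  set π := Measure.pi (fun _ : Fin n => ν)
  let E : Fin (k + 1) → (Fin (k + 1) → Bool) → Set (Fin n → VCLPosition) := fun j w =>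
    {s | (∀ t, s t ∉ revealing k j) ∧
      A.H n (fun t => labelled x (Function.update y k w) (s t)) (x k (fun i => y i.val) j) ≠ w j}
  have hE : ∀ w, hiddenErr ν A n x k (Function.update y k w) =
      ∑ j : Fin (k + 1), ν {⟨k, j⟩} * π (E j w) := by
    intro w
    have hpre : (fun m : Fin k => Function.update y k w m.val) = fun m : Fin k => y m.val :=
      funext fun m => by rw [Function.update_of_ne (by omega)]
    simp only [hiddenErr, hpre, Function.update_self]
    rfl
  have hcover : ∀ j w, π {s | ∀ t, s t ∉ revealing k j} ≤ π (E j w) + π (E j (flipAt j w)) := by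
    intro j w
    refine le_trans (measure_mono fun s hs => ?_) (measure_union_le _ _)
    have hex : (fun t => labelled x (Function.update y k (flipAt j w)) (s t)) =
        fun t => labelled x (Function.update y k w) (s t) :=
      funext fun t => labelled_flipAt y j w (hs t)
    by_cases h : A.H n (fun t => labelled x (Function.update y k w) (s t))
        (x k (fun i => y i.val) j) = w j
    · refine Or.inr ⟨hs, ?_⟩
      rw [hex, h]
      simp [flipAt]
    · exact Or.inl ⟨hs, h⟩
  set C := ∑ j : Fin (k + 1), ν {⟨k, j⟩} * π {s | ∀ t, s t ∉ revealing k j}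
  have hsum : ∑ _w : Fin (k + 1) → Bool, C ≤
      ∑ w, 2 * hiddenErr ν A n x k (Function.update y k w) := by
    calc ∑ _w : Fin (k + 1) → Bool, C
        ≤ ∑ w, ∑ j : Fin (k + 1), (ν {⟨k, j⟩} * π (E j w) + ν {⟨k, j⟩} * π (E j (flipAt j w))) := by
          refine Finset.sum_le_sum fun w _ => Finset.sum_le_sum fun j _ => ?_
          rw [← mul_add]
          gcongr
          exact hcover j w
      _ = ∑ j : Fin (k + 1), (∑ w, ν {⟨k, j⟩} * π (E j w) +
            ∑ w, ν {⟨k, j⟩} * π (E j (flipAt j w))) := by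
          rw [Finset.sum_comm]
          exact Finset.sum_congr rfl fun j _ => Finset.sum_add_distrib
      _ = ∑ j : Fin (k + 1), 2 * ∑ w, ν {⟨k, j⟩} * π (E j w) := by
          refine Finset.sum_congr rfl fun j _ => ?_
          rw [two_mul]
          congr 1
          exact ((flipAt_involutive j).toPerm _).bijective.sum_comp (fun w => ν {⟨k, j⟩} * π (E j w))
      _ = _ := by
          simp only [hE, Finset.mul_sum]
          rw [Finset.sum_comm]
  by_contra! hlt
  refine absurd hsum (not_le.2 ?_)
  exact ENNReal.sum_lt_sum_of_nonempty Finset.univ_nonempty fun w _ => hlt w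

/-- A sample of size `n` misses a set of measure at most `1 / (2n)` with probability at least
`1 / 2`. -/
theorem half_le_pi_notMem [IsProbabilityMeasure ν] (S : Set VCLPosition)
    (hS : n * ν.real S ≤ 1 / 2) :
    1 / 2 ≤ Measure.pi (fun _ : Fin n => ν) {s | ∀ t, s t ∉ S} := by
  have hset : {s : Fin n → VCLPosition | ∀ t, s t ∉ S} = Set.univ.pi fun _ => Sᶜ := by
    ext s; simp
  rw [hset, Measure.pi_pi, Finset.prod_const, Finset.card_univ, Fintype.card_fin,
    ← ofReal_measureReal, measureReal_compl MeasurableSet.of_discrete, probReal_univ,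
    ← ENNReal.ofReal_pow (by linarith [measureReal_le_one (μ := ν) (s := S)])]
  have hb := one_add_mul_le_pow (a := -ν.real S)
    (by linarith [measureReal_le_one (μ := ν) (s := S)]) n
  rw [← sub_eq_add_neg] at hb
  calc (1 / 2 : ℝ≥0∞) = ENNReal.ofReal (1 / 2) := by
        rw [ENNReal.ofReal_div_of_pos two_pos]; simp
    _ ≤ _ := ENNReal.ofReal_le_ofReal (by linarith)

/-! ### A measure on positions with prescribed level masses -/

/-- The distribution that selects level `k` with probability `p k`, and then one of the positions of
that level uniformly. -/
noncomputable def levelPMF (p : ℕ → ℝ≥0∞) (hp : ∑' k, p k = 1) : PMF VCLPosition :=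
  ⟨fun z => p z.1 / (z.1 + 1 : ℕ), by
    rw [ENNReal.summable.hasSum_iff, ENNReal.tsum_sigma', ← hp]
    refine tsum_congr fun k => ?_
    rw [tsum_fintype]
    change ∑ _j : Fin (k + 1), p k / (k + 1 : ℕ) = p k
    rw [Finset.sum_const, Finset.card_univ, Fintype.card_fin, nsmul_eq_mul]
    exact ENNReal.mul_div_cancel (by simp) (ENNReal.natCast_ne_top _)⟩

variable (p : ℕ → ℝ≥0∞) (hp : ∑' k, p k = 1)

theorem levelPMF_singleton (z : VCLPosition) :
    (levelPMF p hp).toMeasure {z} = p z.1 / (z.1 + 1 : ℕ) :=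
  PMF.toMeasure_apply_singleton _ _ MeasurableSet.of_discrete

theorem levelPMF_level (S : Set ℕ) :
    (levelPMF p hp).toMeasure {z | z.1 ∈ S} = ∑' k, S.indicator p k := by
  rw [PMF.toMeasure_apply _ MeasurableSet.of_discrete, ENNReal.tsum_sigma']
  refine tsum_congr fun k => ?_
  by_cases hk : k ∈ S
  · simp only [Set.indicator, Set.mem_ofPred_eq, hk, if_true, tsum_fintype]
    change ∑ _j : Fin (k + 1), p k / (k + 1 : ℕ) = p k
    rw [Finset.sum_const, Finset.card_univ, Fintype.card_fin, nsmul_eq_mul]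
    exact ENNReal.mul_div_cancel (by simp) (ENNReal.natCast_ne_top _)
  · simp [Set.indicator, hk]

theorem realizable_map {ℋ : Set (𝒳 → Bool)} [MeasurableSingletonClass 𝒳]
    (hx : ∀ (y : ∀ k : ℕ, Fin (k + 1) → Bool) (n : ℕ),
      ∃ h ∈ ℋ, ∀ k ≤ n, ∀ i : Fin (k + 1), h (x k (fun j => y j.val) i) = y k i)
    (hν : ⨅ k : ℕ, ν {z | k < z.1} = 0) (y : ∀ k : ℕ, Fin (k + 1) → Bool) :
    Realizable ℋ (ν.map (labelled x y)) := by
  refine le_antisymm ?_ zero_le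
  rw [← hν]
  refine le_iInf fun k => ?_
  obtain ⟨h, hh, hy⟩ := hx y k
  refine (iInf₂_le h hh).trans ?_
  have hm : Measurable (labelled x y) := Measurable.of_discrete
  have hc : (labelled x y '' {z | k < z.1}ᶜ).Countable :=
    (Set.to_countable _).image _
  calc errP (ν.map (labelled x y)) h
      ≤ ν.map (labelled x y) (labelled x y '' {z | k < z.1}ᶜ)ᶜ := by
        refine measure_mono ?_
        rintro _ hq ⟨z, hz, rfl⟩
        exact hq (hy z.1 (not_lt.1 hz) z.2)
    _ ≤ ν {z | k < z.1} := by
        rw [Measure.map_apply hm hc.measurableSet.compl]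
        refine measure_mono fun z hz => ?_
        by_contra hk
        exact hz ⟨z, hk, rfl⟩

variable {n} in
theorem mass_le_four_mul_hiddenErr
    (htail : ∑' k, {k | 4 * n < k}.indicator p k ≤ ENNReal.ofReal (1 / (4 * (n + 1))))
    (y : ∀ k : ℕ, Fin (k + 1) → Bool) :
    ∃ w, p (4 * n) ≤
      4 * hiddenErr (levelPMF p hp).toMeasure A n x (4 * n) (Function.update y (4 * n) w) := by
  set ν := (levelPMF p hp).toMeasure with hν
  obtain ⟨w, hw⟩ := exists_hiddenErr_ge ν A n (x := x) (k := 4 * n) y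
  refine ⟨w, ?_⟩
  have hp1 : p (4 * n) ≤ 1 := hp ▸ ENNReal.le_tsum _
  have hhalf : ∀ j : Fin (4 * n + 1),
      1 / 2 ≤ Measure.pi (fun _ : Fin n => ν) {s | ∀ t, s t ∉ revealing (4 * n) j} := by
    intro j
    refine half_le_pi_notMem ν n _ ?_
    have h1 : ν.real {z | 4 * n < z.1} ≤ 1 / (4 * (n + 1)) := by
      refine ENNReal.toReal_le_of_le_ofReal (by positivity) ?_
      exact (levelPMF_level p hp {k | 4 * n < k}).trans_le htail
    have h2 : ν.real {(⟨4 * n, j⟩ : VCLPosition)} ≤ 1 / (4 * n + 1) := by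
      refine ENNReal.toReal_le_of_le_ofReal (by positivity) ?_
      rw [hν, levelPMF_singleton, ENNReal.ofReal_div_of_pos (by positivity), ENNReal.ofReal_one]
      refine ENNReal.div_le_div hp1 (le_of_eq ?_)
      rw [← ENNReal.ofReal_natCast]
      push_cast
      rfl
    have h3 : ν.real (revealing (4 * n) j) ≤ 1 / (4 * (n + 1)) + 1 / (4 * n + 1) :=
      (measureReal_union_le _ _).trans (add_le_add h1 h2)
    calc n * ν.real (revealing (4 * n) j)
        ≤ n * (1 / (4 * (n + 1)) + 1 / (4 * n + 1)) := by gcongr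
      _ = n / (4 * (n + 1)) + n / (4 * n + 1) := by ring
      _ ≤ 1 / 4 + 1 / 4 := by
        refine add_le_add ?_ ?_ <;> rw [div_le_div_iff₀ (by positivity) (by positivity)] <;> linarith
      _ = 1 / 2 := by norm_num
  have hle : p (4 * n) * (1 / 2) ≤ 2 * hiddenErr ν A n x (4 * n) (Function.update y (4 * n) w) := by
    refine le_trans ?_ hw
    calc p (4 * n) * (1 / 2) = ∑ j : Fin (4 * n + 1), ν {⟨4 * n, j⟩} * (1 / 2) := by
          rw [← Finset.sum_mul]
          congr 1
          simp only [hν, levelPMF_singleton]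
          rw [Finset.sum_const, Finset.card_univ, Fintype.card_fin, nsmul_eq_mul]
          exact (ENNReal.mul_div_cancel (by simp) (ENNReal.natCast_ne_top _)).symm
      _ ≤ _ := by
          gcongr with j
          exact hhalf j
  calc p (4 * n) = 2 * (p (4 * n) * (1 / 2)) := by
        rw [mul_left_comm, one_div, ENNReal.mul_inv_cancel two_ne_zero ENNReal.ofNat_ne_top, mul_one]
    _ ≤ 2 * (2 * hiddenErr ν A n x (4 * n) (Function.update y (4 * n) w)) := by gcongr
    _ = _ := by rw [← mul_assoc]; norm_num

end VCLPosition

/-- Coordinates can be chosen one after the other so as to satisfy requirements `Q k`, each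
depending only on the coordinates up to `k` and attainable by adjusting coordinate `k`. -/
theorem exists_forall_of_update {α : ℕ → Type*} [∀ k, Inhabited (α k)]
    (Q : ℕ → (∀ k, α k) → Prop)
    (hloc : ∀ k y y', (∀ i ≤ k, y i = y' i) → Q k y → Q k y')
    (hex : ∀ k y, ∃ w, Q k (Function.update y k w)) : ∃ y, ∀ k, Q k y := by
  choose w hw using hex
  let Y : ℕ → ∀ k, α k := fun k =>
    Nat.rec (fun _ => default) (fun k y => Function.update y k (w k y)) k
  have hY : ∀ k, Y (k + 1) = Function.update (Y k) k (w k (Y k)) := fun _ => rfl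
  have hstable : ∀ i k, i < k → Y k i = Y (i + 1) i := by
    intro i k hik
    induction k, hik using Nat.le_induction with
    | base => rfl
    | succ k hk ih => rw [hY, Function.update_of_ne (by omega), ih]
  refine ⟨fun k => Y (k + 1) k, fun k => hloc k (Y (k + 1)) _ (fun i hi => ?_) (hw k (Y k))⟩
  exact hstable i (k + 1) (by omega)

/-- The state of the recursion defining level masses for a rate `R`: the mass of the levels from
`k` on is `1 / (rateState R k + 1)`. -/
noncomputable def rateState (R : ℕ → ℝ) : ℕ → ℕ
  | 0 => 0
  | k + 1 => open Classical in
    if 4 ∣ k ∧ R (k / 4) ≤ 1 / (2 * (rateState R k + 1)) ∧ rateState R k ≤ k / 4 then k + 3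
    else rateState R k

theorem rateState_le_succ (R : ℕ → ℝ) (k : ℕ) : rateState R k ≤ rateState R (k + 1) := by
  rw [rateState]
  split_ifs <;> omega

theorem frequently_rateState_jump {R : ℕ → ℝ} (hR : Filter.Tendsto R Filter.atTop (nhds 0)) :
    {n : ℕ | R n ≤ 1 / (2 * (rateState R (4 * n) + 1)) ∧ rateState R (4 * n) ≤ n}.Infinite := by
  rw [Set.infinite_iff_exists_gt]
  intro a
  by_contra! hno
  have hconst : ∀ k ≥ 4 * (a + 1), rateState R k = rateState R (4 * (a + 1)) := by
    intro k hk
    induction k, hk using Nat.le_induction with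
    | base => rfl
    | succ k hk ih =>
      rw [rateState, if_neg, ih]
      rintro ⟨⟨n, rfl⟩, h⟩
      rw [Nat.mul_div_cancel_left _ (by norm_num)] at h
      exact absurd (hno n h) (by omega)
  set m := rateState R (4 * (a + 1))
  have hev : ∀ᶠ n in Filter.atTop, R n ≤ 1 / (2 * ((m : ℝ) + 1)) :=
    hR.eventually_le_const (by positivity)
  obtain ⟨n, hn, hna⟩ := (hev.and (Filter.eventually_ge_atTop (max m (a + 1)))).exists
  have hst := hconst (4 * n) (by omega)
  exact absurd (hno n ⟨by rw [hst]; exact hn, by omega⟩) (by omega)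

/-- Level masses that are at least `R n` on level `4 * n` while deeper levels have mass at most
`1 / (4 * (n + 1))`, for infinitely many `n`. -/
theorem exists_level_masses {R : ℕ → ℝ} (hR : Filter.Tendsto R Filter.atTop (nhds 0)) :
    ∃ p : ℕ → ℝ≥0∞, ∑' k, p k = 1 ∧ {n : ℕ | ENNReal.ofReal (R n) ≤ p (4 * n) ∧
      ∑' k, {k | 4 * n < k}.indicator p k ≤ ENNReal.ofReal (1 / (4 * (n + 1)))}.Infinite := by
  set t : ℕ → ℝ := fun k => 1 / ((rateState R k : ℝ) + 1) with ht
  have hmono : Monotone (rateState R) := monotone_nat_of_le_succ (rateState_le_succ R)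
  have hanti : Antitone t := fun a b hab => by
    have := hmono hab
    simp only [ht]
    gcongr
  have hnn : ∀ k, 0 ≤ t k - t (k + 1) := fun k => sub_nonneg.2 (hanti k.le_succ)
  have hfreq := frequently_rateState_jump hR
  have hjump : ∀ n, R n ≤ 1 / (2 * (rateState R (4 * n) + 1)) ∧ rateState R (4 * n) ≤ n →
      rateState R (4 * n + 1) = 4 * n + 3 := by
    intro n hn
    rw [rateState, if_pos]
    rw [Nat.mul_div_cancel_left _ (by norm_num)]
    exact ⟨dvd_mul_right _ _, hn⟩
  have hlim : Filter.Tendsto t Filter.atTop (nhds 0) := by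
    have : Filter.Tendsto (rateState R) Filter.atTop Filter.atTop := by
      refine Filter.tendsto_atTop_atTop_of_monotone hmono fun b => ?_
      obtain ⟨n, hn, hb⟩ := hfreq.exists_gt b
      exact ⟨4 * n + 1, by rw [hjump n hn]; omega⟩
    exact tendsto_one_div_add_atTop_nhds_zero_nat.comp this
  have htail : ∀ m, HasSum (fun k => t (m + k) - t (m + k + 1)) (t m) := by
    intro m
    rw [hasSum_iff_tendsto_nat_of_nonneg fun k => hnn _]
    have hs : ∀ n, ∑ k ∈ Finset.range n, (t (m + k) - t (m + k + 1)) = t m - t (m + n) :=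
      fun n => Finset.sum_range_sub' (fun k => t (m + k)) n
    simp only [hs]
    have := (hlim.comp (Filter.tendsto_add_atTop_nat m)).const_sub (t m)
    simpa [Function.comp_def, add_comm] using this
  have hsum : ∀ m, ∑' k, ENNReal.ofReal (t (m + k) - t (m + k + 1)) = ENNReal.ofReal (t m) :=
    fun m => by
      rw [← ENNReal.ofReal_tsum_of_nonneg (fun k => hnn _) (htail m).summable, (htail m).tsum_eq]
  refine ⟨fun k => ENNReal.ofReal (t k - t (k + 1)), ?_, hfreq.mono fun n hn => ⟨?_, ?_⟩⟩
  · have := hsum 0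
    simp only [zero_add] at this
    rw [this]
    simp [ht, rateState]
  · refine ENNReal.ofReal_le_ofReal (hn.1.trans ?_)
    have hj := hjump n hn
    have h2 : (rateState R (4 * n) : ℝ) ≤ n := by exact_mod_cast hn.2
    have h3 : t (4 * n + 1) ≤ 1 / (2 * (rateState R (4 * n) + 1)) := by
      simp only [ht, hj]
      push_cast
      refine one_div_le_one_div_of_le (by positivity) (by linarith)
    have h4 : t (4 * n) = 2 * (1 / (2 * (rateState R (4 * n) + 1))) := by
      simp only [ht]
      field_simp
    linarith
  · have hj := hjump n hn
    have h1 : t (4 * n + 1) = 1 / (4 * (n + 1)) := by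
      simp only [ht, hj]
      push_cast
      ring_nf
    rw [← h1, ← hsum (4 * n + 1), ← ENNReal.summable.sum_add_tsum_nat_add' (k := 4 * n + 1)]
    rw [Finset.sum_eq_zero, zero_add]
    · refine ENNReal.tsum_le_tsum fun k => ?_
      refine (Set.indicator_le_self _ _ _).trans (le_of_eq ?_)
      rw [add_comm k]
    · intro k hk
      have := Finset.mem_range.1 hk
      exact Set.indicator_of_notMem (by simp; omega) _

theorem exists_realizable_slow_rate [MeasurableSpace 𝒳] [MeasurableSingletonClass 𝒳]
    {ℋ : Set (𝒳 → Bool)} (htree : HasInfiniteVCLTree ℋ) {R : ℕ → ℝ}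
    (hR : Filter.Tendsto R Filter.atTop (nhds 0)) (A : LearningAlgorithm 𝒳) :
    ∃ P : Measure (𝒳 × Bool), IsProbabilityMeasure P ∧ Realizable ℋ P ∧
      {n : ℕ | ENNReal.ofReal (R n) ≤ 4 * expErr P A n}.Infinite := by
  obtain ⟨x, hx⟩ := htree
  obtain ⟨p, hp, hinf⟩ := exists_level_masses hR
  set ν := (VCLPosition.levelPMF p hp).toMeasure with hν
  obtain ⟨y, hy⟩ := exists_forall_of_update (α := fun k => Fin (k + 1) → Bool)
    (fun k y => ∀ n, k = 4 * n →
      ∑' k, {k | 4 * n < k}.indicator p k ≤ ENNReal.ofReal (1 / (4 * (n + 1))) →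
        p k ≤ 4 * VCLPosition.hiddenErr ν A n x k y)
    (fun k y y' h hQ n hn htail => by
      rw [← VCLPosition.hiddenErr_congr ν A n h]
      exact hQ n hn htail)
    (fun k y => by
      by_cases hk : ∃ n, k = 4 * n ∧
        ∑' k, {k | 4 * n < k}.indicator p k ≤ ENNReal.ofReal (1 / (4 * (n + 1)))
      · obtain ⟨n, rfl, htail⟩ := hk
        obtain ⟨w, hw⟩ := VCLPosition.mass_le_four_mul_hiddenErr A (x := x) p hp htail y
        refine ⟨w, fun m hm _ => ?_⟩
        obtain rfl : n = m := by omega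
        exact hw
      · exact ⟨fun _ => false, fun n hn htail => absurd ⟨n, hn, htail⟩ hk⟩)
  refine ⟨ν.map (VCLPosition.labelled x y),
    Measure.isProbabilityMeasure_map Measurable.of_discrete.aemeasurable,
    VCLPosition.realizable_map ν hx ?_ y, hinf.mono fun n hn => ?_⟩
  · refine le_antisymm (ENNReal.le_of_forall_pos_le_add fun ε hε _ => ?_) zero_le
    obtain ⟨N, hN⟩ := exists_nat_one_div_lt (NNReal.coe_pos.2 hε)
    obtain ⟨n, hn, hNn⟩ := hinf.exists_gt N
    rw [zero_add]
    refine (iInf_le _ (4 * n)).trans ?_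
    refine ((VCLPosition.levelPMF_level p hp {k | 4 * n < k}).trans_le hn.2).trans ?_
    rw [← ENNReal.ofReal_coe_nnreal]
    refine ENNReal.ofReal_le_ofReal (le_trans ?_ hN.le)
    have : (N : ℝ) ≤ n := by exact_mod_cast hNn.le
    refine one_div_le_one_div_of_le (by positivity) (by linarith)
  · refine hn.1.trans ((hy (4 * n) n rfl hn.2).trans ?_)
    gcongr
    exact VCLPosition.hiddenErr_le_expErr ν A n x (4 * n) y

/-- **Theorem 5.7 (arbitrarily slow rates).** If `ℋ` (members universally measurable) has an
infinite VCL tree, then for every rate function `R(n) → 0` and every learning algorithm there is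
a realizable distribution `P` with `E[er_P(ĥ_n)] ≥ R(n)/40` for infinitely many `n`.  In
particular, `ℋ` requires arbitrarily slow rates. -/
theorem arbitrarily_slow_rates
    (𝒳 : Type*) [TopologicalSpace 𝒳] [PolishSpace 𝒳] [MeasurableSpace 𝒳] [BorelSpace 𝒳]
    (ℋ : Set (𝒳 → Bool)) (hum : ∀ h ∈ ℋ, UniversallyMeasurable h)
    (htree : HasInfiniteVCLTree ℋ) :
    (∀ R : ℕ → ℝ, IsRate R → ∀ A : LearningAlgorithm 𝒳,
      ∃ P : MeasureTheory.Measure (𝒳 × Bool),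
        MeasureTheory.IsProbabilityMeasure P ∧ Realizable ℋ P ∧
          {n : ℕ | ENNReal.ofReal (R n / 40) ≤ expErr P A n}.Infinite) ∧
    RequiresArbitrarilySlowRates ℋ := by
  have key : ∀ R : ℕ → ℝ, IsRate R → ∀ A : LearningAlgorithm 𝒳,
      ∃ P : MeasureTheory.Measure (𝒳 × Bool),
        MeasureTheory.IsProbabilityMeasure P ∧ Realizable ℋ P ∧
          {n : ℕ | ENNReal.ofReal (R n / 40) ≤ expErr P A n}.Infinite := by
    intro R hR A
    obtain ⟨P, hP, hreal, hinf⟩ := exists_realizable_slow_rate htree hR.2 A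
    refine ⟨P, hP, hreal, hinf.mono fun n hn => ?_⟩
    have h4 : ENNReal.ofReal (R n / 4) ≤ expErr P A n := by
      rw [ENNReal.ofReal_div_of_pos four_pos, ENNReal.ofReal_ofNat]
      exact ENNReal.div_le_of_le_mul' hn
    exact (ENNReal.ofReal_le_ofReal (by linarith [(hR.1 n).1])).trans h4
  refine ⟨key, fun R hR A => ?_⟩
  obtain ⟨P, hP, hreal, hinf⟩ := key R hR A
  refine ⟨P, hP, hreal, 1 / 40, by norm_num, 1, one_pos, hinf.mono fun n hn => ?_⟩
  simpa [div_eq_inv_mul] using hn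
end
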